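/- If u ∈ P₁(0,M) and limsup_{r→0⁺} δ_r(u) > 0, then there exists ρ > 0 such that u ≥ 0 on B(0,ρ). -/

import Mathlib

open MeasureTheory Metric Set Filter
open scoped RealInnerProductSpace

noncomputable section

/-- The Laplacian of `φ` at `x`, as the sum of the pure second derivatives. -/
def lap (N : ℕ) (φ : EuclideanSpace ℝ (Fin N) → ℝ) (x : EuclideanSpace ℝ (Fin N)) : ℝ :=
  ∑ i : Fin N,
    fderiv ℝ (fun y => fderiv ℝ φ y (EuclideanSpace.single i 1)) x (EuclideanSpace.single i 1)

/-- Membership in the class `P_r(z, M)`. -/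
def MemP (N : ℕ) (r : ℝ) (z : EuclideanSpace ℝ (Fin N)) (M : ℝ)
    (Ω : Set (EuclideanSpace ℝ (Fin N))) (u : EuclideanSpace ℝ (Fin N) → ℝ) : Prop :=
  IsOpen Ω ∧ ContDiff ℝ 1 u ∧
    (∀ φ : EuclideanSpace ℝ (Fin N) → ℝ, ContDiff ℝ (⊤ : ℕ∞) φ → tsupport φ ⊆ ball z r →
      ∫ x, u x * lap N φ x = ∫ x in Ω, φ x) ∧
    (∀ x ∈ ball z r \ Ω, u x = 0 ∧ gradient u x = 0) ∧
    (∀ x ∈ ball z r, |u x| ≤ M) ∧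
    z ∈ frontier Ω

/-- Membership in the class `P_∞(0, M)` of global solutions with quadratic growth. -/
def MemPinf (N : ℕ) (M : ℝ) (Ω : Set (EuclideanSpace ℝ (Fin N)))
    (u : EuclideanSpace ℝ (Fin N) → ℝ) : Prop :=
  IsOpen Ω ∧ ContDiff ℝ 1 u ∧
    (∀ φ : EuclideanSpace ℝ (Fin N) → ℝ, ContDiff ℝ (⊤ : ℕ∞) φ → HasCompactSupport φ →
      ∫ x, u x * lap N φ x = ∫ x in Ω, φ x) ∧
    (∀ x ∈ Ωᶜ, u x = 0 ∧ gradient u x = 0) ∧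
    (0 : EuclideanSpace ℝ (Fin N)) ∈ frontier Ω ∧
    (∀ x, |u x| ≤ M * (‖x‖ ^ 2 + 1))

/-- The minimum diameter of a set: the smallest width of a slab containing it. -/
def MD (N : ℕ) (D : Set (EuclideanSpace ℝ (Fin N))) : ℝ :=
  ⨅ e : {e : EuclideanSpace ℝ (Fin N) // ‖e‖ = 1},
    ((⨆ x : D, ⟪(x : EuclideanSpace ℝ (Fin N)), (e : EuclideanSpace ℝ (Fin N))⟫) -
      ⨅ x : D, ⟪(x : EuclideanSpace ℝ (Fin N)), (e : EuclideanSpace ℝ (Fin N))⟫)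

/-- The density function `δ_r(u)`. -/
def deltaFn (N : ℕ) (u : EuclideanSpace ℝ (Fin N) → ℝ) (r : ℝ) : ℝ :=
  MD N ({x | u x = 0 ∧ gradient u x = 0} ∩ ball 0 r) / r

/-- Half-space solutions `x ↦ (max(⟪x,e⟫,0))²/2`. -/
def IsHalfSpaceSol (N : ℕ) (u : EuclideanSpace ℝ (Fin N) → ℝ) : Prop :=
  ∃ e : EuclideanSpace ℝ (Fin N), ‖e‖ = 1 ∧ ∀ x, u x = (max ⟪x, e⟫ 0) ^ 2 / 2

/-- `∂Ω ∩ B` is the graph of a `C¹` function. -/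
def IsC1Graph (N : ℕ) (Ω B : Set (EuclideanSpace ℝ (Fin N))) : Prop :=
  ∃ (e : EuclideanSpace ℝ (Fin N)) (f : EuclideanSpace ℝ (Fin N) → ℝ),
    ‖e‖ = 1 ∧ ContDiff ℝ 1 f ∧
    Ω ∩ B = {x ∈ B | f (x - ⟪x, e⟫ • e) < ⟪x, e⟫} ∧
    frontier Ω ∩ B = {x ∈ B | ⟪x, e⟫ = f (x - ⟪x, e⟫ • e)}

/-- `∂Ω ∩ B` is the graph of a real-analytic function. -/
def IsAnalyticGraph (N : ℕ) (Ω B : Set (EuclideanSpace ℝ (Fin N))) : Prop :=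
  ∃ (e : EuclideanSpace ℝ (Fin N)) (f : EuclideanSpace ℝ (Fin N) → ℝ),
    ‖e‖ = 1 ∧ (∀ x, AnalyticAt ℝ f x) ∧
    Ω ∩ B = {x ∈ B | f (x - ⟪x, e⟫ • e) < ⟪x, e⟫} ∧
    frontier Ω ∩ B = {x ∈ B | ⟪x, e⟫ = f (x - ⟪x, e⟫ • e)}

/-- The Alt–Caffarelli–Friedman functional `φ(r, v)` centered at the origin. -/
def acf (N : ℕ) (v : EuclideanSpace ℝ (Fin N) → ℝ) (r : ℝ) : ℝ :=
  r ^ (-4 : ℤ) *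
    (∫ x in ball (0 : EuclideanSpace ℝ (Fin N)) r,
      ‖gradient (fun y => max (v y) 0) x‖ ^ 2 * ‖x‖ ^ ((2 : ℤ) - (N : ℤ))) *
    ∫ x in ball (0 : EuclideanSpace ℝ (Fin N)) r,
      ‖gradient (fun y => max (-v y) 0) x‖ ^ 2 * ‖x‖ ^ ((2 : ℤ) - (N : ℤ))

/-- `S_j(z, u) = sup_{B(z, 2^{-j})} |u|`. -/
def Sj (N : ℕ) (z : EuclideanSpace ℝ (Fin N)) (u : EuclideanSpace ℝ (Fin N) → ℝ) (j : ℕ) : ℝ :=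
  sSup ((fun x => |u x|) '' ball z ((2 : ℝ) ^ (-(j : ℤ))))

set_option linter.unusedSectionVars false

section Calculus

variable {E : Type*} [NormedAddCommGroup E] [InnerProductSpace ℝ E]

/-- `v` is continuously differentiable with gradient field `g`. -/
structure IsC1 (v : E → ℝ) (g : E → E) : Prop where
  cont_grad : Continuous g
  hasFDerivAt : ∀ x, HasFDerivAt v (innerSL ℝ (g x)) x

namespace IsC1

variable {v w : E → ℝ} {g h : E → E}

theorem continuous (hv : IsC1 v g) : Continuous v :=
  continuous_iff_continuousAt.2 fun x => (hv.hasFDerivAt x).continuousAt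

theorem const_mul (hv : IsC1 v g) (c : ℝ) : IsC1 (fun x => c * v x) (fun x => c • g x) :=
  ⟨hv.cont_grad.const_smul c, fun x => by
    simpa using (hv.hasFDerivAt x).const_mul c⟩

theorem sub (hv : IsC1 v g) (hw : IsC1 w h) :
    IsC1 (fun x => v x - w x) (fun x => g x - h x) :=
  ⟨hv.cont_grad.sub hw.cont_grad, fun x => by
    exact ((hv.hasFDerivAt x).sub (hw.hasFDerivAt x)).congr_fderiv (by simp)⟩

theorem mul (hv : IsC1 v g) (hw : IsC1 w h) :
    IsC1 (fun x => v x * w x) (fun x => w x • g x + v x • h x) :=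
  ⟨(hw.continuous.smul hv.cont_grad).add (hv.continuous.smul hw.cont_grad), fun x => by
    exact ((hv.hasFDerivAt x).mul (hw.hasFDerivAt x)).congr_fderiv (by simp [add_comm])⟩

theorem comp (hv : IsC1 v g) {ψ ψ' : ℝ → ℝ} (hψ' : Continuous ψ')
    (hψ : ∀ s, HasDerivAt ψ (ψ' s) s) :
    IsC1 (fun x => ψ (v x)) (fun x => ψ' (v x) • g x) :=
  ⟨(hψ'.comp hv.continuous).smul hv.cont_grad, fun x => by
    exact ((hψ (v x)).comp_hasFDerivAt x (hv.hasFDerivAt x)).congr_fderiv (by simp)⟩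

theorem comp_affine (hv : IsC1 v g) (a : E) (t : ℝ) :
    IsC1 (fun x => v (a + t • x)) (fun x => t • g (a + t • x)) :=
  ⟨(hv.cont_grad.comp (by fun_prop)).const_smul t, fun x => by
    have h1 : HasFDerivAt (fun x : E => a + t • x) (t • ContinuousLinearMap.id ℝ E) x :=
      ((hasFDerivAt_id x).const_smul t).const_add a
    have := (hv.hasFDerivAt (a + t • x)).comp x h1
    refine this.congr_fderiv ?_
    ext y
    simp⟩

theorem hasDerivAt_line (hv : IsC1 v g) (x y : E) (t : ℝ) :
    HasDerivAt (fun t : ℝ => v (x + t • y)) ⟪g (x + t • y), y⟫ t := by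
  have h1 : HasDerivAt (fun t : ℝ => x + t • y) y t := by
    simpa using ((hasDerivAt_id t).smul_const y).const_add x
  exact ((hv.hasFDerivAt (x + t • y)).comp_hasDerivAt t h1).congr_deriv (by simp)

end IsC1

theorem hasDerivAt_max_pow (n : ℕ) (s : ℝ) :
    HasDerivAt (fun s : ℝ => max s 0 ^ (n + 2)) ((n + 2) * max s 0 ^ (n + 1)) s := by
  rcases lt_trichotomy s 0 with hs | rfl | hs
  · have : (fun s : ℝ => max s 0 ^ (n + 2)) =ᶠ[nhds s] fun _ => 0 := by
      filter_upwards [Iio_mem_nhds hs] with y hy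
      simp [max_eq_right (le_of_lt (mem_Iio.1 hy))]
    simpa [max_eq_right hs.le] using (hasDerivAt_const s (0 : ℝ)).congr_of_eventuallyEq this
  · have h := (hasDerivAt_pow (n + 2) (0 : ℝ))
    rw [hasDerivAt_iff_isLittleO_nhds_zero] at h ⊢
    simp only [zero_add, ne_eq, Nat.add_eq_zero_iff, OfNat.ofNat_ne_zero, and_false,
      not_false_eq_true, zero_pow, sub_zero, max_self, smul_eq_mul] at h ⊢
    have h' : (fun s : ℝ => s ^ (n + 2)) =o[nhds 0] fun h => h := by
      simpa using h
    have : (fun s : ℝ => max s 0 ^ (n + 2)) =o[nhds 0] fun h => h := by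
      refine (Asymptotics.IsBigO.of_bound 1 (Eventually.of_forall fun s => ?_)).trans_isLittleO h'
      rw [norm_pow, norm_pow, one_mul]
      gcongr
      rw [Real.norm_eq_abs, Real.norm_eq_abs]
      rcases le_total s 0 with hs | hs
      · rw [max_eq_right hs]; simp
      · rw [max_eq_left hs]
    simpa using this
  · have : (fun s : ℝ => max s 0 ^ (n + 2)) =ᶠ[nhds s] fun s => s ^ (n + 2) := by
      filter_upwards [Ioi_mem_nhds hs] with y hy
      simp only [max_eq_left (le_of_lt (mem_Ioi.1 hy))]
    simpa [max_eq_left hs.le] using (hasDerivAt_pow (n + 2) s).congr_of_eventuallyEq this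

theorem isC1_normSq : IsC1 (fun x : E => 1 - ‖x‖ ^ 2) (fun x => (-2 : ℝ) • x) :=
  ⟨by fun_prop, fun x => by
    have := (hasStrictFDerivAt_norm_sq x).hasFDerivAt.const_sub 1
    refine this.congr_fderiv ?_
    ext y
    simp⟩

/-- The averaging weight `(1 - ‖x‖²)₊²`. -/
def wt (x : E) : ℝ := max (1 - ‖x‖ ^ 2) 0 ^ 2

/-- The companion weight `(1 - ‖x‖²)₊³ / 3`, whose gradient is `-2 wt x • x`. -/
def zt (x : E) : ℝ := max (1 - ‖x‖ ^ 2) 0 ^ 3 / 3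

theorem isC1_wt : IsC1 (wt : E → ℝ) (fun x => (2 * max (1 - ‖x‖ ^ 2) 0) • (-2 : ℝ) • x) :=
  isC1_normSq.comp (ψ := fun s => max s 0 ^ 2) (ψ' := fun s => 2 * max s 0) (by fun_prop)
    fun s => by simpa using hasDerivAt_max_pow 0 s

theorem isC1_zt : IsC1 (zt : E → ℝ) (fun x => wt x • (-2 : ℝ) • x) :=
  isC1_normSq.comp (ψ := fun s => max s 0 ^ 3 / 3) (ψ' := fun s => max s 0 ^ 2) (by fun_prop)
    fun s => by
      have := (hasDerivAt_max_pow 1 s).div_const 3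
      exact this.congr_deriv (by push_cast; ring)

@[fun_prop] theorem continuous_wt : Continuous (wt : E → ℝ) := isC1_wt.continuous

@[fun_prop] theorem continuous_zt : Continuous (zt : E → ℝ) := isC1_zt.continuous

theorem wt_nonneg (x : E) : 0 ≤ wt x := by unfold wt; positivity

theorem zt_nonneg (x : E) : 0 ≤ zt x := by unfold zt; positivity

theorem wt_le_one (x : E) : wt x ≤ 1 := by
  unfold wt
  have : max (1 - ‖x‖ ^ 2) 0 ≤ 1 := max_le (by nlinarith [norm_nonneg x]) zero_le_one
  exact pow_le_one₀ (le_max_right _ _) this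

theorem zt_le_wt (x : E) : zt x ≤ wt x := by
  unfold zt wt
  have : max (1 - ‖x‖ ^ 2) 0 ≤ 1 := max_le (by nlinarith [norm_nonneg x]) zero_le_one
  have h0 : 0 ≤ max (1 - ‖x‖ ^ 2) 0 := le_max_right _ _
  nlinarith [sq_nonneg (max (1 - ‖x‖ ^ 2) 0)]

theorem wt_eq_zero {x : E} (hx : 1 ≤ ‖x‖) : wt x = 0 := by
  unfold wt; rw [max_eq_right (by nlinarith)]; simp

theorem zt_eq_zero {x : E} (hx : 1 ≤ ‖x‖) : zt x = 0 := by
  unfold zt; rw [max_eq_right (by nlinarith)]; simp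

theorem wt_pos {x : E} (hx : ‖x‖ < 1) : 0 < wt x := by
  unfold wt
  have : 0 < 1 - ‖x‖ ^ 2 := by nlinarith [norm_nonneg x]
  have := lt_max_of_lt_left (b := (1 - ‖x‖ ^ 2)) (c := 0) this
  positivity

theorem zt_pos {x : E} (hx : ‖x‖ < 1) : 0 < zt x := by
  unfold zt
  have : 0 < 1 - ‖x‖ ^ 2 := by nlinarith [norm_nonneg x]
  have := lt_max_of_lt_left (b := (1 - ‖x‖ ^ 2)) (c := 0) this
  positivity

theorem tsupport_wt : tsupport (wt : E → ℝ) ⊆ closedBall 0 1 :=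
  closure_minimal (fun x hx => by
    by_contra h
    exact hx (wt_eq_zero (by simpa using (not_le.1 (by simpa using h)).le))) isClosed_closedBall

theorem tsupport_zt : tsupport (zt : E → ℝ) ⊆ closedBall 0 1 :=
  closure_minimal (fun x hx => by
    by_contra h
    exact hx (zt_eq_zero (by simpa using (not_le.1 (by simpa using h)).le))) isClosed_closedBall

theorem wt_neg (x : E) : wt (-x) = wt x := by simp [wt]

theorem abs_max_sub_le (x y : E) :
    |max (1 - ‖x‖ ^ 2) 0 - max (1 - ‖y‖ ^ 2) 0| ≤ 2 * ‖x - y‖ := by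
  have key : ∀ z : E, max (1 - ‖z‖ ^ 2) 0 = 1 - min ‖z‖ 1 ^ 2 := fun z => by
    rcases le_total ‖z‖ 1 with h | h
    · rw [min_eq_left h, max_eq_left]; nlinarith [norm_nonneg z]
    · rw [min_eq_right h, max_eq_right (by nlinarith)]; norm_num
  rw [key, key]
  have h1 : |min ‖y‖ 1 - min ‖x‖ 1| ≤ ‖x - y‖ := by
    refine (abs_min_sub_min_le_max _ _ _ _).trans ?_
    simp only [sub_self, abs_zero]
    rw [max_eq_left (abs_nonneg _), norm_sub_rev]
    exact abs_norm_sub_norm_le y x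
  have h2 : |min ‖y‖ 1 + min ‖x‖ 1| ≤ 2 := by
    rw [abs_of_nonneg (by positivity)]
    linarith [min_le_right ‖y‖ 1, min_le_right ‖x‖ 1]
  calc _ = |min ‖y‖ 1 - min ‖x‖ 1| * |min ‖y‖ 1 + min ‖x‖ 1| := by rw [← abs_mul]; ring_nf
    _ ≤ ‖x - y‖ * 2 := by gcongr
    _ = _ := by ring

theorem abs_wt_sub_le (x y : E) : |wt x - wt y| ≤ 4 * ‖x - y‖ := by
  unfold wt
  set a := max (1 - ‖x‖ ^ 2) 0
  set b := max (1 - ‖y‖ ^ 2) 0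
  have h := abs_max_sub_le x y
  have ha : a ≤ 1 := max_le (by nlinarith [norm_nonneg x]) zero_le_one
  have hb : b ≤ 1 := max_le (by nlinarith [norm_nonneg y]) zero_le_one
  have ha0 : 0 ≤ a := le_max_right _ _
  have hb0 : 0 ≤ b := le_max_right _ _
  calc |a ^ 2 - b ^ 2| = |a - b| * |a + b| := by rw [← abs_mul]; ring_nf
    _ ≤ (2 * ‖x - y‖) * 2 := by
      gcongr
      rw [abs_of_nonneg (by positivity)]; linarith
    _ = _ := by ring

theorem abs_zt_sub_le (x y : E) : |zt x - zt y| ≤ 4 * ‖x - y‖ := by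
  unfold zt
  set a := max (1 - ‖x‖ ^ 2) 0
  set b := max (1 - ‖y‖ ^ 2) 0
  have h : |a - b| ≤ _ := abs_max_sub_le x y
  have ha : a ≤ 1 := max_le (by nlinarith [norm_nonneg x]) zero_le_one
  have hb : b ≤ 1 := max_le (by nlinarith [norm_nonneg y]) zero_le_one
  have ha0 : 0 ≤ a := le_max_right _ _
  have hb0 : 0 ≤ b := le_max_right _ _
  calc |a ^ 3 / 3 - b ^ 3 / 3| = |a - b| * |(a ^ 2 + a * b + b ^ 2) / 3| := by
        rw [← abs_mul]; ring_nf
    _ ≤ (2 * ‖x - y‖) * 2 := by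
      gcongr
      rw [abs_of_nonneg (by positivity)]; nlinarith
    _ = _ := by ring

variable [FiniteDimensional ℝ E]

theorem hasCompactSupport_wt : HasCompactSupport (wt : E → ℝ) := by
  have := FiniteDimensional.proper ℝ E
  exact (isCompact_closedBall _ _).of_isClosed_subset (isClosed_tsupport _) tsupport_wt

theorem hasCompactSupport_zt : HasCompactSupport (zt : E → ℝ) := by
  have := FiniteDimensional.proper ℝ E
  exact (isCompact_closedBall _ _).of_isClosed_subset (isClosed_tsupport _) tsupport_zt

variable [MeasurableSpace E] [BorelSpace E]

theorem integral_affine (x : E) {t : ℝ} (ht : 0 < t) (F : E → ℝ) :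
    ∫ y, F (x + t • y) = (t ^ Module.finrank ℝ E)⁻¹ * ∫ z, F z := by
  have h1 := Measure.integral_comp_smul (volume : Measure E) (fun z => F (x + z)) t
  rw [h1, integral_add_left_eq_self, abs_of_pos (by positivity), smul_eq_mul]

/-- The total mass of `wt`. -/
def wtMass (E : Type*) [NormedAddCommGroup E] [InnerProductSpace ℝ E] [FiniteDimensional ℝ E]
    [MeasurableSpace E] [BorelSpace E] : ℝ := ∫ x : E, wt x

/-- The total mass of `zt`. -/
def ztMass (E : Type*) [NormedAddCommGroup E] [InnerProductSpace ℝ E] [FiniteDimensional ℝ E]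
    [MeasurableSpace E] [BorelSpace E] : ℝ := ∫ x : E, zt x

theorem integrable_wt : Integrable (wt : E → ℝ) :=
  continuous_wt.integrable_of_hasCompactSupport hasCompactSupport_wt

theorem integrable_zt : Integrable (zt : E → ℝ) :=
  continuous_zt.integrable_of_hasCompactSupport hasCompactSupport_zt

theorem wtMass_pos : 0 < wtMass E :=
  continuous_wt.integral_pos_of_hasCompactSupport_nonneg_nonzero hasCompactSupport_wt
    wt_nonneg (x := 0) (wt_pos (by simp)).ne'

theorem ztMass_pos : 0 < ztMass E :=
  continuous_zt.integral_pos_of_hasCompactSupport_nonneg_nonzero hasCompactSupport_zt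
    zt_nonneg (x := 0) (zt_pos (by simp)).ne'

theorem integrable_mul_wt {h : E → ℝ} (hh : Continuous h) : Integrable fun x => h x * wt x :=
  (hh.mul continuous_wt).integrable_of_hasCompactSupport hasCompactSupport_wt.mul_left

theorem integrable_mul_zt {h : E → ℝ} (hh : Continuous h) : Integrable fun x => h x * zt x :=
  (hh.mul continuous_zt).integrable_of_hasCompactSupport hasCompactSupport_zt.mul_left

theorem integrable_bdd_mul {f w : E → ℝ} (hw : Integrable w) (hf : Measurable f) {K : ℝ}
    (hK : ∀ x, |f x| ≤ K) : Integrable fun x => f x * w x :=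
  hw.bdd_mul (c := K) hf.aestronglyMeasurable (Eventually.of_forall hK)

theorem exists_integral_abs_sub_le : ∃ L : ℝ, 0 < L ∧ ∀ h : E,
    ∫ y, |wt (y + h) - wt y| ≤ L * ‖h‖ ∧ ∫ y, |zt (y + h) - zt y| ≤ L * ‖h‖ := by
  have := FiniteDimensional.proper ℝ E
  set V := (volume : Measure E).real (closedBall (0 : E) 1) with hV
  have main : ∀ (k : E → ℝ), Continuous k → HasCompactSupport k → (∀ x : E, 1 ≤ ‖x‖ → k x = 0) →
      (∀ x y : E, |k x - k y| ≤ 4 * ‖x - y‖) → ∀ h : E,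
      ∫ y, |k (y + h) - k y| ≤ (4 * ‖h‖) * (V + V) := by
    intro k hk hkc h0 hlip h
    set S := closedBall (0 : E) 1 ∪ closedBall (-h) 1
    have hS : MeasurableSet S := (isClosed_closedBall.union isClosed_closedBall).measurableSet
    have hb1 : volume (closedBall (0 : E) 1) ≠ ⊤ := (isCompact_closedBall _ _).measure_lt_top.ne
    have hb2 : volume (closedBall (-h) 1) ≠ ⊤ := (isCompact_closedBall _ _).measure_lt_top.ne
    have hSfin : volume S ≠ ⊤ := (measure_union_lt_top hb1.lt_top hb2.lt_top).ne
    have e1 : ∫ y, |k (y + h) - k y| = ∫ y in S, |k (y + h) - k y| := by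
      refine (setIntegral_eq_integral_of_forall_compl_eq_zero fun y hy => ?_).symm
      simp only [S, mem_union, mem_closedBall, dist_eq_norm, sub_neg_eq_add, sub_zero,
        not_or, not_le] at hy
      rw [h0 _ hy.1.le, h0 _ hy.2.le]; simp
    rw [e1]
    have hle : ∫ y in S, |k (y + h) - k y| ≤ ∫ y in S, (4 * ‖h‖ : ℝ) := by
      refine setIntegral_mono_on ?_ (integrableOn_const hSfin) hS fun y _ => ?_
      · exact ContinuousOn.integrableOn_compact
          ((isCompact_closedBall _ _).union (isCompact_closedBall _ _)) (Continuous.continuousOn (by fun_prop))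
      · simpa using hlip (y + h) y
    refine hle.trans ?_
    rw [setIntegral_const, smul_eq_mul, mul_comm]
    gcongr
    calc volume.real S ≤ volume.real (closedBall (0 : E) 1) + volume.real (closedBall (-h) 1) :=
          measureReal_union_le _ _
      _ = V + V := by rw [hV, Measure.addHaar_real_closedBall_center volume (-h)]
  have hV0 : 0 ≤ V := measureReal_nonneg
  refine ⟨4 * (V + V) + 1, by positivity, fun h => ⟨?_, ?_⟩⟩
  · refine (main wt continuous_wt hasCompactSupport_wt (fun x => wt_eq_zero) abs_wt_sub_le h).trans ?_
    nlinarith [norm_nonneg h]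
  · refine (main zt continuous_zt hasCompactSupport_zt (fun x => zt_eq_zero) abs_zt_sub_le h).trans ?_
    nlinarith [norm_nonneg h]

end Calculus

section WeakLaplacian

variable {E : Type*} [NormedAddCommGroup E] [InnerProductSpace ℝ E] [FiniteDimensional ℝ E]
  [MeasurableSpace E] [BorelSpace E]

/-- The gradient field `g` has divergence `f` on `D` in the weak sense, with `f` bounded. -/
structure WeakLap (g : E → E) (f : E → ℝ) (D : Set E) : Prop where
  meas : Measurable f
  bdd : ∃ B, ∀ x, |f x| ≤ B
  weak : ∀ φ ψ, IsC1 φ ψ → HasCompactSupport φ → tsupport φ ⊆ D →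
    ∫ x, ⟪g x, ψ x⟫ = -∫ x, f x * φ x

/-- The gradient field `g` has nonnegative divergence on `D` in the weak sense. -/
def SubLap (g : E → E) (D : Set E) : Prop :=
  ∀ φ ψ, IsC1 φ ψ → HasCompactSupport φ → tsupport φ ⊆ D → (∀ x, 0 ≤ φ x) →
    ∫ x, ⟪g x, ψ x⟫ ≤ 0

theorem WeakLap.mono {g : E → E} {f : E → ℝ} {D D' : Set E} (h : WeakLap g f D) (hD : D' ⊆ D) :
    WeakLap g f D' :=
  ⟨h.meas, h.bdd, fun φ ψ h1 h2 h3 => h.weak φ ψ h1 h2 (h3.trans hD)⟩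

theorem WeakLap.subLap {g : E → E} {f : E → ℝ} {D : Set E} (h : WeakLap g f D)
    (hf : ∀ x, 0 ≤ f x) : SubLap g D := fun φ ψ h1 h2 h3 h4 => by
  rw [h.weak φ ψ h1 h2 h3, neg_nonpos]
  exact integral_nonneg fun x => mul_nonneg (hf x) (h4 x)

theorem IsC1.hasCompactSupport_grad {φ : E → ℝ} {ψ : E → E} (h : IsC1 φ ψ) :
    tsupport ψ ⊆ tsupport φ := by
  refine closure_minimal (fun x hx => ?_) (isClosed_tsupport _)
  by_contra hn
  apply hx
  have h0 : φ =ᶠ[nhds x] fun _ => 0 := notMem_tsupport_iff_eventuallyEq.1 hn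
  have := (h.hasFDerivAt x).unique ((hasFDerivAt_const (0 : ℝ) x).congr_of_eventuallyEq h0)
  have h2 := congrArg (fun L : E →L[ℝ] ℝ => L (ψ x)) this
  simpa using h2

theorem IsC1.integrable_inner {φ : E → ℝ} {ψ : E → E} (h : IsC1 φ ψ) (hc : HasCompactSupport φ)
    {g : E → E} (hg : Continuous g) : Integrable fun x => ⟪g x, ψ x⟫ := by
  refine (hg.inner h.cont_grad).integrable_of_hasCompactSupport ?_
  refine hc.of_isClosed_subset (isClosed_tsupport _) (closure_minimal (fun x hx => ?_)
    (isClosed_tsupport _))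
  apply h.hasCompactSupport_grad
  refine subset_tsupport _ fun h0 => hx ?_
  simp [h0]

theorem integrable_bdd_mul_compact {φ : E → ℝ} (hφ : Continuous φ) (hc : HasCompactSupport φ)
    {f : E → ℝ} (hf : Measurable f) (hb : ∃ B, ∀ x, |f x| ≤ B) :
    Integrable fun x => f x * φ x :=
  let ⟨_, hB⟩ := hb
  integrable_bdd_mul (hφ.integrable_of_hasCompactSupport hc) hf hB

theorem WeakLap.sub {g₁ g₂ : E → E} {f₁ f₂ : E → ℝ} {D : Set E} (h₁ : WeakLap g₁ f₁ D)
    (h₂ : WeakLap g₂ f₂ D) (hg₁ : Continuous g₁) (hg₂ : Continuous g₂) :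
    WeakLap (fun x => g₁ x - g₂ x) (fun x => f₁ x - f₂ x) D := by
  refine ⟨h₁.meas.sub h₂.meas, ?_, fun φ ψ h hc hs => ?_⟩
  · obtain ⟨B₁, hB₁⟩ := h₁.bdd
    obtain ⟨B₂, hB₂⟩ := h₂.bdd
    exact ⟨B₁ + B₂, fun x => (abs_sub _ _).trans (add_le_add (hB₁ x) (hB₂ x))⟩
  · simp only [inner_sub_left, sub_mul]
    rw [integral_sub (h.integrable_inner hc hg₁) (h.integrable_inner hc hg₂),
      integral_sub (integrable_bdd_mul_compact h.continuous hc h₁.meas h₁.bdd)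
        (integrable_bdd_mul_compact h.continuous hc h₂.meas h₂.bdd),
      h₁.weak φ ψ h hc hs, h₂.weak φ ψ h hc hs]
    ring

theorem WeakLap.const_mul {g : E → E} {f : E → ℝ} {D : Set E} (h : WeakLap g f D) (c : ℝ) :
    WeakLap (fun x => c • g x) (fun x => c * f x) D := by
  refine ⟨h.meas.const_mul c, ?_, fun φ ψ h1 hc hs => ?_⟩
  · obtain ⟨B, hB⟩ := h.bdd
    exact ⟨|c| * B, fun x => by rw [abs_mul]; gcongr; exact hB x⟩
  · simp only [real_inner_smul_left, mul_assoc]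
    rw [integral_const_mul, integral_const_mul, h.weak φ ψ h1 hc hs]
    ring

/-- The weighted average of `v` over the ball `B(x, t)`, not normalized. -/
def avg (v : E → ℝ) (t : ℝ) (x : E) : ℝ := ∫ y, v (x + t • y) * wt y

theorem hasDerivAt_integral_weight {F F' : ℝ → E → ℝ} {w : E → ℝ} (hw : Continuous w)
    (hwc : HasCompactSupport w) {U : Set ℝ} (hU : IsOpen U) {t : ℝ} (ht : t ∈ U)
    (hF : ∀ s ∈ U, Continuous (F s)) (hF' : ContinuousOn (Function.uncurry F') (U ×ˢ univ))
    (hd : ∀ s ∈ U, ∀ y, HasDerivAt (fun s => F s y) (F' s y) s) :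
    HasDerivAt (fun s => ∫ y, F s y * w y) (∫ y, F' t y * w y) t := by
  obtain ⟨ε, hε, hεU⟩ := Metric.nhds_basis_closedBall.mem_iff.1 (hU.mem_nhds ht)
  have hK : IsCompact (closedBall t ε ×ˢ tsupport w) := (isCompact_closedBall _ _).prod hwc
  obtain ⟨C, hC⟩ := hK.exists_bound_of_continuousOn
    (hF'.mono (prod_mono hεU (subset_univ _)))
  have hcont : ∀ s ∈ U, Continuous (F' s) := fun s hs => by
    have h2 := hF'.comp (f := fun y : E => (s, y)) (s := univ) (by fun_prop)
      (fun y _ => ⟨hs, mem_univ _⟩)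
    exact continuousOn_univ.1 h2
  refine (hasDerivAt_integral_of_dominated_loc_of_deriv_le (F := fun s y => F s y * w y)
    (F' := fun s y => F' s y * w y) (bound := fun y => C * ‖w y‖) (ball_mem_nhds t hε)
    ?_ ?_ ?_ ?_ ?_ ?_).2
  · filter_upwards [hU.mem_nhds ht] with s hs
    exact ((hF s hs).mul hw).aestronglyMeasurable
  · exact ((hF t ht).mul hw).integrable_of_hasCompactSupport hwc.mul_left
  · exact ((hcont t ht).mul hw).aestronglyMeasurable
  · refine Eventually.of_forall fun y s hs => ?_
    rw [norm_mul]
    by_cases hy : y ∈ tsupport w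
    · gcongr
      exact hC (s, y) ⟨ball_subset_closedBall hs, hy⟩
    · simp [image_eq_zero_of_notMem_tsupport hy]
  · exact ((hw.integrable_of_hasCompactSupport hwc).norm).const_mul C
  · refine Eventually.of_forall fun y s hs => ?_
    exact (hd s (hεU (ball_subset_closedBall hs)) y).mul_const _

theorem IsC1.hasDerivAt_avg {v : E → ℝ} {g : E → E} (hv : IsC1 v g) (x : E) (t : ℝ) :
    HasDerivAt (fun t => avg v t x) (∫ y, ⟪g (x + t • y), y⟫ * wt y) t := by
  refine hasDerivAt_integral_weight (F := fun t y => v (x + t • y))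
    (F' := fun t y => ⟪g (x + t • y), y⟫) continuous_wt hasCompactSupport_wt isOpen_univ
    (mem_univ t) (fun s _ => ?_) (Continuous.continuousOn ?_) fun s _ y => hv.hasDerivAt_line x y s
  · exact hv.continuous.comp (by fun_prop)
  · have := hv.cont_grad
    simp only [Function.uncurry_def]
    exact (this.comp (by fun_prop)).inner (by fun_prop)

theorem avg_zero (v : E → ℝ) (x : E) : avg v 0 x = wtMass E * v x := by
  simp only [avg, zero_smul, add_zero, wtMass, integral_const_mul]
  ring

/-- The test function `zt ((z - x) / t)` and its gradient. -/
theorem exists_test (x : E) {t : ℝ} (ht : 0 < t) : ∃ φ : E → ℝ, ∃ ψ : E → E, IsC1 φ ψ ∧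
    HasCompactSupport φ ∧ tsupport φ ⊆ closedBall x t ∧ (∀ z, 0 ≤ φ z) ∧
    (∀ y, φ (x + t • y) = zt y) ∧ ∀ y, ψ (x + t • y) = (-2 * t⁻¹ * wt y) • y := by
  have h := isC1_zt.comp_affine (-t⁻¹ • x) t⁻¹
  have key : ∀ y : E, -t⁻¹ • x + t⁻¹ • (x + t • y) = y := fun y => by
    rw [smul_add, smul_smul, inv_mul_cancel₀ ht.ne', one_smul, neg_smul, neg_add_cancel_left]
  have hsub : tsupport (fun z => zt (-t⁻¹ • x + t⁻¹ • z)) ⊆ closedBall x t := by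
    refine closure_minimal (fun z hz => ?_) isClosed_closedBall
    by_contra hn
    apply hz
    refine zt_eq_zero ?_
    rw [mem_closedBall, not_le, dist_eq_norm] at hn
    have : -t⁻¹ • x + t⁻¹ • z = t⁻¹ • (z - x) := by rw [smul_sub, neg_smul]; abel
    rw [this, norm_smul, norm_inv, Real.norm_of_nonneg ht.le, ← div_eq_inv_mul, le_div_iff₀ ht]
    linarith
  refine ⟨_, _, h, (isCompact_closedBall x t).of_isClosed_subset (isClosed_tsupport _) hsub, hsub,
    fun z => zt_nonneg _, fun y => ?_, fun y => ?_⟩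
  · simp only [key]
  · simp only [key, smul_smul]
    congr 1
    ring

theorem SubLap.integral_nonneg {g : E → E} {D : Set E} (h : SubLap g D) {x : E} {t : ℝ}
    (ht : 0 < t) (hD : closedBall x t ⊆ D) : 0 ≤ ∫ y, ⟪g (x + t • y), y⟫ * wt y := by
  obtain ⟨φ, ψ, h1, h2, h3, h4, -, h6⟩ := exists_test x ht
  have := h φ ψ h1 h2 (h3.trans hD) h4
  have e := integral_affine x ht fun z => ⟪g z, ψ z⟫
  simp only [h6, inner_smul_right] at e
  have e2 : ∫ y, -2 * t⁻¹ * wt y * ⟪g (x + t • y), y⟫ =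
      (-2 * t⁻¹) * ∫ y, ⟪g (x + t • y), y⟫ * wt y := by
    rw [← integral_const_mul]; congr 1; ext y; ring
  rw [e2] at e
  have h7 : (-2 * t⁻¹) * ∫ y, ⟪g (x + t • y), y⟫ * wt y ≤ 0 := by
    rw [e]; exact mul_nonpos_of_nonneg_of_nonpos (by positivity) this
  by_contra hn
  push Not at hn
  have : 0 < t⁻¹ := by positivity
  nlinarith

theorem WeakLap.integral_eq {g : E → E} {f : E → ℝ} {D : Set E} (h : WeakLap g f D) {x : E} {t : ℝ}
    (ht : 0 < t) (hD : closedBall x t ⊆ D) :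
    ∫ y, ⟪g (x + t • y), y⟫ * wt y = t / 2 * ∫ y, f (x + t • y) * zt y := by
  obtain ⟨φ, ψ, h1, h2, h3, h4, h5, h6⟩ := exists_test x ht
  have := h.weak φ ψ h1 h2 (h3.trans hD)
  have e := integral_affine x ht fun z => ⟪g z, ψ z⟫
  have e' := integral_affine x ht fun z => f z * φ z
  simp only [h6, h5, inner_smul_right] at e e'
  have e2 : ∫ y, -2 * t⁻¹ * wt y * ⟪g (x + t • y), y⟫ =
      (-2 * t⁻¹) * ∫ y, ⟪g (x + t • y), y⟫ * wt y := by
    rw [← integral_const_mul]; congr 1; ext y; ring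
  rw [e2, this, mul_neg, ← e'] at e
  field_simp at e ⊢
  linarith

theorem SubLap.le_avg {v : E → ℝ} {g : E → E} {D : Set E} (hv : IsC1 v g) (h : SubLap g D) {x : E}
    {t : ℝ} (ht : 0 ≤ t) (hD : ball x t ⊆ D) : wtMass E * v x ≤ avg v t x := by
  rw [← avg_zero]
  have hmono : MonotoneOn (fun s => avg v s x) (Icc 0 t) := by
    refine monotoneOn_of_deriv_nonneg (convex_Icc _ _)
      (fun s _ => (hv.hasDerivAt_avg x s).continuousAt.continuousWithinAt)
      (fun s _ => (hv.hasDerivAt_avg x s).differentiableAt.differentiableWithinAt) fun s hs => ?_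
    rw [interior_Icc] at hs
    rw [(hv.hasDerivAt_avg x s).deriv]
    exact h.integral_nonneg hs.1 ((closedBall_subset_ball hs.2).trans hD)
  exact hmono (left_mem_Icc.2 ht) (right_mem_Icc.2 ht) ht

theorem avg_neg (v : E → ℝ) (t : ℝ) (x : E) : avg (fun x => -1 * v x) t x = -avg v t x := by
  simp only [avg, mul_assoc, integral_const_mul]; ring

theorem WeakLap.avg_le {v : E → ℝ} {g : E → E} {f : E → ℝ} {D : Set E} (hv : IsC1 v g)
    (h : WeakLap g f D) {x : E} {t : ℝ} (ht : 0 ≤ t) (hD : ball x t ⊆ D) {K : ℝ}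
    (hK : ∀ z ∈ ball x t, f z ≤ K) :
    avg v t x ≤ wtMass E * v x + K * ztMass E * t ^ 2 / 4 := by
  have hanti : AntitoneOn (fun s => avg v s x - K * ztMass E * s ^ 2 / 4) (Icc 0 t) := by
    have hd : ∀ s, HasDerivAt (fun s => avg v s x - K * ztMass E * s ^ 2 / 4)
        ((∫ y, ⟪g (x + s • y), y⟫ * wt y) - K * ztMass E * (2 * s) / 4) s := fun s =>
      (hv.hasDerivAt_avg x s).sub
        ((((hasDerivAt_pow 2 s).const_mul (K * ztMass E)).div_const 4).congr_deriv (by simp))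
    refine antitoneOn_of_deriv_nonpos (convex_Icc _ _)
      (fun s _ => (hd s).continuousAt.continuousWithinAt)
      (fun s _ => (hd s).differentiableAt.differentiableWithinAt) fun s hs => ?_
    rw [interior_Icc] at hs
    rw [(hd s).deriv, h.integral_eq hs.1 ((closedBall_subset_ball hs.2).trans hD)]
    have : ∫ y, f (x + s • y) * zt y ≤ K * ztMass E := by
      rw [ztMass, ← integral_const_mul]
      refine integral_mono ?_ (integrable_zt.const_mul K) fun y => ?_
      · obtain ⟨B, hB⟩ := h.bdd
        exact integrable_bdd_mul integrable_zt (h.meas.comp (by fun_prop)) fun y => hB _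
      · simp only
        rcases lt_or_ge ‖y‖ 1 with hy | hy
        · refine mul_le_mul_of_nonneg_right (hK _ ?_) (zt_nonneg y)
          rw [mem_ball, dist_eq_norm, add_sub_cancel_left, norm_smul, Real.norm_of_nonneg hs.1.le]
          nlinarith [hs.1, hs.2, norm_nonneg y]
        · simp [zt_eq_zero hy]
    nlinarith [hs.1]
  have := hanti (left_mem_Icc.2 ht) (right_mem_Icc.2 ht) ht
  simp only [avg_zero] at this
  linarith

theorem WeakLap.le_avg {v : E → ℝ} {g : E → E} {f : E → ℝ} {D : Set E} (hv : IsC1 v g)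
    (h : WeakLap g f D) {x : E} {t : ℝ} (ht : 0 ≤ t) (hD : ball x t ⊆ D) {K : ℝ}
    (hK : ∀ z ∈ ball x t, K ≤ f z) :
    wtMass E * v x + K * ztMass E * t ^ 2 / 4 ≤ avg v t x := by
  have := (h.const_mul (-1)).avg_le (hv.const_mul (-1)) ht hD (K := -K)
    fun z hz => by linarith [hK z hz]
  rw [avg_neg] at this
  linarith

end WeakLaplacian

section Estimates

variable {E : Type*} [NormedAddCommGroup E] [InnerProductSpace ℝ E] [FiniteDimensional ℝ E]
  [MeasurableSpace E] [BorelSpace E]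

theorem abs_integral_translate_sub_le {k : E → ℝ} (hk : Integrable k)
    (hk0 : ∀ y : E, 1 ≤ ‖y‖ → k y = 0) {L : ℝ}
    (hL : ∀ h : E, ∫ y, |k (y + h) - k y| ≤ L * ‖h‖) {q : E → ℝ} (hq : Measurable q) {x x' : E}
    {t B : ℝ} (ht : 0 < t) (hB : ∀ z ∈ ball x t ∪ ball x' t, |q z| ≤ B) :
    |(∫ y, q (x + t • y) * k y) - ∫ y, q (x' + t • y) * k y| ≤ B * (L * (‖x - x'‖ / t)) := by
  have hB0 : 0 ≤ B := (abs_nonneg _).trans (hB x (Or.inl (mem_ball_self ht)))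
  set h := t⁻¹ • (x - x') with hh
  have mem : ∀ (a y : E), ‖y‖ < 1 → a + t • y ∈ ball a t := fun a y hy => by
    rw [mem_ball, dist_eq_norm, add_sub_cancel_left, norm_smul, Real.norm_of_nonneg ht.le]
    nlinarith
  have int : ∀ a : E, (a = x ∨ a = x') → Integrable fun y => q (a + t • y) * k y := fun a ha => by
    refine (hk.norm.const_mul B).mono' ((hq.comp (by fun_prop)).aestronglyMeasurable.mul
      hk.aestronglyMeasurable) (Eventually.of_forall fun y => ?_)
    rw [norm_mul]
    rcases lt_or_ge ‖y‖ 1 with hy | hy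
    · gcongr
      refine hB _ ?_
      rcases ha with rfl | rfl
      · exact Or.inl (mem _ y hy)
      · exact Or.inr (mem _ y hy)
    · simp [hk0 y hy]
  have hx : ∀ y : E, x' + t • (y + h) = x + t • y := fun y => by
    rw [hh, smul_add, smul_smul, mul_inv_cancel₀ ht.ne', one_smul]; abel
  have e : ∫ y, q (x' + t • y) * k y = ∫ y, q (x + t • y) * k (y + h) := by
    rw [← integral_add_right_eq_self _ h]
    simp only [hx]
  have int2 : Integrable fun y => q (x + t • y) * k (y + h) := by
    have := (int x' (Or.inr rfl)).comp_add_right h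
    simpa only [hx] using this
  rw [e, ← integral_sub (int x (Or.inl rfl)) int2, ← Real.norm_eq_abs]
  have hkh : Integrable fun y => k (y + h) := hk.comp_add_right h
  calc ‖∫ y, (q (x + t • y) * k y - q (x + t • y) * k (y + h))‖
      ≤ ∫ y, B * |k (y + h) - k y| := by
        refine norm_integral_le_of_norm_le ((hkh.sub hk).abs.const_mul B)
          (Eventually.of_forall fun y => ?_)
        rw [← mul_sub, norm_mul, Real.norm_eq_abs, Real.norm_eq_abs, abs_sub_comm (k y)]
        rcases lt_or_ge ‖y‖ 1 with hy | hy
        · gcongr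
          exact hB _ (Or.inl (mem _ y hy))
        · rcases lt_or_ge ‖y + h‖ 1 with hy' | hy'
          · gcongr
            refine hB _ (Or.inr ?_)
            rw [← hx]
            exact mem _ _ hy'
          · simp [hk0 y hy, hk0 _ hy']
    _ = B * ∫ y, |k (y + h) - k y| := integral_const_mul _ _
    _ ≤ B * (L * ‖h‖) := by gcongr; exact hL h
    _ = _ := by
      rw [hh, norm_smul, norm_inv, Real.norm_of_nonneg ht.le]
      ring

variable (E) in
/-- Interior gradient estimate for the Poisson equation. -/
theorem exists_gradient_bound : ∃ C : ℝ, 0 < C ∧ ∀ (v : E → ℝ) (g : E → E) (f : E → ℝ) (p : E)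
    (R S K t : ℝ), IsC1 v g → WeakLap g f (ball p R) → (∀ x, |f x| ≤ K) →
    (∀ x ∈ ball p R, |v x| ≤ S) → 0 < t → ∀ x ∈ ball p (R - t), ‖g x‖ ≤ C * (S / t + K * t) := by
  obtain ⟨L, hL0, hL⟩ := exists_integral_abs_sub_le (E := E)
  have hc0 := wtMass_pos (E := E)
  refine ⟨L / wtMass E, by positivity, fun v g f p R S K t hv hW hK hS ht x hx => ?_⟩
  have hK0 : 0 ≤ K := (abs_nonneg _).trans (hK 0)
  have hsub : ∀ x ∈ ball p (R - t), ball x t ⊆ ball p R := fun x hx =>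
    ball_subset_ball' (by rw [mem_ball] at hx; linarith)
  have hS0 : 0 ≤ S := (abs_nonneg _).trans (hS x (hsub x hx (mem_ball_self ht)))
  have key : ∀ x' ∈ ball p (R - t), |v x' - v x| ≤
      L / wtMass E * (S / t + K * t) * ‖x' - x‖ := by
    intro x' hx'
    have h1 := abs_integral_translate_sub_le (k := wt) integrable_wt (fun y => wt_eq_zero)
      (fun h => (hL h).1) hv.continuous.measurable (x := x') (x' := x) (B := S) ht
      (by rintro z (hz | hz)
          · exact hS z (hsub _ hx' hz)
          · exact hS z (hsub _ hx hz))
    have hd : ∀ s, HasDerivAt (fun s => avg v s x' - avg v s x)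
        ((∫ y, ⟪g (x' + s • y), y⟫ * wt y) - ∫ y, ⟪g (x + s • y), y⟫ * wt y) s := fun s =>
      (hv.hasDerivAt_avg x' s).sub (hv.hasDerivAt_avg x s)
    obtain ⟨s, hs, hs'⟩ := exists_hasDerivAt_eq_slope (fun s => avg v s x' - avg v s x) _ ht
      (fun s _ => (hd s).continuousAt.continuousWithinAt) fun s _ => hd s
    have cb : ∀ x ∈ ball p (R - t), closedBall x s ⊆ ball p R := fun x hx =>
      (closedBall_subset_ball hs.2).trans (hsub x hx)
    rw [hW.integral_eq hs.1 (cb x' hx'), hW.integral_eq hs.1 (cb x hx), ← mul_sub,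
      avg_zero, avg_zero, eq_div_iff (by simpa using ht.ne')] at hs'
    have h2 := abs_integral_translate_sub_le (k := zt) integrable_zt (fun y => zt_eq_zero)
      (fun h => (hL h).2) hW.meas (x := x') (x' := x) (B := K) hs.1 fun z _ => hK z
    set I := (∫ y, f (x' + s • y) * zt y) - ∫ y, f (x + s • y) * zt y
    set A := avg v t x' - avg v t x
    have h1' : |A| ≤ S * (L * (‖x' - x‖ / t)) := h1
    have h3 : wtMass E * (v x' - v x) = A - s / 2 * I * t := by linarith
    have h4 : wtMass E * |v x' - v x| ≤ S * (L * (‖x' - x‖ / t)) + K * L * ‖x' - x‖ * t := by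
      rw [show wtMass E * |v x' - v x| = |wtMass E * (v x' - v x)| by
        rw [abs_mul, abs_of_pos hc0], h3]
      refine (abs_sub _ _).trans (add_le_add h1' ?_)
      rw [abs_mul, abs_mul, abs_of_pos ht, abs_of_pos (half_pos hs.1)]
      have : s / 2 * |I| ≤ K * L * ‖x' - x‖ := by
        calc s / 2 * |I| ≤ s / 2 * (K * (L * (‖x' - x‖ / s))) := by
              have := hs.1.le; gcongr
          _ = K * L * ‖x' - x‖ / 2 := by have := hs.1.ne'; field_simp
          _ ≤ _ := by
            have : 0 ≤ K * L * ‖x' - x‖ := by positivity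
            linarith
      gcongr
    rw [← mul_le_mul_iff_right₀ hc0]
    refine h4.trans (le_of_eq ?_)
    field_simp
  have := (hv.hasFDerivAt x).le_of_lip' (C := L / wtMass E * (S / t + K * t)) (by positivity) (by
    filter_upwards [isOpen_ball.mem_nhds hx] with x' hx'
    exact key x' hx')
  simpa using this

theorem WeakLap.abs_le_integral {v : E → ℝ} {g : E → E} {f : E → ℝ} {x : E} {K : ℝ} (hv : IsC1 v g)
    (h : WeakLap g f (ball x 1)) (hK : ∀ z, |f z| ≤ K) :
    wtMass E * |v x| ≤ (∫ y, v (x + y) ^ 2 * wt y) + wtMass E + K * ztMass E := by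
  have hu := h.avg_le hv zero_le_one subset_rfl (K := K) fun z _ => (abs_le.1 (hK z)).2
  have hl := h.le_avg hv zero_le_one subset_rfl (K := -K) fun z _ => (abs_le.1 (hK z)).1
  have hK0 : 0 ≤ K := (abs_nonneg _).trans (hK 0)
  have hz := ztMass_pos (E := E)
  have hc := hv.continuous
  have ha : |avg v 1 x| ≤ (∫ y, v (x + y) ^ 2 * wt y) + wtMass E := by
    rw [wtMass, ← integral_add (integrable_mul_wt (by fun_prop)) integrable_wt, ← Real.norm_eq_abs]
    refine norm_integral_le_of_norm_le ((integrable_mul_wt (by fun_prop)).add integrable_wt)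
      (Eventually.of_forall fun y => ?_)
    rw [one_smul, norm_mul, Real.norm_of_nonneg (wt_nonneg y), Real.norm_eq_abs]
    have : |v (x + y)| ≤ v (x + y) ^ 2 + 1 := by
      rw [← sq_abs]; nlinarith [abs_nonneg (v (x + y))]
    nlinarith [wt_nonneg y]
  rw [show wtMass E * |v x| = |wtMass E * v x| by
    rw [abs_mul, abs_of_pos (wtMass_pos (E := E))], abs_le]
  rw [abs_le] at ha
  have hKz : 0 ≤ K * ztMass E := by positivity
  constructor <;> nlinarith [ha.1, ha.2]

theorem IsC1.abs_sub_le {v : E → ℝ} {g : E → E} (hv : IsC1 v g) {s : Set E} (hs : Convex ℝ s)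
    {G : ℝ} (hG : ∀ x ∈ s, ‖g x‖ ≤ G) {x y : E} (hx : x ∈ s) (hy : y ∈ s) :
    |v y - v x| ≤ G * ‖y - x‖ :=
  hs.norm_image_sub_le_of_norm_hasFDerivWithin_le (f := v)
    (fun z _ => (hv.hasFDerivAt z).hasFDerivWithinAt)
    (fun z hz => by simpa using hG z hz) hx hy

/-- Convergence, uniform on balls, of functions together with their gradients. -/
def LocConv (v : ℕ → E → ℝ) (g : ℕ → E → E) (v₀ : E → ℝ) (g₀ : E → E) : Prop :=
  ∀ R ε : ℝ, 0 < ε → ∀ᶠ j in atTop, ∀ x, ‖x‖ ≤ R → |v j x - v₀ x| < ε ∧ ‖g j x - g₀ x‖ < ε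

theorem LocConv.tendsto {v : ℕ → E → ℝ} {g : ℕ → E → E} {v₀ : E → ℝ} {g₀ : E → E}
    (h : LocConv v g v₀ g₀) (x : E) : Tendsto (fun j => v j x) atTop (nhds (v₀ x)) :=
  Metric.tendsto_nhds.2 fun ε hε => (h ‖x‖ ε hε).mono fun _ hj => (hj x le_rfl).1

theorem LocConv.tendsto_grad {v : ℕ → E → ℝ} {g : ℕ → E → E} {v₀ : E → ℝ} {g₀ : E → E}
    (h : LocConv v g v₀ g₀) (x : E) : Tendsto (fun j => g j x) atTop (nhds (g₀ x)) :=
  Metric.tendsto_nhds.2 fun ε hε => (h ‖x‖ ε hε).mono fun j hj => by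
    rw [dist_eq_norm]; exact (hj x le_rfl).2

theorem LocConv.isC1 {v : ℕ → E → ℝ} {g : ℕ → E → E} {v₀ : E → ℝ} {g₀ : E → E}
    (h : LocConv v g v₀ g₀) (hv : ∀ j, IsC1 (v j) (g j)) : IsC1 v₀ g₀ := by
  have hu : ∀ R, TendstoUniformlyOn g g₀ atTop (ball 0 R) := fun R => by
    rw [Metric.tendstoUniformlyOn_iff]
    intro ε hε
    filter_upwards [h R ε hε] with j hj x hx
    rw [dist_comm, dist_eq_norm]
    exact (hj x (by simpa using (mem_ball_zero_iff.1 hx).le)).2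
  have hmem : ∀ x : E, x ∈ ball (0 : E) (‖x‖ + 1) := fun x => by simp
  refine ⟨continuous_iff_continuousAt.2 fun x => ?_, fun x => ?_⟩
  · exact ((hu (‖x‖ + 1)).continuousOn (Eventually.of_forall fun j =>
      (hv j).cont_grad.continuousOn).frequently).continuousAt (isOpen_ball.mem_nhds (hmem x))
  · refine hasFDerivAt_of_tendstoUniformlyOn (l := atTop) (f := v)
      (f' := fun j x => innerSL ℝ (g j x)) (g' := fun x => innerSL ℝ (g₀ x)) isOpen_ball
      ?_ (fun j x _ => (hv j).hasFDerivAt x) (fun x _ => h.tendsto x) (hmem x)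
    rw [Metric.tendstoUniformlyOn_iff]
    intro ε hε
    filter_upwards [h (‖x‖ + 1) ε hε] with j hj z hz
    rw [dist_comm, dist_eq_norm, ← map_sub, innerSL_apply_norm]
    exact (hj z (mem_ball_zero_iff.1 hz).le).2

theorem exists_limit {v : ℕ → E → ℝ} {g : ℕ → E → E} {f : ℕ → E → ℝ} (hv : ∀ j, IsC1 (v j) (g j))
    (hf : ∀ᶠ j in atTop, ∀ x, |f j x| ≤ 1)
    (hb : ∀ R : ℝ, ∃ S, ∀ᶠ j in atTop, WeakLap (g j) (f j) (ball 0 R) ∧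
      ∀ x ∈ ball (0 : E) R, |v j x| ≤ S) :
    ∃ (σ : ℕ → ℕ) (v₀ : E → ℝ) (g₀ : E → E), Tendsto σ atTop atTop ∧ IsC1 v₀ g₀ ∧
      LocConv (fun j => v (σ j)) (fun j => g (σ j)) v₀ g₀ := by
  obtain ⟨C, hC, hgrad⟩ := exists_gradient_bound E
  set U : Ultrafilter ℕ := hyperfilter ℕ
  have hU : (U : Filter ℕ) ≤ atTop := Nat.hyperfilter_le_atTop
  have hmem : ∀ x : E, x ∈ ball (0 : E) (‖x‖ + 1) := fun x => by simp
  have hbg : ∀ R : ℝ, ∃ G, 0 ≤ G ∧ ∀ᶠ j in atTop, ∀ x ∈ ball (0 : E) R, ‖g j x‖ ≤ G := fun R => by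
    obtain ⟨S, hS⟩ := hb (R + 1)
    refine ⟨C * (|S| / 1 + 1 * 1), by positivity, ?_⟩
    filter_upwards [hS, hf] with j hj hfj x hx
    exact hgrad (v j) (g j) (f j) 0 (R + 1) |S| 1 1 (hv j) hj.1 hfj
      (fun x hx => (hj.2 x hx).trans (le_abs_self S)) one_pos x (by simpa using hx)
  have hlim : ∀ x, ∃ a, Tendsto (fun j => v j x) U (nhds a) := fun x => by
    obtain ⟨S, hS⟩ := hb (‖x‖ + 1)
    obtain ⟨a, -, ha⟩ := (isCompact_closedBall (0 : ℝ) S).ultrafilter_le_nhds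
      (U.map fun j => v j x) (by
        rw [le_principal_iff]
        refine hU ?_
        filter_upwards [hS] with j hj
        simpa using hj.2 x (hmem x))
    exact ⟨a, ha⟩
  choose v₀ hv₀ using hlim
  have hglim : ∀ x, ∃ a, Tendsto (fun j => g j x) U (nhds a) := fun x => by
    obtain ⟨G, -, hG⟩ := hbg (‖x‖ + 1)
    obtain ⟨a, -, ha⟩ := (isCompact_closedBall (0 : E) G).ultrafilter_le_nhds
      (U.map fun j => g j x) (by
        rw [le_principal_iff]
        refine hU ?_
        filter_upwards [hG] with j hj
        simpa using hj x (hmem x))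
    exact ⟨a, ha⟩
  choose g₀ hg₀ using hglim
  have hunif : ∀ R η : ℝ, 0 < η → ∀ᶠ j in (U : Filter ℕ), ∀ x ∈ ball (0 : E) R,
      |v j x - v₀ x| ≤ η := by
    intro R η hη
    obtain ⟨G, hG0, hG⟩ := hbg (R + 1)
    have hlip : ∀ᶠ j in atTop, ∀ x ∈ ball (0 : E) (R + 1), ∀ y ∈ ball (0 : E) (R + 1),
        |v j y - v j x| ≤ G * ‖y - x‖ := by
      filter_upwards [hG] with j hj x hx y hy
      exact (hv j).abs_sub_le (convex_ball _ _) hj hx hy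
    have hlip0 : ∀ x ∈ ball (0 : E) (R + 1), ∀ y ∈ ball (0 : E) (R + 1),
        |v₀ y - v₀ x| ≤ G * ‖y - x‖ := fun x hx y hy =>
      le_of_tendsto (((hv₀ y).sub (hv₀ x)).abs) ((hlip.filter_mono hU).mono fun j hj => hj x hx y hy)
    obtain ⟨T, hTs, hTf, hT⟩ := finite_cover_balls_of_compact (isCompact_closedBall (0 : E) R)
      (e := η / (3 * (G + 1))) (by positivity)
    have hnet : ∀ᶠ j in (U : Filter ℕ), ∀ y ∈ T, |v j y - v₀ y| < η / 3 :=
      (eventually_all_finite hTf).2 fun y _ => by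
        have := Metric.tendsto_nhds.1 (hv₀ y) (η / 3) (by positivity)
        simpa [Real.dist_eq] using this
    filter_upwards [hnet, hU hlip] with j hj hl x hx
    obtain ⟨y, hyT, hxy⟩ := mem_iUnion₂.1 (hT (ball_subset_closedBall hx))
    have hx' : x ∈ ball (0 : E) (R + 1) := ball_subset_ball (by linarith) hx
    have hy' : y ∈ ball (0 : E) (R + 1) :=
      closedBall_subset_ball (by linarith) (hTs hyT)
    have hn : G * ‖x - y‖ ≤ η / 3 := by
      rw [mem_ball, dist_eq_norm] at hxy
      calc G * ‖x - y‖ ≤ (G + 1) * (η / (3 * (G + 1))) := by gcongr; linarith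
        _ = η / 3 := by field_simp
    have a1 := hl y hy' x hx'
    have a2 := hlip0 y hy' x hx'
    have a3 := (hj y hyT).le
    rw [abs_le] at *
    constructor <;> linarith [a1.1, a1.2, a2.1, a2.2, a3.1, a3.2]
  have hgunif : ∀ R ε : ℝ, 0 < ε → ∀ᶠ j in (U : Filter ℕ), ∀ x ∈ ball (0 : E) R,
      ‖g j x - g₀ x‖ ≤ ε := by
    intro R ε hε
    set t : ℝ := min 1 (ε / (4 * C)) with ht
    have ht0 : 0 < t := lt_min one_pos (by positivity)
    have ht1 : t ≤ 1 := min_le_left _ _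
    have htε : C * (2 * t) ≤ ε / 2 := by
      have : t ≤ ε / (4 * C) := min_le_right _ _
      calc C * (2 * t) ≤ C * (2 * (ε / (4 * C))) := by gcongr
        _ = ε / 2 := by field_simp; norm_num
    set η := ε * t / (4 * C) with hη
    have hη0 : 0 < η := by positivity
    obtain ⟨S, hS⟩ := hb (R + 1)
    have hev : ∀ᶠ j in (U : Filter ℕ), (∀ x, |f j x| ≤ 1) ∧ WeakLap (g j) (f j) (ball 0 (R + 1)) ∧
        ∀ x ∈ ball (0 : E) (R + 1), |v j x - v₀ x| ≤ η := by
      filter_upwards [hU hf, hU hS, hunif (R + 1) η hη0] with j h1 h2 h3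
      exact ⟨h1, h2.1, h3⟩
    filter_upwards [hev] with j hj x hx
    refine le_of_tendsto ((tendsto_const_nhds.sub (hg₀ x)).norm) ?_
    filter_upwards [hev] with k hk
    have := hgrad (fun x => v j x - v k x) (fun x => g j x - g k x) (fun x => f j x - f k x) 0
      (R + 1) (2 * η) 2 t ((hv j).sub (hv k))
      (hj.2.1.sub hk.2.1 (hv j).cont_grad (hv k).cont_grad)
      (fun x => (abs_sub _ _).trans (by linarith [hj.1 x, hk.1 x]))
      (fun x hx => by
        have a1 := hj.2.2 x hx
        have a2 := hk.2.2 x hx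
        rw [abs_le] at *
        constructor <;> linarith [a1.1, a1.2, a2.1, a2.2]) ht0 x
      (ball_subset_ball (by linarith) hx)
    refine this.trans ?_
    have e : C * (2 * η / t) = ε / 2 := by rw [hη]; field_simp; norm_num
    linarith
  have hsel : ∀ n : ℕ, ∃ j, n ≤ j ∧ ∀ x ∈ ball (0 : E) n, |v j x - v₀ x| ≤ 1 / (n + 1) ∧
      ‖g j x - g₀ x‖ ≤ 1 / (n + 1) := fun n => by
    have h0 : (0 : ℝ) < 1 / (n + 1) := by positivity
    obtain ⟨j, h1, h2, h3⟩ := (((eventually_ge_atTop n).filter_mono hU).and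
      ((hunif n _ h0).and (hgunif n _ h0))).exists
    exact ⟨j, h1, fun x hx => ⟨h2 x hx, h3 x hx⟩⟩
  choose σ hσ hσ' using hsel
  have hconv : LocConv (fun j => v (σ j)) (fun j => g (σ j)) v₀ g₀ := by
    intro R ε hε
    have h1 := (tendsto_one_div_add_atTop_nhds_zero_nat (𝕜 := ℝ)).eventually (gt_mem_nhds hε)
    filter_upwards [h1, eventually_gt_atTop ⌈R⌉₊] with n hn hnR x hx
    have hx' : x ∈ ball (0 : E) n := by
      rw [mem_ball_zero_iff]
      exact hx.trans_lt ((Nat.le_ceil R).trans_lt (by exact_mod_cast hnR))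
    exact ⟨(hσ' n x hx').1.trans_lt hn, (hσ' n x hx').2.trans_lt hn⟩
  exact ⟨σ, v₀, g₀, tendsto_atTop_mono hσ tendsto_id, hconv.isC1 fun j => hv _, hconv⟩

end Estimates

section Weiss

variable {E : Type*} [NormedAddCommGroup E] [InnerProductSpace ℝ E] [FiniteDimensional ℝ E]
  [MeasurableSpace E] [BorelSpace E]

/-- The quadratic rescaling `v (r x) / r²`. -/
def sc (r : ℝ) (v : E → ℝ) (x : E) : ℝ := (r ^ 2)⁻¹ * v (r • x)

/-- The gradient of the quadratic rescaling. -/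
def scg (r : ℝ) (g : E → E) (x : E) : E := r⁻¹ • g (r • x)

theorem IsC1.sc {v : E → ℝ} {g : E → E} (hv : IsC1 v g) (r : ℝ) : IsC1 (sc r v) (scg r g) := by
  have h := (hv.comp_affine 0 r).const_mul (r ^ 2)⁻¹
  have e1 : (fun x => (r ^ 2)⁻¹ * v (0 + r • x)) = _root_.sc r v := by
    ext x; simp [_root_.sc]
  have e2 : (fun x => (r ^ 2)⁻¹ • r • g (0 + r • x)) = scg r g := by
    ext x
    rw [scg, zero_add, smul_smul]
    congr 1
    rcases eq_or_ne r 0 with rfl | hr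
    · simp
    · field_simp
  rwa [e1, e2] at h

theorem sc_sc (t r : ℝ) (v : E → ℝ) : sc t (sc r v) = sc (t * r) v := by
  ext x
  simp only [sc, smul_smul, mul_pow, mul_inv, mul_comm r t]
  ring

theorem scg_scg (t r : ℝ) (g : E → E) : scg t (scg r g) = scg (t * r) g := by
  ext x
  simp only [scg, smul_smul, mul_inv, mul_comm r t]

theorem WeakLap.sc {g : E → E} {f : E → ℝ} {R : ℝ} (h : WeakLap g f (ball 0 R)) {r : ℝ}
    (hr : 0 < r) : WeakLap (scg r g) (fun x => f (r • x)) (ball 0 (R / r)) := by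
  obtain ⟨B, hB⟩ := h.bdd
  refine ⟨h.meas.comp (by fun_prop), ⟨B, fun x => hB _⟩, fun φ ψ hφ hc hs => ?_⟩
  have h' := hφ.comp_affine 0 r⁻¹
  have hcont : Continuous fun y : E => r • y := by fun_prop
  have hK : IsCompact ((fun y : E => r • y) '' tsupport φ) := hc.image hcont
  have hsub : tsupport (fun x => φ (0 + r⁻¹ • x)) ⊆ (fun y : E => r • y) '' tsupport φ := by
    refine closure_minimal (fun x hx => ⟨r⁻¹ • x, subset_tsupport _ ?_, ?_⟩) hK.isClosed
    · simpa using hx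
    · simp [smul_smul, hr.ne']
  have hsub' : (fun y : E => r • y) '' tsupport φ ⊆ ball 0 R := by
    rintro _ ⟨y, hy, rfl⟩
    have := hs hy
    rw [mem_ball_zero_iff, lt_div_iff₀ hr] at this
    simp only [mem_ball_zero_iff, norm_smul, Real.norm_of_nonneg hr.le]
    linarith
  have key := h.weak _ _ h' (hK.of_isClosed_subset (isClosed_tsupport _) hsub)
    (hsub.trans hsub')
  have e1 := integral_affine 0 hr fun x => ⟪g x, r⁻¹ • ψ (0 + r⁻¹ • x)⟫
  have e2 := integral_affine 0 hr fun x => f x * φ (0 + r⁻¹ • x)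
  simp only [zero_add, smul_smul, inv_mul_cancel₀ hr.ne', one_smul] at e1 e2 key
  rw [key, mul_neg, ← e2] at e1
  simpa only [scg, real_inner_smul_left, real_inner_smul_right] using e1

/-- The deviation `x · ∇v - 2 v` from homogeneity of degree two. -/
def zf (v : E → ℝ) (g : E → E) (x : E) : ℝ := ⟪g x, x⟫ - 2 * v x

/-- The weighted square norm of `v`. -/
def hN (v : E → ℝ) : ℝ := ∫ x, v x ^ 2 * wt x

/-- The weighted Weiss energy. -/
def weiss (m : ℝ) (v : E → ℝ) (g : E → E) : ℝ :=
  ∫ x, ((‖g x‖ ^ 2 + m * v x) * zt x - 4 * v x ^ 2 * wt x)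

theorem IsC1.continuous_zf {v : E → ℝ} {g : E → E} (hv : IsC1 v g) : Continuous (zf v g) := by
  have h1 := hv.continuous
  have h2 := hv.cont_grad
  unfold zf
  exact (h2.inner continuous_id).sub (by fun_prop)

theorem hN_nonneg (v : E → ℝ) : 0 ≤ hN v :=
  integral_nonneg fun x => mul_nonneg (sq_nonneg _) (wt_nonneg x)

theorem IsC1.integrable_weiss {v : E → ℝ} {g : E → E} (hv : IsC1 v g) (m : ℝ) :
    Integrable fun x => (‖g x‖ ^ 2 + m * v x) * zt x - 4 * v x ^ 2 * wt x := by
  have h1 := hv.continuous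
  have h2 := hv.cont_grad
  exact (integrable_mul_zt (by fun_prop)).sub (integrable_mul_wt (by fun_prop))

theorem mul_zt_hasCompactSupport (v : E → ℝ) : HasCompactSupport fun x => v x * zt x :=
  hasCompactSupport_zt.mul_left

theorem tsupport_mul_zt (v : E → ℝ) : tsupport (fun x => v x * zt x) ⊆ closedBall 0 1 :=
  (tsupport_mul_subset_right).trans tsupport_zt

theorem weiss_sub_weiss {v₁ v₂ : E → ℝ} {g₁ g₂ : E → E} {f₁ f₂ : E → ℝ} {D : Set E}
    (h₁ : IsC1 v₁ g₁) (h₂ : IsC1 v₂ g₂) (w₁ : WeakLap g₁ f₁ D) (w₂ : WeakLap g₂ f₂ D)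
    (hD : closedBall 0 1 ⊆ D) :
    weiss 2 v₂ g₂ - weiss 2 v₁ g₁ = ∫ x, (v₂ x - v₁ x) *
      ((2 - f₁ x - f₂ x) * zt x + 2 * (zf v₂ g₂ x + zf v₁ g₁ x) * wt x) := by
  have hφ := (h₂.sub h₁).mul isC1_zt
  have hc := mul_zt_hasCompactSupport fun x : E => v₂ x - v₁ x
  have hs := (tsupport_mul_zt fun x : E => v₂ x - v₁ x).trans hD
  have k₁ := w₁.weak _ _ hφ hc hs
  have k₂ := w₂.weak _ _ hφ hc hs
  have i₁ := hφ.integrable_inner hc h₁.cont_grad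
  have i₂ := hφ.integrable_inner hc h₂.cont_grad
  have j₁ := integrable_bdd_mul_compact hφ.continuous hc w₁.meas w₁.bdd
  have j₂ := integrable_bdd_mul_compact hφ.continuous hc w₂.meas w₂.bdd
  have e : ∀ x, (v₂ x - v₁ x) * ((2 - f₁ x - f₂ x) * zt x + 2 * (zf v₂ g₂ x + zf v₁ g₁ x) * wt x) =
      (((‖g₂ x‖ ^ 2 + 2 * v₂ x) * zt x - 4 * v₂ x ^ 2 * wt x) -
      ((‖g₁ x‖ ^ 2 + 2 * v₁ x) * zt x - 4 * v₁ x ^ 2 * wt x)) -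
      ((⟪g₁ x, zt x • (g₂ x - g₁ x) + (v₂ x - v₁ x) • wt x • (-2 : ℝ) • x⟫ +
        f₁ x * ((v₂ x - v₁ x) * zt x)) +
      (⟪g₂ x, zt x • (g₂ x - g₁ x) + (v₂ x - v₁ x) • wt x • (-2 : ℝ) • x⟫ +
        f₂ x * ((v₂ x - v₁ x) * zt x))) := fun x => by
    simp only [zf, inner_add_right, inner_smul_right, inner_sub_right, real_inner_self_eq_norm_sq,
      real_inner_comm (g₁ x) (g₂ x)]
    ring
  simp only [e]
  rw [integral_sub ((h₂.integrable_weiss 2).sub' (h₁.integrable_weiss 2))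
    ((i₁.fun_add j₁).fun_add (i₂.fun_add j₂)), integral_sub (h₂.integrable_weiss 2) (h₁.integrable_weiss 2),
    integral_add (i₁.fun_add j₁) (i₂.fun_add j₂), integral_add i₁ j₁, integral_add i₂ j₂, k₁, k₂]
  simp [weiss]

theorem weiss_eq {v : E → ℝ} {g : E → E} {f : E → ℝ} {D : Set E} (h : IsC1 v g)
    (w : WeakLap g f D) (hD : closedBall 0 1 ⊆ D) (m : ℝ) :
    weiss m v g = ∫ x, ((m - f x) * v x * zt x + 2 * v x * zf v g x * wt x) := by
  have hφ := h.mul isC1_zt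
  have hc := mul_zt_hasCompactSupport v
  have hs := (tsupport_mul_zt v).trans hD
  have k := w.weak _ _ hφ hc hs
  have i := hφ.integrable_inner hc h.cont_grad
  have j := integrable_bdd_mul_compact hφ.continuous hc w.meas w.bdd
  have e : ∀ x, (m - f x) * v x * zt x + 2 * v x * zf v g x * wt x =
      ((‖g x‖ ^ 2 + m * v x) * zt x - 4 * v x ^ 2 * wt x) -
      (⟪g x, zt x • g x + v x • wt x • (-2 : ℝ) • x⟫ + f x * (v x * zt x)) := fun x => by
    simp only [zf, inner_add_right, inner_smul_right, real_inner_self_eq_norm_sq]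
    ring
  simp only [e]
  rw [integral_sub (h.integrable_weiss m) (i.fun_add j), integral_add i j, k]
  simp [weiss]

theorem IsC1.hasDerivAt_sc {v : E → ℝ} {g : E → E} (hv : IsC1 v g) {s : ℝ} (hs : 0 < s) (x : E) :
    HasDerivAt (fun s => _root_.sc s v x) (s⁻¹ * zf (_root_.sc s v) (scg s g) x) s := by
  have h1 := hv.hasDerivAt_line 0 x s
  simp only [zero_add] at h1
  have h2 := ((hasDerivAt_pow 2 s).inv (by positivity)).mul h1
  refine h2.congr_deriv ?_
  simp only [zf, scg, _root_.sc, real_inner_smul_left, Pi.inv_apply]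
  field_simp
  ring

theorem IsC1.continuousOn_sc {v : E → ℝ} {g : E → E} (hv : IsC1 v g) :
    ContinuousOn (fun p : ℝ × E => _root_.sc p.1 v p.2) (Ioi 0 ×ˢ univ) := by
  have := hv.continuous
  refine ContinuousOn.mul (ContinuousOn.inv₀ (by fun_prop) fun p hp => ?_) (by fun_prop)
  have : p.1 ≠ 0 := (mem_Ioi.1 hp.1).ne'
  positivity

theorem IsC1.continuousOn_zf_sc {v : E → ℝ} {g : E → E} (hv : IsC1 v g) :
    ContinuousOn (fun p : ℝ × E => zf (_root_.sc p.1 v) (scg p.1 g) p.2) (Ioi 0 ×ˢ univ) := by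
  have := hv.cont_grad
  refine ContinuousOn.sub (ContinuousOn.inner (𝕜 := ℝ) (ContinuousOn.smul (ContinuousOn.inv₀
    (by fun_prop) fun p hp => (mem_Ioi.1 hp.1).ne') (by fun_prop)) (by fun_prop)) ?_
  exact continuousOn_const.mul hv.continuousOn_sc

theorem IsC1.continuousOn_deriv_sc {v : E → ℝ} {g : E → E} (hv : IsC1 v g) :
    ContinuousOn (fun p : ℝ × E => p.1⁻¹ * zf (_root_.sc p.1 v) (scg p.1 g) p.2)
      (Ioi 0 ×ˢ univ) :=
  (ContinuousOn.inv₀ (by fun_prop) fun p hp => (mem_Ioi.1 hp.1).ne').mul hv.continuousOn_zf_sc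

theorem IsC1.hasDerivAt_hN {v : E → ℝ} {g : E → E} (hv : IsC1 v g) {s : ℝ} (hs : 0 < s) :
    HasDerivAt (fun s => hN (_root_.sc s v))
      (s⁻¹ * ∫ x, 2 * _root_.sc s v x * zf (_root_.sc s v) (scg s g) x * wt x) s := by
  have := hasDerivAt_integral_weight (F := fun s x => _root_.sc s v x ^ 2)
    (F' := fun s x => 2 * _root_.sc s v x * (s⁻¹ * zf (_root_.sc s v) (scg s g) x))
    continuous_wt hasCompactSupport_wt isOpen_Ioi hs
    (fun s _ => (hv.sc s).continuous.pow 2)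
    ((continuousOn_const.fun_mul hv.continuousOn_sc).fun_mul hv.continuousOn_deriv_sc)
    fun s hs y => ((hv.hasDerivAt_sc hs y).pow 2).congr_deriv (by simp)
  refine this.congr_deriv ?_
  rw [← integral_const_mul]
  congr 1; ext x; ring

/-- A solution of the no-sign obstacle problem in the unit ball. -/
structure Sol (u : E → ℝ) (g : E → E) (Ω : Set E) : Prop where
  isOpen : IsOpen Ω
  isC1 : IsC1 u g
  weak : WeakLap g (Ω.indicator 1) (ball 0 1)
  zero : ∀ x ∈ ball (0 : E) 1, x ∉ Ω → u x = 0 ∧ g x = 0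

theorem indicator_one_abs_le (Ω : Set E) (x : E) : |Ω.indicator (1 : E → ℝ) x| ≤ 1 := by
  by_cases h : x ∈ Ω <;> simp [h]

theorem Sol.weak_sc {u : E → ℝ} {g : E → E} {Ω : Set E} (h : Sol u g Ω) {r : ℝ} (hr : 0 < r) :
    WeakLap (scg r g) (fun x => Ω.indicator (1 : E → ℝ) (r • x)) (ball 0 (1 / r)) := h.weak.sc hr

theorem smul_mem_ball_one {r : ℝ} (hr : 0 < r) (hr1 : r < 1) {x : E} (hx : ‖x‖ ≤ 1) :
    r • x ∈ ball (0 : E) 1 := by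
  rw [mem_ball_zero_iff, norm_smul, Real.norm_of_nonneg hr.le]
  nlinarith [norm_nonneg x]

theorem closedBall_subset_scaled {r : ℝ} (hr : 0 < r) (hr1 : r < 1) :
    closedBall (0 : E) 1 ⊆ ball 0 (1 / r) :=
  closedBall_subset_ball (by rw [lt_div_iff₀ hr]; linarith)

theorem Sol.zero_sc {u : E → ℝ} {g : E → E} {Ω : Set E} (h : Sol u g Ω) {r : ℝ} (hr : 0 < r)
    (hr1 : r < 1) {x : E} (hx : ‖x‖ ≤ 1) (hΩ : r • x ∉ Ω) :
    sc r u x = 0 ∧ zf (sc r u) (scg r g) x = 0 := by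
  have := h.zero _ (smul_mem_ball_one hr hr1 hx) hΩ
  simp [sc, scg, zf, this.1, this.2]

/-- Weiss' monotonicity formula. -/
theorem Sol.hasDerivAt_weiss {u : E → ℝ} {g : E → E} {Ω : Set E} (h : Sol u g Ω) {r : ℝ}
    (hr : 0 < r) (hr1 : r < 1) :
    HasDerivAt (fun s => weiss 2 (sc s u) (scg s g))
      (4 * r⁻¹ * ∫ x, zf (sc r u) (scg r g) x ^ 2 * wt x) r := by
  set a := r / 2
  set b := (r + 1) / 2
  have ha : 0 < a := half_pos hr
  have har : a < r := half_lt_self hr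
  have hrb : r < b := by simp only [b]; linarith
  have hb1 : b < 1 := by simp only [b]; linarith
  have hK : IsCompact (Icc a b ×ˢ closedBall (0 : E) 1) := isCompact_Icc.prod
    (isCompact_closedBall _ _)
  have hKs : Icc a b ×ˢ closedBall (0 : E) 1 ⊆ Ioi 0 ×ˢ univ :=
    prod_mono (fun s hs => ha.trans_le hs.1) (subset_univ _)
  obtain ⟨C₁, hC₁⟩ := hK.exists_bound_of_continuousOn (h.isC1.continuousOn_deriv_sc.mono hKs)
  obtain ⟨C₂, hC₂⟩ := hK.exists_bound_of_continuousOn (h.isC1.continuousOn_zf_sc.mono hKs)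
  have hC₁0 : 0 ≤ C₁ := (norm_nonneg _).trans (hC₁ (r, 0) ⟨⟨har.le, hrb.le⟩, by simp⟩)
  have hC₂0 : 0 ≤ C₂ := (norm_nonneg _).trans (hC₂ (r, 0) ⟨⟨har.le, hrb.le⟩, by simp⟩)
  have hlip : ∀ s ∈ Icc a b, ∀ x : E, ‖x‖ ≤ 1 → |sc s u x - sc r u x| ≤ C₁ * |s - r| :=
    fun s hs x hx => (convex_Icc a b).norm_image_sub_le_of_norm_hasDerivWithin_le
      (f := fun s => sc s u x) (fun τ hτ => (h.isC1.hasDerivAt_sc (ha.trans_le hτ.1)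
        x).hasDerivWithinAt) (fun τ hτ => hC₁ (τ, x) ⟨hτ, by simpa using hx⟩)
      ⟨har.le, hrb.le⟩ hs
  have hev : ∀ᶠ s in nhdsWithin r {r}ᶜ, s ∈ Ioo a b ∧ s ≠ r := by
    filter_upwards [nhdsWithin_le_nhds (Ioo_mem_nhds har hrb), self_mem_nhdsWithin] with s h1 h2
    exact ⟨h1, h2⟩
  rw [hasDerivAt_iff_tendsto_slope]
  have eslope : ∀ᶠ s in nhdsWithin r {r}ᶜ, ∫ x, (s - r)⁻¹ * ((sc s u x - sc r u x) *
      ((2 - Ω.indicator (1 : E → ℝ) (r • x) - Ω.indicator (1 : E → ℝ) (s • x)) * zt x +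
        2 * (zf (sc s u) (scg s g) x + zf (sc r u) (scg r g) x) * wt x)) =
      slope (fun s => weiss 2 (sc s u) (scg s g)) r s := by
    filter_upwards [hev] with s hs
    have hs0 : 0 < s := ha.trans hs.1.1
    have hs1 : s < 1 := hs.1.2.trans hb1
    rw [slope_def_field, weiss_sub_weiss (h.isC1.sc r) (h.isC1.sc s)
      ((h.weak_sc hr).mono inter_subset_left) ((h.weak_sc hs0).mono inter_subset_right)
      (subset_inter (closedBall_subset_scaled hr hr1) (closedBall_subset_scaled hs0 hs1)),
      integral_const_mul, div_eq_inv_mul]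
  refine Tendsto.congr' eslope ?_
  rw [← integral_const_mul]
  have hsc : ∀ s, Continuous (sc s u) := fun s => (h.isC1.sc s).continuous
  have hzf : ∀ s, Continuous (zf (sc s u) (scg s g)) := fun s => (h.isC1.sc s).continuous_zf
  have hind : ∀ s : ℝ, Measurable fun x : E => Ω.indicator (1 : E → ℝ) (s • x) := fun s =>
    h.weak.meas.comp (by fun_prop)
  refine tendsto_integral_filter_of_dominated_convergence
    (fun x => C₁ * (4 + 4 * C₂) * wt x) ?_ ?_ (integrable_wt.const_mul _) ?_
  · refine Eventually.of_forall fun s => Measurable.aestronglyMeasurable ?_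
    have := (hsc s).measurable
    have := (hsc r).measurable
    have := (hzf s).measurable
    have := (hzf r).measurable
    have := hind s
    have := hind r
    have := (continuous_wt (E := E)).measurable
    have := (continuous_zt (E := E)).measurable
    fun_prop
  · filter_upwards [hev] with s hs
    refine Eventually.of_forall fun x => ?_
    rcases le_or_gt ‖x‖ 1 with hx | hx
    · have h1 := hlip s ⟨hs.1.1.le, hs.1.2.le⟩ x hx
      have h2 := hC₂ (s, x) ⟨⟨hs.1.1.le, hs.1.2.le⟩, by simpa using hx⟩
      have h3 := hC₂ (r, x) ⟨⟨har.le, hrb.le⟩, by simpa using hx⟩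
      simp only [Real.norm_eq_abs] at h2 h3 ⊢
      have h4 : |(2 - Ω.indicator (1 : E → ℝ) (r • x) - Ω.indicator (1 : E → ℝ) (s • x)) * zt x +
        2 * (zf (sc s u) (scg s g) x + zf (sc r u) (scg r g) x) * wt x| ≤ (4 + 4 * C₂) * wt x := by
        have a1 := indicator_one_abs_le Ω (r • x)
        have a2 := indicator_one_abs_le Ω (s • x)
        have b1 : |2 - Ω.indicator (1 : E → ℝ) (r • x) - Ω.indicator (1 : E → ℝ) (s • x)| ≤ 4 := by
          rw [abs_le] at *; constructor <;> linarith [a1.1, a1.2, a2.1, a2.2]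
        have b2 : |2 * (zf (sc s u) (scg s g) x + zf (sc r u) (scg r g) x)| ≤ 4 * C₂ := by
          rw [abs_le] at *; constructor <;> linarith [h2.1, h2.2, h3.1, h3.2]
        refine (abs_add_le _ _).trans ?_
        rw [abs_mul, abs_mul, abs_of_nonneg (zt_nonneg x), abs_of_nonneg (wt_nonneg x), add_mul]
        refine add_le_add (mul_le_mul b1 (zt_le_wt x) (zt_nonneg x) (by norm_num)) ?_
        exact mul_le_mul_of_nonneg_right b2 (wt_nonneg x)
      have h5 : 0 < |s - r| := abs_pos.2 (sub_ne_zero.2 hs.2)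
      rw [abs_mul, abs_mul, abs_inv, ← mul_assoc, mul_assoc C₁]
      refine mul_le_mul ?_ h4 (abs_nonneg _) hC₁0
      rw [inv_mul_le_iff₀ h5]
      linarith
    · simp [wt_eq_zero hx.le, zt_eq_zero hx.le]
  · refine Eventually.of_forall fun x => ?_
    rcases le_or_gt ‖x‖ 1 with hx | hx
    · have t1 : Tendsto (fun s => (s - r)⁻¹ * (sc s u x - sc r u x)) (nhdsWithin r {r}ᶜ)
          (nhds (r⁻¹ * zf (sc r u) (scg r g) x)) := by
        have := hasDerivAt_iff_tendsto_slope.1 (h.isC1.hasDerivAt_sc hr x)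
        simpa only [slope_fun_def, vsub_eq_sub, smul_eq_mul] using this
      have t2 : Tendsto (fun s => zf (sc s u) (scg s g) x) (nhdsWithin r {r}ᶜ)
          (nhds (zf (sc r u) (scg r g) x)) := by
        have hc := h.isC1.continuousOn_zf_sc.comp (f := fun s : ℝ => (s, x)) (s := Ioi 0)
          (by fun_prop) fun s hs => ⟨hs, mem_univ _⟩
        exact ((hc.continuousAt (Ioi_mem_nhds hr)).tendsto).mono_left nhdsWithin_le_nhds
      have t3 : Tendsto (fun s => (s - r)⁻¹ * (sc s u x - sc r u x) *
          (2 - Ω.indicator (1 : E → ℝ) (r • x) - Ω.indicator (1 : E → ℝ) (s • x))) (nhdsWithin r {r}ᶜ) (nhds 0) := by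
        by_cases hΩ : r • x ∈ Ω
        · have : ∀ᶠ s in nhdsWithin r {r}ᶜ, s • x ∈ Ω := by
            refine nhdsWithin_le_nhds ?_
            have hc : ContinuousAt (fun s : ℝ => s • x) r := by fun_prop
            exact hc (h.isOpen.mem_nhds hΩ)
          refine tendsto_const_nhds.congr' ?_
          filter_upwards [this] with s hs
          simp only [hΩ, hs, indicator_of_mem, Pi.one_apply]
          ring
        · rw [(h.zero_sc hr hr1 hx hΩ).2, mul_zero] at t1
          refine t1.zero_mul_isBoundedUnder_le ⟨4, ?_⟩
          rw [eventually_map]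
          refine Eventually.of_forall fun s => ?_
          have a1 := indicator_one_abs_le Ω (r • x)
          have a2 := indicator_one_abs_le Ω (s • x)
          simp only [Function.comp, Real.norm_eq_abs]
          rw [abs_le] at *; constructor <;> linarith [a1.1, a1.2, a2.1, a2.2]
      have := (t3.mul_const (zt x)).add ((t1.mul (((t2.add_const
        (zf (sc r u) (scg r g) x)).const_mul 2))).mul_const (wt x))
      refine (this.congr fun s => ?_).trans_eq ?_
      · ring
      · congr 1; ring
    · simp [wt_eq_zero hx.le, zt_eq_zero hx.le]

theorem Sol.weiss_mono {u : E → ℝ} {g : E → E} {Ω : Set E} (h : Sol u g Ω) :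
    MonotoneOn (fun s => weiss 2 (sc s u) (scg s g)) (Ioo 0 1) := by
  refine monotoneOn_of_deriv_nonneg (convex_Ioo _ _)
    (fun s hs => (h.hasDerivAt_weiss hs.1 hs.2).continuousAt.continuousWithinAt)
    (fun s hs => ?_) fun s hs => ?_
  · rw [interior_Ioo] at hs
    exact (h.hasDerivAt_weiss hs.1 hs.2).differentiableAt.differentiableWithinAt
  · rw [interior_Ioo] at hs
    rw [(h.hasDerivAt_weiss hs.1 hs.2).deriv]
    have := inv_pos.2 hs.1
    exact mul_nonneg (by positivity)
      (integral_nonneg fun x => mul_nonneg (sq_nonneg _) (wt_nonneg x))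

theorem Sol.deriv_hN_le {u : E → ℝ} {g : E → E} {Ω : Set E} (h : Sol u g Ω) {r : ℝ}
    (hr : 0 < r) (hr1 : r < 1) :
    ∫ x, 2 * sc r u x * zf (sc r u) (scg r g) x * wt x ≤
      weiss 2 (sc r u) (scg r g) + wtMass E + hN (sc r u) := by
  have hc := (h.isC1.sc r).continuous
  have hz := (h.isC1.sc r).continuous_zf
  rw [weiss_eq (h.isC1.sc r) (h.weak_sc hr) (closedBall_subset_scaled hr hr1) 2, wtMass, hN]
  have e : ∀ x, (2 - Ω.indicator (1 : E → ℝ) (r • x)) * sc r u x * zt x +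
      2 * sc r u x * zf (sc r u) (scg r g) x * wt x = sc r u x * zt x +
      2 * sc r u x * zf (sc r u) (scg r g) x * wt x := fun x => by
    rcases le_or_gt ‖x‖ 1 with hx | hx
    · by_cases hΩ : r • x ∈ Ω
      · simp only [hΩ, indicator_of_mem, Pi.one_apply]; ring
      · rw [(h.zero_sc hr hr1 hx hΩ).1]; ring
    · rw [wt_eq_zero hx.le, zt_eq_zero hx.le]; ring
  simp only [e]
  rw [← integral_add ((integrable_mul_zt hc).fun_add (integrable_mul_wt (by fun_prop))) integrable_wt,
    ← integral_add (((integrable_mul_zt hc).fun_add (integrable_mul_wt (by fun_prop))).fun_add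
      integrable_wt) (integrable_mul_wt (by fun_prop))]
  refine integral_mono (integrable_mul_wt (by fun_prop))
    ((((integrable_mul_zt hc).add (integrable_mul_wt (by fun_prop))).add
      integrable_wt).add (integrable_mul_wt (by fun_prop))) fun x => ?_
  simp only
  have h1 := zt_nonneg x
  have h2 := zt_le_wt x
  nlinarith [mul_nonneg h1 (sq_nonneg (sc r u x + 1)), mul_nonneg (sub_nonneg.2 h2)
    (add_nonneg (sq_nonneg (sc r u x)) zero_le_one), mul_nonneg h1 (sq_nonneg (sc r u x))]

/-- Doubling of the weighted square norm. -/
theorem Sol.exists_doubling {u : E → ℝ} {g : E → E} {Ω : Set E} (h : Sol u g Ω) :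
    ∃ A : ℝ, 0 ≤ A ∧ ∀ r s : ℝ, 0 < r → r ≤ s → s ≤ 1 / 2 →
      hN (sc s u) + A ≤ s / r * (hN (sc r u) + A) := by
  set A := |weiss 2 (sc (1 / 2) u) (scg (1 / 2) g)| + wtMass E
  have hd : ∀ s, 0 < s → HasDerivAt (fun s => (hN (sc s u) + A) * s⁻¹) _ s := fun s hs =>
    ((h.isC1.hasDerivAt_hN hs).add_const A).mul (hasDerivAt_inv hs.ne')
  have hanti : AntitoneOn (fun s => (hN (sc s u) + A) * s⁻¹) (Ioc 0 (1 / 2)) := by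
    refine antitoneOn_of_deriv_nonpos (convex_Ioc _ _)
      (fun s hs => (hd s hs.1).continuousAt.continuousWithinAt) (fun s hs => ?_) fun s hs => ?_
    · rw [interior_Ioc] at hs
      exact (hd s hs.1).differentiableAt.differentiableWithinAt
    · rw [interior_Ioc] at hs
      rw [(hd s hs.1).deriv]
      have hs1 : s < 1 := hs.2.trans (by norm_num)
      have h1 := h.deriv_hN_le hs.1 hs1
      have h2 := h.weiss_mono ⟨hs.1, hs1⟩ ⟨by norm_num, by norm_num⟩ hs.2.le
      simp only at h2
      have h3 := le_abs_self (weiss 2 (sc (1 / 2) u) (scg (1 / 2) g))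
      have : 0 < s⁻¹ := inv_pos.2 hs.1
      rw [← inv_pow]
      have h4 : (∫ x, 2 * sc s u x * zf (sc s u) (scg s g) x * wt x) ≤ hN (sc s u) + A := by
        simp only [A]; linarith
      nlinarith [mul_le_mul_of_nonneg_left h4 (sq_nonneg s⁻¹)]
  refine ⟨A, add_nonneg (abs_nonneg _) wtMass_pos.le, fun r s hr hrs hs => ?_⟩
  have := hanti ⟨hr, hrs.trans hs⟩ ⟨hr.trans_le hrs, hs⟩ hrs
  simp only at this
  have hs0 : 0 < s := hr.trans_le hrs
  calc hN (sc s u) + A = s * ((hN (sc s u) + A) * s⁻¹) := by field_simp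
    _ ≤ s * ((hN (sc r u) + A) * r⁻¹) := by gcongr
    _ = _ := by ring

end Weiss

section BlowUp

variable {E : Type*} [NormedAddCommGroup E] [InnerProductSpace ℝ E] [FiniteDimensional ℝ E]
  [MeasurableSpace E] [BorelSpace E]

theorem wt_anti {x y : E} (h : ‖x‖ ≤ ‖y‖) : wt y ≤ wt x := by
  unfold wt
  have : ‖x‖ ^ 2 ≤ ‖y‖ ^ 2 := by gcongr
  gcongr

theorem nine_le_wt {x : E} (h : ‖x‖ ≤ 1 / 2) : 9 / 16 ≤ wt x := by
  unfold wt
  have h1 : 3 / 4 ≤ max (1 - ‖x‖ ^ 2) 0 := le_max_of_le_left (by nlinarith [norm_nonneg x])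
  nlinarith

theorem integral_sq_le (v : E → ℝ) (hv : Continuous v) {R : ℝ} (hR : 0 ≤ R) {x : E}
    (hx : ‖x‖ ≤ R) : ∫ y, v (x + y) ^ 2 * wt y ≤
      16 / 9 * ((2 * (R + 1)) ^ (Module.finrank ℝ E + 4) * hN (sc (2 * (R + 1)) v)) := by
  set ρ := 2 * (R + 1) with hρ
  have hρ0 : 0 < ρ := by positivity
  have e1 : ∫ y, v (x + y) ^ 2 * wt y = ∫ z, v z ^ 2 * wt (z - x) := by
    rw [← integral_add_left_eq_self (fun z => v z ^ 2 * wt (z - x)) x]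
    simp
  have e2 : ∫ z, v z ^ 2 * wt (ρ⁻¹ • z) = ρ ^ (Module.finrank ℝ E + 4) * hN (sc ρ v) := by
    have := integral_affine 0 hρ0 fun z => v z ^ 2 * wt (ρ⁻¹ • z)
    simp only [zero_add, smul_smul, inv_mul_cancel₀ hρ0.ne', one_smul] at this
    rw [eq_inv_mul_iff_mul_eq₀ (by positivity)] at this
    rw [← this, hN, pow_add, mul_assoc, ← integral_const_mul (ρ ^ 4)]
    congr 1
    refine integral_congr_ae (Eventually.of_forall fun y => ?_)
    simp only [sc]
    field_simp
  have hc1 : HasCompactSupport fun z : E => wt (z - x) := by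
    exact hasCompactSupport_wt.comp_homeomorph (Homeomorph.subRight x)
  have hc2 : HasCompactSupport fun z : E => wt (ρ⁻¹ • z) :=
    hasCompactSupport_wt.comp_smul (inv_ne_zero hρ0.ne')
  have i1 : Integrable fun z => v z ^ 2 * wt (z - x) :=
    Continuous.integrable_of_hasCompactSupport (by fun_prop) hc1.mul_left
  have i2 : Integrable fun z => v z ^ 2 * wt (ρ⁻¹ • z) :=
    Continuous.integrable_of_hasCompactSupport (by fun_prop) hc2.mul_left
  rw [e1, ← e2, ← integral_const_mul]
  refine integral_mono i1 (i2.const_mul _) fun z => ?_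
  have hw := wt_nonneg (ρ⁻¹ • z)
  simp only
  rcases le_or_gt 1 ‖z - x‖ with h | h
  · rw [wt_eq_zero h, mul_zero]
    positivity
  · have hz : ‖z‖ ≤ R + 1 := by
      have := norm_le_norm_add_norm_sub' z x
      linarith
    have h1 : 9 / 16 ≤ wt (ρ⁻¹ • z) := by
      refine nine_le_wt ?_
      rw [norm_smul, Real.norm_of_nonneg (by positivity), inv_mul_le_iff₀ hρ0]
      linarith
    have h2 := wt_le_one (z - x)
    nlinarith [sq_nonneg (v z)]

theorem exists_sup_bound (E : Type*) [NormedAddCommGroup E] [InnerProductSpace ℝ E]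
    [FiniteDimensional ℝ E] [MeasurableSpace E] [BorelSpace E] {R : ℝ} (hR : 0 ≤ R) :
    ∃ C : ℝ, 0 ≤ C ∧ ∀ (v : E → ℝ) (g : E → E) (f : E → ℝ),
    IsC1 v g → WeakLap g f (ball 0 (R + 1)) → (∀ x, |f x| ≤ 1) → ∀ x, ‖x‖ ≤ R →
      |v x| ≤ C * (1 + hN (sc (2 * (R + 1)) v)) := by
  have hw := wtMass_pos (E := E)
  have hz := ztMass_pos (E := E)
  set P := 16 / 9 * (2 * (R + 1)) ^ (Module.finrank ℝ E + 4)
  have hP : 0 ≤ P := by positivity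
  refine ⟨(P + wtMass E + ztMass E) / wtMass E, by positivity, fun v g f hv h hf x hx => ?_⟩
  have h1 := (h.mono (ball_subset_ball' (by rw [dist_zero_right]; linarith))).abs_le_integral
    (x := x) hv hf
  have h2 := integral_sq_le v hv.continuous hR hx
  have h3 := hN_nonneg (sc (2 * (R + 1)) v)
  rw [div_mul_eq_mul_div, le_div_iff₀ hw]
  rw [← mul_assoc] at h2
  change _ ≤ P * _ at h2
  nlinarith [mul_nonneg hw.le h3, mul_nonneg hz.le h3]

theorem hN_const_mul (c : ℝ) (v : E → ℝ) : hN (fun x => c * v x) = c ^ 2 * hN v := by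
  rw [hN, hN, ← integral_const_mul]
  congr 1; ext x; ring

theorem sc_const_mul (r c : ℝ) (v : E → ℝ) : sc r (fun x => c * v x) = fun x => c * sc r v x := by
  ext x; simp only [sc]; ring

theorem scg_const_smul (r c : ℝ) (g : E → E) :
    scg r (fun x => c • g x) = fun x => c • scg r g x := by
  ext x; simp only [scg]; rw [smul_comm]

theorem zf_const_mul (c : ℝ) (v : E → ℝ) (g : E → E) (x : E) :
    zf (fun x => c * v x) (fun x => c • g x) x = c * zf v g x := by
  simp only [zf, real_inner_smul_left]; ring

theorem zf_sc {t : ℝ} (ht : t ≠ 0) (v : E → ℝ) (g : E → E) (x : E) :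
    zf (sc t v) (scg t g) x = (t ^ 2)⁻¹ * zf v g (t • x) := by
  simp only [zf, sc, scg, real_inner_smul_left, real_inner_smul_right]
  field_simp

theorem weiss_const_mul {c : ℝ} (hc : c ≠ 0) (m : ℝ) (v : E → ℝ) (g : E → E) :
    weiss m (fun x => c * v x) (fun x => c • g x) = c ^ 2 * weiss (m / c) v g := by
  rw [weiss, weiss, ← integral_const_mul]
  congr 1; ext x
  rw [norm_smul, mul_pow, Real.norm_eq_abs, sq_abs]
  field_simp

/-- `(v₀, g₀)` is a limit of the rescalings of `(u, g)` at scales `r j`, normalized by `M j`. -/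
structure BlowUp (u : E → ℝ) (g : E → E) (r M : ℕ → ℝ) (v₀ : E → ℝ) (g₀ : E → E) : Prop where
  r_pos : ∀ j, 0 < r j
  r_tendsto : Tendsto r atTop (nhds 0)
  one_le : ∀ j, 1 ≤ M j
  isC1 : IsC1 v₀ g₀
  conv : LocConv (fun j x => (M j)⁻¹ * sc (r j) u x) (fun j x => (M j)⁻¹ • scg (r j) g x) v₀ g₀

theorem eventually_mul_lt {r : ℕ → ℝ} (hr : Tendsto r atTop (nhds 0)) (R : ℝ) {c : ℝ}
    (hc : 0 < c) : ∀ᶠ j in atTop, R * r j < c := by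
  have := hr.const_mul R
  rw [mul_zero] at this
  exact this.eventually (gt_mem_nhds hc)

theorem Sol.exists_blowUp {u : E → ℝ} {g : E → E} {Ω : Set E} (h : Sol u g Ω) {r M : ℕ → ℝ}
    (hr : ∀ j, 0 < r j) (hr0 : Tendsto r atTop (nhds 0)) (hM : ∀ j, 1 ≤ M j) {C : ℝ}
    (hC : ∀ j, hN (sc (r j) u) ≤ C * M j ^ 2) :
    ∃ (σ : ℕ → ℕ) (v₀ : E → ℝ) (g₀ : E → E), Tendsto σ atTop atTop ∧
      BlowUp u g (fun j => r (σ j)) (fun j => M (σ j)) v₀ g₀ := by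
  obtain ⟨A, hA, hdoub⟩ := h.exists_doubling
  have hM0 : ∀ j, 0 < M j := fun j => one_pos.trans_le (hM j)
  have hC0 : 0 ≤ C := by
    have := (hN_nonneg _).trans (hC 0)
    exact nonneg_of_mul_nonneg_left this (by have := hM0 0; positivity)
  have hlim := exists_limit (v := fun j x => (M j)⁻¹ * sc (r j) u x)
    (g := fun j x => (M j)⁻¹ • scg (r j) g x)
    (f := fun j x => (M j)⁻¹ * Ω.indicator (1 : E → ℝ) (r j • x))
    (fun j => (h.isC1.sc _).const_mul _) ?_ ?_
  · obtain ⟨σ, v₀, g₀, hσ, h1, h2⟩ := hlim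
    exact ⟨σ, v₀, g₀, hσ, fun j => hr _, hr0.comp hσ, fun j => hM _, h1, h2⟩
  · refine Eventually.of_forall fun j x => ?_
    rw [abs_mul, abs_inv, abs_of_pos (hM0 j)]
    have := inv_le_one_of_one_le₀ (hM j)
    have := inv_pos.2 (hM0 j)
    nlinarith [indicator_one_abs_le Ω (r j • x), abs_nonneg (Ω.indicator (1 : E → ℝ) (r j • x))]
  · intro R
    set R' := max R 0
    have hR' : 0 ≤ R' := le_max_right _ _
    obtain ⟨K, hK, hsup⟩ := exists_sup_bound E hR'
    set ρ := 2 * (R' + 1) with hρ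
    have hρ1 : 1 ≤ ρ := by linarith
    have hρ0 : 0 < ρ := by linarith
    refine ⟨K * (1 + ρ * (C + A)), ?_⟩
    filter_upwards [eventually_mul_lt hr0 ρ (half_pos one_pos)] with j hj
    have hrj := hr j
    have hw : WeakLap (fun x => (M j)⁻¹ • scg (r j) g x)
        (fun x => (M j)⁻¹ * Ω.indicator (1 : E → ℝ) (r j • x)) (ball 0 (R' + 1)) := by
      refine ((h.weak_sc hrj).const_mul _).mono (ball_subset_ball ?_)
      rw [le_div_iff₀ hrj]
      nlinarith
    refine ⟨hw.mono (ball_subset_ball (by linarith [le_max_left R 0])), fun x hx => ?_⟩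
    have hx' : ‖x‖ ≤ R' := (mem_ball_zero_iff.1 hx).le.trans (le_max_left _ _)
    refine (hsup _ _ _ ((h.isC1.sc _).const_mul _) hw (fun x => ?_) x hx').trans ?_
    · rw [abs_mul, abs_inv, abs_of_pos (hM0 j)]
      have := inv_le_one_of_one_le₀ (hM j)
      have := inv_pos.2 (hM0 j)
      nlinarith [indicator_one_abs_le Ω (r j • x), abs_nonneg (Ω.indicator (1 : E → ℝ) (r j • x))]
    · rw [sc_const_mul, hN_const_mul, sc_sc]
      refine mul_le_mul_of_nonneg_left (add_le_add le_rfl ?_) hK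
      have h1 := hdoub (r j) (ρ * r j) hrj (by nlinarith) hj.le
      rw [mul_div_cancel_right₀ _ hrj.ne'] at h1
      have h2 : 1 ≤ M j ^ 2 := one_le_pow₀ (hM j)
      rw [inv_pow, inv_mul_le_iff₀ (by positivity)]
      change hN (sc (ρ * r j) u) ≤ _
      calc hN (sc (ρ * r j) u) ≤ ρ * (hN (sc (r j) u) + A) := by linarith
        _ ≤ ρ * (C * M j ^ 2 + A * M j ^ 2) := by
          gcongr
          · exact hC j
          · exact le_mul_of_one_le_right hA h2
        _ = _ := by ring

theorem LocConv.exists_bound {v : ℕ → E → ℝ} {g : ℕ → E → E} {v₀ : E → ℝ} {g₀ : E → E}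
    (h : LocConv v g v₀ g₀) (h₀ : IsC1 v₀ g₀) (R : ℝ) : ∃ B : ℝ, 0 ≤ B ∧ ∀ᶠ j in atTop, ∀ x,
      ‖x‖ ≤ R → |v j x| ≤ B ∧ ‖g j x‖ ≤ B := by
  have hK : IsCompact (closedBall (0 : E) R) := isCompact_closedBall _ _
  obtain ⟨B₁, hB₁⟩ := hK.exists_bound_of_continuousOn h₀.continuous.continuousOn
  obtain ⟨B₂, hB₂⟩ := hK.exists_bound_of_continuousOn h₀.cont_grad.continuousOn
  refine ⟨max B₁ B₂ ⊔ 0 + 1, by positivity, ?_⟩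
  filter_upwards [h R 1 one_pos] with j hj x hx
  have h1 := hB₁ x (by simpa using hx)
  have h2 := hB₂ x (by simpa using hx)
  obtain ⟨h3, h4⟩ := hj x hx
  have h5 := norm_le_norm_add_norm_sub' (g j x) (g₀ x)
  have h6 := norm_le_norm_add_norm_sub' (v j x) (v₀ x)
  simp only [Real.norm_eq_abs] at h1 h6
  have := le_max_left B₁ B₂
  have := le_max_right B₁ B₂
  have := le_max_left (max B₁ B₂) 0
  exact ⟨by linarith, by linarith⟩

theorem tendsto_integral_of_ball {F : ℕ → E → ℝ} {F₀ : E → ℝ} {R B : ℝ}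
    (hF : ∀ j, Continuous (F j)) (hb : ∀ᶠ j in atTop, ∀ x, ‖x‖ ≤ R → |F j x| ≤ B)
    (h0 : ∀ j x, R < ‖x‖ → F j x = 0) (hl : ∀ x, Tendsto (fun j => F j x) atTop (nhds (F₀ x))) :
    Tendsto (fun j => ∫ x, F j x) atTop (nhds (∫ x, F₀ x)) := by
  refine tendsto_integral_filter_of_dominated_convergence
    ((closedBall (0 : E) R).indicator fun _ => B)
    (Eventually.of_forall fun j => (hF j).aestronglyMeasurable) ?_
    ((integrable_indicator_iff measurableSet_closedBall).2
      (integrableOn_const (measure_closedBall_lt_top.ne)))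
    (Eventually.of_forall hl)
  filter_upwards [hb] with j hj
  refine Eventually.of_forall fun x => ?_
  rcases le_or_gt ‖x‖ R with hx | hx
  · rw [indicator_of_mem (by simpa using hx)]
    exact hj x hx
  · rw [indicator_of_notMem (by simpa using hx), h0 j x hx, norm_zero]

theorem LocConv.tendsto_hN {v : ℕ → E → ℝ} {g : ℕ → E → E} {v₀ : E → ℝ} {g₀ : E → E}
    (h : LocConv v g v₀ g₀) (h₀ : IsC1 v₀ g₀) (hv : ∀ j, IsC1 (v j) (g j)) :
    Tendsto (fun j => hN (v j)) atTop (nhds (hN v₀)) := by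
  obtain ⟨B, hB, hb⟩ := h.exists_bound h₀ 1
  refine tendsto_integral_of_ball (R := 1) (B := B ^ 2)
    (fun j => by have := (hv j).continuous; fun_prop) ?_
    (fun j x hx => by rw [wt_eq_zero hx.le, mul_zero])
    fun x => ((h.tendsto x).pow 2).mul_const _
  filter_upwards [hb] with j hj x hx
  rw [abs_mul, abs_pow, abs_of_nonneg (wt_nonneg x)]
  have := (hj x hx).1
  exact (mul_le_of_le_one_right (by positivity) (wt_le_one x)).trans (by gcongr)

theorem LocConv.tendsto_weiss {v : ℕ → E → ℝ} {g : ℕ → E → E} {v₀ : E → ℝ} {g₀ : E → E}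
    (h : LocConv v g v₀ g₀) (h₀ : IsC1 v₀ g₀) (hv : ∀ j, IsC1 (v j) (g j)) {m : ℕ → ℝ} {m₀ : ℝ}
    (hm : Tendsto m atTop (nhds m₀)) :
    Tendsto (fun j => weiss (m j) (v j) (g j)) atTop (nhds (weiss m₀ v₀ g₀)) := by
  obtain ⟨B, hB, hb⟩ := h.exists_bound h₀ 1
  refine tendsto_integral_of_ball (R := 1) (B := B ^ 2 + (|m₀| + 1) * B + 4 * B ^ 2)
    (fun j => ?_) ?_
    (fun j x hx => by rw [wt_eq_zero hx.le, zt_eq_zero hx.le]; ring) fun x => ?_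
  · have := (hv j).continuous
    have := (hv j).cont_grad
    fun_prop
  · filter_upwards [hb, hm.abs.eventually (gt_mem_nhds (lt_add_one |m₀|))] with j hj hmj x hx
    obtain ⟨h1, h2⟩ := hj x hx
    refine (abs_sub _ _).trans (add_le_add ?_ ?_)
    · rw [abs_mul, abs_of_nonneg (zt_nonneg x)]
      refine (mul_le_of_le_one_right (abs_nonneg _) ((zt_le_wt x).trans (wt_le_one x))).trans ?_
      refine (abs_add_le _ _).trans ?_
      rw [abs_pow, abs_norm, abs_mul]
      gcongr
    · rw [abs_mul, abs_mul, abs_pow, abs_of_nonneg (wt_nonneg x), abs_of_pos (by norm_num)]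
      refine (mul_le_of_le_one_right (by positivity) (wt_le_one x)).trans ?_
      gcongr
  · exact (((h.tendsto_grad x).norm.pow 2).add (hm.mul (h.tendsto x))).mul_const _ |>.sub
      ((((h.tendsto x).pow 2).const_mul 4).mul_const _)

theorem LocConv.sc {v : ℕ → E → ℝ} {g : ℕ → E → E} {v₀ : E → ℝ} {g₀ : E → E}
    (h : LocConv v g v₀ g₀) {t : ℝ} (ht : 0 < t) :
    LocConv (fun j => _root_.sc t (v j)) (fun j => scg t (g j)) (_root_.sc t v₀) (scg t g₀) := by
  intro R ε hε
  filter_upwards [h (t * R) (ε * min t (t ^ 2)) (by positivity)] with j hj x hx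
  obtain ⟨h1, h2⟩ := hj (t • x) (by rw [norm_smul, Real.norm_of_nonneg ht.le]; gcongr)
  constructor
  · rw [_root_.sc, _root_.sc, ← mul_sub, abs_mul, abs_of_pos (by positivity),
      inv_mul_lt_iff₀ (by positivity)]
    nlinarith [min_le_right t (t ^ 2)]
  · rw [scg, scg, ← smul_sub, norm_smul, Real.norm_of_nonneg (by positivity),
      inv_mul_lt_iff₀ (by positivity)]
    nlinarith [min_le_left t (t ^ 2)]

/-- If the Weiss energy does not change at the scales of the blow-up, the limit is homogeneous. -/
theorem BlowUp.zf_eq_zero {u : E → ℝ} {g : E → E} {Ω : Set E} {r M : ℕ → ℝ} {v₀ : E → ℝ}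
    {g₀ : E → E} (b : BlowUp u g r M v₀ g₀) (h : Sol u g Ω)
    (hW : ∀ R : ℝ, 0 < R → Tendsto (fun j => (weiss 2 (sc (2 * R * r j) u) (scg (2 * R * r j) g) -
      weiss 2 (sc (R * r j) u) (scg (R * r j) g)) / M j ^ 2) atTop (nhds 0)) (x : E) :
    zf v₀ g₀ x = 0 := by
  set v := fun j x => (M j)⁻¹ * sc (r j) u x with hv
  set G := fun j x => (M j)⁻¹ • scg (r j) g x with hG
  have hC1 : ∀ j, IsC1 (v j) (G j) := fun j => (h.isC1.sc _).const_mul _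
  set R := ‖x‖ + 1 with hRdef
  have hR : 0 < R := by positivity
  set n := Module.finrank ℝ E
  have key : ∀ᶠ j in atTop, 2 * ((2 * R) ^ (n + 4))⁻¹ * ∫ z, zf (v j) (G j) z ^ 2 * wt (R⁻¹ • z) ≤
      (weiss 2 (sc (2 * R * r j) u) (scg (2 * R * r j) g) -
      weiss 2 (sc (R * r j) u) (scg (R * r j) g)) / M j ^ 2 := by
    filter_upwards [eventually_mul_lt b.r_tendsto (2 * R) one_pos] with j hj
    have hrj := b.r_pos j
    have hMj : 0 < M j := one_pos.trans_le (b.one_le j)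
    have hRr : 0 < R * r j := by positivity
    have hlt : R * r j < 2 * R * r j := by linarith
    obtain ⟨c, hc, hslope⟩ := exists_hasDerivAt_eq_slope
      (fun s => weiss 2 (sc s u) (scg s g)) _ hlt
      (fun s hs => (h.hasDerivAt_weiss (hRr.trans_le hs.1)
        (hs.2.trans_lt hj)).continuousAt.continuousWithinAt)
      (fun s hs => h.hasDerivAt_weiss (hRr.trans hs.1) (hs.2.trans hj))
    have hc0 : 0 < c := hRr.trans hc.1
    set t := c / r j with ht
    have hct : c = t * r j := by rw [ht]; field_simp
    have htR : R < t := by rw [ht, lt_div_iff₀ hrj]; exact hc.1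
    have htR2 : t < 2 * R := by rw [ht, div_lt_iff₀ hrj]; exact hc.2
    have ht0 : 0 < t := hR.trans htR
    have hI : ∫ y, zf (sc c u) (scg c g) y ^ 2 * wt y = M j ^ 2 * ((t ^ (n + 4))⁻¹ *
        ∫ z, zf (v j) (G j) z ^ 2 * wt (t⁻¹ • z)) := by
      have e := integral_affine 0 ht0 fun z => zf (v j) (G j) z ^ 2 * wt (t⁻¹ • z)
      simp only [zero_add, smul_smul, inv_mul_cancel₀ ht0.ne', one_smul] at e
      have e2 : ∀ y, zf (sc c u) (scg c g) y ^ 2 * wt y =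
          (M j ^ 2 * (t ^ 4)⁻¹) * (zf (v j) (G j) (t • y) ^ 2 * wt y) := fun y => by
        rw [hct, ← sc_sc, ← scg_scg, zf_sc ht0.ne']
        simp only [v, G, zf_const_mul]
        field_simp
      simp only [e2]
      rw [integral_const_mul, e, pow_add]
      change _ = M j ^ 2 * ((t ^ n * t ^ 4)⁻¹ * _)
      rw [mul_inv]
      ring
    have hmono : ∫ z, zf (v j) (G j) z ^ 2 * wt (R⁻¹ • z) ≤
        ∫ z, zf (v j) (G j) z ^ 2 * wt (t⁻¹ • z) := by
      have hz := (hC1 j).continuous_zf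
      refine integral_mono
        (Continuous.integrable_of_hasCompactSupport (by fun_prop)
          (hasCompactSupport_wt.comp_smul (inv_ne_zero hR.ne')).mul_left)
        (Continuous.integrable_of_hasCompactSupport (by fun_prop)
          (hasCompactSupport_wt.comp_smul (inv_ne_zero ht0.ne')).mul_left) fun z => ?_
      refine mul_le_mul_of_nonneg_left (wt_anti ?_) (sq_nonneg _)
      rw [norm_smul, norm_smul, Real.norm_of_nonneg (by positivity),
        Real.norm_of_nonneg (by positivity)]
      gcongr
    rw [eq_div_iff (by linarith), hI] at hslope
    rw [← hslope, le_div_iff₀ (by positivity)]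
    have hI0 : 0 ≤ ∫ z, zf (v j) (G j) z ^ 2 * wt (R⁻¹ • z) :=
      integral_nonneg fun z => mul_nonneg (sq_nonneg _) (wt_nonneg _)
    have h1 : 2 ≤ 4 * c⁻¹ * (2 * R * r j - R * r j) := by
      rw [← div_eq_mul_inv, div_mul_eq_mul_div, le_div_iff₀ hc0]
      linarith [hc.2]
    calc _ = M j ^ 2 * (2 * (((2 * R) ^ (n + 4))⁻¹ *
          ∫ z, zf (v j) (G j) z ^ 2 * wt (R⁻¹ • z))) := by ring
      _ ≤ M j ^ 2 * ((4 * c⁻¹ * (2 * R * r j - R * r j)) * ((t ^ (n + 4))⁻¹ *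
          ∫ z, zf (v j) (G j) z ^ 2 * wt (t⁻¹ • z))) := by
        gcongr
      _ = _ := by ring
  have hlim : Tendsto (fun j => ∫ z, zf (v j) (G j) z ^ 2 * wt (R⁻¹ • z)) atTop
      (nhds (∫ z, zf v₀ g₀ z ^ 2 * wt (R⁻¹ • z))) := by
    obtain ⟨B, hB, hb⟩ := b.conv.exists_bound b.isC1 R
    refine tendsto_integral_of_ball (R := R) (B := (B * R + 2 * B) ^ 2)
      (fun j => by have := (hC1 j).continuous_zf; fun_prop) ?_ (fun j z hz => ?_) fun z => ?_
    · filter_upwards [hb] with j hj z hz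
      obtain ⟨h1, h2⟩ := hj z hz
      rw [abs_mul, abs_pow, abs_of_nonneg (wt_nonneg _)]
      refine (mul_le_of_le_one_right (by positivity) (wt_le_one _)).trans ?_
      have : |zf (v j) (G j) z| ≤ B * R + 2 * B := by
        refine (abs_sub _ _).trans (add_le_add ?_ ?_)
        · exact (abs_real_inner_le_norm _ _).trans (by gcongr)
        · rw [abs_mul, abs_of_pos (by norm_num)]; gcongr
      gcongr
    · rw [wt_eq_zero, mul_zero]
      rw [norm_smul, Real.norm_of_nonneg (by positivity), le_inv_mul_iff₀ hR]
      linarith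
    · exact ((((b.conv.tendsto_grad z).inner tendsto_const_nhds).sub
        ((b.conv.tendsto z).const_mul 2)).pow 2).mul_const _
  have hle := le_of_tendsto_of_tendsto (hlim.const_mul _) (hW R hR) key
  have hpos : 0 < 2 * ((2 * R) ^ (n + 4))⁻¹ := by positivity
  have h0 : ∫ z, zf v₀ g₀ z ^ 2 * wt (R⁻¹ • z) ≤ 0 := by
    by_contra! hc
    nlinarith
  have hz := b.isC1.continuous_zf
  by_contra hne
  have : 0 < ∫ z, zf v₀ g₀ z ^ 2 * wt (R⁻¹ • z) := by
    refine Continuous.integral_pos_of_hasCompactSupport_nonneg_nonzero (x := x) (by fun_prop)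
      (hasCompactSupport_wt.comp_smul (inv_ne_zero hR.ne')).mul_left
      (fun z => mul_nonneg (sq_nonneg _) (wt_nonneg _)) (ne_of_gt ?_)
    refine mul_pos (by positivity) (wt_pos ?_)
    rw [norm_smul, Real.norm_of_nonneg (by positivity), inv_mul_lt_iff₀ hR]
    linarith
  linarith

theorem IsC1.grad_unique {v : E → ℝ} {g g' : E → E} (h : IsC1 v g) (h' : IsC1 v g') : g = g' := by
  ext1 x
  have := (h.hasFDerivAt x).unique (h'.hasFDerivAt x)
  refine ext_inner_right ℝ fun y => ?_
  simpa using congrArg (fun L : E →L[ℝ] ℝ => L y) this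

theorem IsC1.homogeneous {v : E → ℝ} {g : E → E} (h : IsC1 v g) (hz : ∀ x, zf v g x = 0) {t : ℝ}
    (ht : 0 < t) (x : E) : v (t • x) = t ^ 2 * v x ∧ g (t • x) = t • g x := by
  have e : ∀ s, 0 < s → _root_.sc s v = v := fun s hs => by
    ext y
    have hd : ∀ τ, 0 < τ → HasDerivAt (fun τ => _root_.sc τ v y) 0 τ := fun τ hτ =>
      (h.hasDerivAt_sc hτ y).congr_deriv (by rw [zf_sc hτ.ne', hz]; simp)
    have := (convex_Ioi (0 : ℝ)).is_const_of_fderivWithin_eq_zero (𝕜 := ℝ)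
      (f := fun τ => _root_.sc τ v y)
      (fun τ hτ => (hd τ hτ).differentiableAt.differentiableWithinAt)
      (fun τ hτ => by
        rw [fderivWithin_of_isOpen isOpen_Ioi hτ]
        ext; simp [(hd τ hτ).deriv]) (mem_Ioi.2 hs) (mem_Ioi.2 one_pos)
    simpa [_root_.sc] using this
  constructor
  · have := congrFun (e t ht) x
    rw [_root_.sc, inv_mul_eq_iff_eq_mul₀ (by positivity)] at this
    exact this
  · have h1 := h.sc t
    rw [e t ht] at h1
    have := congrFun (h1.grad_unique h) x
    rw [scg, inv_smul_eq_iff₀ ht.ne'] at this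
    exact this

end BlowUp

section Homogeneous

variable {E : Type*} [NormedAddCommGroup E] [InnerProductSpace ℝ E] [FiniteDimensional ℝ E]
  [MeasurableSpace E] [BorelSpace E]

theorem BlowUp.tendsto_weiss {u : E → ℝ} {g : E → E} {Ω : Set E} {r M : ℕ → ℝ} {v₀ : E → ℝ}
    {g₀ : E → E} (b : BlowUp u g r M v₀ g₀) (h : Sol u g Ω) {m : ℝ}
    (hm : Tendsto (fun j => 2 / M j) atTop (nhds m)) {t : ℝ} (ht : 0 < t) :
    Tendsto (fun j => weiss 2 (sc (t * r j) u) (scg (t * r j) g) / M j ^ 2) atTop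
      (nhds (weiss m (sc t v₀) (scg t g₀))) := by
  refine ((b.conv.sc ht).tendsto_weiss (b.isC1.sc t)
    (fun j => ((h.isC1.sc _).const_mul _).sc t) hm).congr fun j => ?_
  have hM : M j ≠ 0 := (one_pos.trans_le (b.one_le j)).ne'
  rw [sc_const_mul, scg_const_smul, sc_sc, scg_scg, weiss_const_mul (inv_ne_zero hM)]
  field_simp

theorem BlowUp.zf_eq_zero_of_const {u : E → ℝ} {g : E → E} {Ω : Set E} {r M : ℕ → ℝ} {v₀ : E → ℝ}
    {g₀ : E → E} (b : BlowUp u g r M v₀ g₀) (h : Sol u g Ω) {m L : ℝ}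
    (hm : Tendsto (fun j => 2 / M j) atTop (nhds m))
    (hL : ∀ t, 0 < t → weiss m (sc t v₀) (scg t g₀) = L) (x : E) : zf v₀ g₀ x = 0 := by
  refine b.zf_eq_zero h (fun R hR => ?_) x
  have h1 := (b.tendsto_weiss h hm (t := 2 * R) (by positivity)).sub (b.tendsto_weiss h hm hR)
  rw [hL _ hR, hL _ (by positivity), sub_self] at h1
  exact h1.congr fun j => (sub_div _ _ _).symm

/-- A blow-up limit with bounded normalization is homogeneous. -/
theorem BlowUp.zf_eq_zero_of_one {u : E → ℝ} {g : E → E} {Ω : Set E} {r : ℕ → ℝ} {v₀ : E → ℝ}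
    {g₀ : E → E} (b : BlowUp u g r (fun _ => 1) v₀ g₀) (h : Sol u g Ω) (x : E) :
    zf v₀ g₀ x = 0 := by
  have hm : Tendsto (fun _ : ℕ => (2 : ℝ) / 1) atTop (nhds (2 / 1)) := tendsto_const_nhds
  have hlim : ∀ t, 0 < t → Tendsto (fun j => weiss 2 (sc (t * r j) u) (scg (t * r j) g)) atTop
      (nhds (weiss (2 / 1) (sc t v₀) (scg t g₀))) := fun t ht => by
    simpa using b.tendsto_weiss h hm ht
  have hrt : ∀ t, 0 < t → Tendsto (fun j => t * r j) atTop (nhdsWithin 0 (Ioi 0)) := fun t ht => by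
    rw [tendsto_nhdsWithin_iff]
    refine ⟨?_, Eventually.of_forall fun j => mul_pos ht (b.r_pos j)⟩
    simpa using b.r_tendsto.const_mul t
  have hbdd : BddBelow ((fun s => weiss 2 (sc s u) (scg s g)) '' Ioo 0 1) := by
    refine ⟨weiss (2 / 1) (sc 1 v₀) (scg 1 g₀), ?_⟩
    rintro _ ⟨s, hs, rfl⟩
    refine le_of_tendsto (hlim 1 one_pos) ?_
    filter_upwards [eventually_mul_lt b.r_tendsto 1 hs.1] with j hj
    exact h.weiss_mono ⟨mul_pos one_pos (b.r_pos j), hj.trans hs.2⟩ hs hj.le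
  have hL := h.weiss_mono.tendsto_nhdsWithin_Ioo_right (nonempty_Ioo.2 one_pos) hbdd
  exact b.zf_eq_zero_of_const h hm
    (fun t ht => tendsto_nhds_unique (hlim t ht) (hL.comp (hrt t ht))) x

theorem LocConv.tendsto_integral_inner {v : ℕ → E → ℝ} {g : ℕ → E → E} {v₀ : E → ℝ} {g₀ : E → E}
    (h : LocConv v g v₀ g₀) (h₀ : IsC1 v₀ g₀) (hv : ∀ j, IsC1 (v j) (g j)) {φ : E → ℝ} {ψ : E → E}
    (hφ : IsC1 φ ψ) (hc : HasCompactSupport φ) :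
    Tendsto (fun j => ∫ x, ⟪g j x, ψ x⟫) atTop (nhds (∫ x, ⟪g₀ x, ψ x⟫)) := by
  obtain ⟨R, hR⟩ := hc.isBounded.subset_closedBall 0
  obtain ⟨B, hB, hb⟩ := h.exists_bound h₀ R
  obtain ⟨P, hP⟩ := (isCompact_closedBall (0 : E) R).exists_bound_of_continuousOn
    hφ.cont_grad.continuousOn
  refine tendsto_integral_of_ball (R := R) (B := B * P) (fun j => ?_) ?_ (fun j x hx => ?_)
    fun x => (h.tendsto_grad x).inner tendsto_const_nhds
  · exact (hv j).cont_grad.inner hφ.cont_grad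
  · filter_upwards [hb] with j hj x hx
    refine (abs_real_inner_le_norm _ _).trans ?_
    have := hP x (by simpa using hx)
    have := (hj x hx).2
    gcongr
  · have h0 : ψ x = 0 := image_eq_zero_of_notMem_tsupport fun hx' => by
      have := hR (hφ.hasCompactSupport_grad hx')
      rw [mem_closedBall_zero_iff] at this
      linarith
    rw [h0, inner_zero_right]

theorem BlowUp.weakLap_zero {u : E → ℝ} {g : E → E} {Ω : Set E} {r M : ℕ → ℝ} {v₀ : E → ℝ}
    {g₀ : E → E} (b : BlowUp u g r M v₀ g₀) (h : Sol u g Ω) (hM : Tendsto M atTop atTop) :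
    WeakLap g₀ (fun _ => 0) univ := by
  refine ⟨measurable_const, ⟨0, by simp⟩, fun φ ψ hφ hc _ => ?_⟩
  have h1 := b.conv.tendsto_integral_inner b.isC1 (fun j => (h.isC1.sc _).const_mul _) hφ hc
  obtain ⟨R, hR⟩ := hc.isBounded.subset_ball 0
  have hi : Integrable fun x => |φ x| :=
    (hφ.continuous.integrable_of_hasCompactSupport hc).abs
  have h2 : Tendsto (fun j => (M j)⁻¹ * ∫ x, |φ x|) atTop (nhds 0) := by
    simpa using hM.inv_tendsto_atTop.mul_const (∫ x, |φ x|)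
  simp only [zero_mul, integral_zero, neg_zero]
  refine tendsto_nhds_unique h1 (squeeze_zero_norm' ?_ h2)
  filter_upwards [eventually_mul_lt b.r_tendsto R one_pos] with j hj
  have hrj := b.r_pos j
  have hMj := inv_pos.2 (one_pos.trans_le (b.one_le j))
  have hw := ((h.weak_sc hrj).const_mul (M j)⁻¹).weak φ ψ hφ hc (hR.trans (ball_subset_ball (by
    rw [le_div_iff₀ hrj]; exact hj.le)))
  rw [hw, norm_neg, ← integral_const_mul]
  refine norm_integral_le_of_norm_le (hi.const_mul _) (Eventually.of_forall fun x => ?_)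
  rw [norm_mul, norm_mul, Real.norm_of_nonneg hMj.le, mul_assoc]
  refine mul_le_mul_of_nonneg_left ?_ hMj.le
  exact mul_le_of_le_one_left (abs_nonneg _) (indicator_one_abs_le Ω _)

theorem BlowUp.weakLap_one {u : E → ℝ} {g : E → E} {Ω : Set E} {r : ℕ → ℝ} {v₀ : E → ℝ}
    {g₀ : E → E} (b : BlowUp u g r (fun _ => 1) v₀ g₀) (h : Sol u g Ω) :
    WeakLap g₀ (fun _ => 1) {x | v₀ x ≠ 0 ∨ g₀ x ≠ 0} := by
  refine ⟨measurable_const, ⟨1, by simp⟩, fun φ ψ hφ hc hs => ?_⟩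
  have h1 := b.conv.tendsto_integral_inner b.isC1 (fun j => (h.isC1.sc _).const_mul _) hφ hc
  refine tendsto_nhds_unique h1 (tendsto_const_nhds.congr' ?_)
  obtain ⟨R, hR⟩ := hc.isBounded.subset_ball 0
  obtain ⟨δ, hδ, hlow⟩ : ∃ δ > 0, ∀ x ∈ tsupport φ, δ ≤ |v₀ x| + ‖g₀ x‖ := by
    have hcont : Continuous fun x => |v₀ x| + ‖g₀ x‖ :=
      b.isC1.continuous.abs.add b.isC1.cont_grad.norm
    rcases (tsupport φ).eq_empty_or_nonempty with he | he
    · exact ⟨1, one_pos, by simp [he]⟩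
    · obtain ⟨x, hx, hmin⟩ := hc.isCompact.exists_isMinOn he hcont.continuousOn
      refine ⟨|v₀ x| + ‖g₀ x‖, ?_, fun y hy => hmin hy⟩
      rcases hs hx with h | h
      · have := abs_pos.2 h; positivity
      · have := norm_pos_iff.2 h; positivity
  filter_upwards [eventually_mul_lt b.r_tendsto R one_pos, b.conv R (δ / 2) (half_pos hδ)]
    with j hj hcj
  have hrj := b.r_pos j
  have hsub : tsupport φ ⊆ ball 0 (1 / r j) := hR.trans (ball_subset_ball (by
    rw [le_div_iff₀ hrj]; exact hj.le))
  have hw := ((h.weak_sc hrj).const_mul (1 : ℝ)⁻¹).weak φ ψ hφ hc hsub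
  rw [hw]
  congr 1
  refine integral_congr_ae (Eventually.of_forall fun x => ?_)
  by_cases hx : x ∈ tsupport φ
  · have hmem : r j • x ∈ Ω := by
      by_contra hΩ
      have hx1 : r j • x ∈ ball (0 : E) 1 := by
        have := mem_ball_zero_iff.1 (hsub hx)
        rw [lt_div_iff₀ hrj] at this
        rw [mem_ball_zero_iff, norm_smul, Real.norm_of_nonneg hrj.le]
        linarith
      obtain ⟨a1, a2⟩ := h.zero _ hx1 hΩ
      obtain ⟨b1, b2⟩ := hcj x (mem_ball_zero_iff.1 (hR hx)).le
      simp only [sc, scg, a1, a2, mul_zero, smul_zero, zero_sub, norm_neg, abs_neg] at b1 b2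
      linarith [hlow x hx]
    simp [hmem]
  · simp [image_eq_zero_of_notMem_tsupport hx]

/-- The common zeros of `v` and `g` in the unit ball are not contained in any slab of half-width
less than `c` around a hyperplane through the origin. -/
def Thick (c : ℝ) (v : E → ℝ) (g : E → E) : Prop :=
  ∀ n : E, ‖n‖ = 1 → ∃ y, ‖y‖ ≤ 1 ∧ c ≤ |⟪y, n⟫| ∧ v y = 0 ∧ g y = 0

theorem Thick.limit {c : ℝ} {v : ℕ → E → ℝ} {g : ℕ → E → E} {v₀ : E → ℝ} {g₀ : E → E}
    (h : LocConv v g v₀ g₀) (h₀ : IsC1 v₀ g₀) (ht : ∀ j, Thick c (v j) (g j)) :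
    Thick c v₀ g₀ := fun n hn => by
  choose y hy1 hy2 hy3 hy4 using fun j => ht j n hn
  obtain ⟨x, hx, σ, hσ, hlim⟩ := (isCompact_closedBall (0 : E) 1).tendsto_subseq
    (x := y) fun j => by simpa using hy1 j
  have l1 := (h₀.continuous.tendsto x).comp hlim
  have l2 := (h₀.cont_grad.tendsto x).comp hlim
  have l3 : Tendsto (fun j => v₀ (y (σ j))) atTop (nhds 0) := by
    refine Metric.tendsto_nhds.2 fun ε hε => ?_
    filter_upwards [hσ.tendsto_atTop.eventually (h 1 ε hε)] with j hj
    have := (hj _ (hy1 (σ j))).1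
    rw [hy3, zero_sub, abs_neg] at this
    simpa using this
  have l4 : Tendsto (fun j => g₀ (y (σ j))) atTop (nhds 0) := by
    refine Metric.tendsto_nhds.2 fun ε hε => ?_
    filter_upwards [hσ.tendsto_atTop.eventually (h 1 ε hε)] with j hj
    have := (hj _ (hy1 (σ j))).2
    rw [hy4, zero_sub, norm_neg] at this
    simpa using this
  refine ⟨x, by simpa using hx, ?_, tendsto_nhds_unique l1 l3, tendsto_nhds_unique l2 l4⟩
  exact ge_of_tendsto ((hlim.inner tendsto_const_nhds).abs)
    (Eventually.of_forall fun j => hy2 (σ j))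

theorem WeakLap.avg_eq {v : E → ℝ} {g : E → E} {f : E → ℝ} {D : Set E} (hv : IsC1 v g)
    (h : WeakLap g f D) {x : E} {t m : ℝ} (ht : 0 ≤ t) (hD : ball x t ⊆ D)
    (hf : ∀ z ∈ ball x t, f z = m) : avg v t x = wtMass E * v x + m * ztMass E * t ^ 2 / 4 :=
  le_antisymm (h.avg_le hv ht hD fun z hz => (hf z hz).le)
    (h.le_avg hv ht hD fun z hz => (hf z hz).ge)

theorem WeakLap.grad_avg {v : E → ℝ} {g : E → E} {f : E → ℝ} {D : Set E} (hv : IsC1 v g)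
    (h : WeakLap g f D) {x : E} {t R m : ℝ} (ht : 0 ≤ t) (htR : t < R) (hD : ball x R ⊆ D)
    (hf : ∀ z ∈ ball x R, f z = m) (ν : E) :
    ∫ y, ⟪g (x + t • y), ν⟫ * wt y = wtMass E * ⟪g x, ν⟫ := by
  have hg := hv.cont_grad
  have hvc := hv.continuous
  have hline : ∀ (p : E) (s : ℝ), HasDerivAt (fun s => v (p + s • ν)) ⟪g (p + s • ν), ν⟫ s :=
    fun p s => hv.hasDerivAt_line p ν s
  have h1 := hasDerivAt_integral_weight (F := fun s y => v (x + t • y + s • ν))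
    (F' := fun s y => ⟪g (x + t • y + s • ν), ν⟫) continuous_wt hasCompactSupport_wt isOpen_univ
    (mem_univ (0 : ℝ)) (fun s _ => by fun_prop)
    (by
      have : Continuous fun p : ℝ × E => ⟪g (x + t • p.2 + p.1 • ν), ν⟫ :=
        (hg.comp (by fun_prop)).inner continuous_const
      exact this.continuousOn)
    fun s _ y => hline _ s
  have h2 := ((hline x 0).const_mul (wtMass E)).add_const (m * ztMass E * t ^ 2 / 4)
  have hev : ∀ᶠ s : ℝ in nhds 0, (∫ y, v (x + t • y + s • ν) * wt y) =
      wtMass E * v (x + s • ν) + m * ztMass E * t ^ 2 / 4 := by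
    have hcont : Tendsto (fun s : ℝ => ‖s • ν‖) (nhds 0) (nhds 0) := by
      have : Continuous fun s : ℝ => ‖s • ν‖ := by fun_prop
      simpa using this.tendsto 0
    filter_upwards [hcont.eventually (gt_mem_nhds (sub_pos.2 htR))] with s hs
    have hsub : ball (x + s • ν) t ⊆ ball x R :=
      ball_subset_ball' (by rw [dist_eq_norm, add_sub_cancel_left]; linarith)
    rw [← h.avg_eq hv ht (hsub.trans hD) fun z hz => hf z (hsub hz), avg]
    simp only [add_right_comm]
  have h3 := (h1.congr_of_eventuallyEq (hev.mono fun _ h => h.symm)).unique h2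
  simpa using h3

theorem contDiff_wt : ContDiff ℝ 1 (wt : E → ℝ) :=
  contDiff_one_iff_hasFDerivAt.2 ⟨_, (innerSL ℝ).continuous.comp isC1_wt.cont_grad,
    isC1_wt.hasFDerivAt⟩

theorem WeakLap.exists_hasFDerivAt {v : E → ℝ} {g : E → E} (hv : IsC1 v g)
    (h : WeakLap g (fun _ => 0) univ) (x : E) : ∃ L : E →L[ℝ] E, HasFDerivAt g L x := by
  have hg := hv.cont_grad
  have e : g = fun x => (wtMass E)⁻¹ • convolution wt g (ContinuousLinearMap.lsmul ℝ ℝ) volume x := by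
    ext1 x
    refine ext_inner_right ℝ fun ν => ?_
    have h1 := h.grad_avg hv zero_le_one one_lt_two (subset_univ (ball x 2)) (fun _ _ => rfl) ν
    have hi : Integrable fun y => wt y • g (x - y) :=
      Continuous.integrable_of_hasCompactSupport (by fun_prop) hasCompactSupport_wt.smul_right
    rw [real_inner_smul_left, convolution]
    simp only [ContinuousLinearMap.lsmul_apply]
    rw [real_inner_comm ν (∫ y, wt y • g (x - y)), ← integral_inner hi ν, eq_inv_mul_iff_mul_eq₀ wtMass_pos.ne', ← h1,
      ← integral_neg_eq_self]
    refine integral_congr_ae (Eventually.of_forall fun y => ?_)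
    simp only [wt_neg, inner_smul_right, one_smul, sub_eq_add_neg, real_inner_comm ν]
    ring
  have h2 := (hasCompactSupport_wt.hasFDerivAt_convolution_left (ContinuousLinearMap.lsmul ℝ ℝ)
    contDiff_wt (hg.locallyIntegrable (μ := volume)) x).const_smul (wtMass E)⁻¹
  exact ⟨_, h2.congr_of_eventuallyEq (Eventually.of_forall fun y => congrFun e y)⟩

theorem IsC1.abs_zf_le {v : E → ℝ} {g : E → E} (hv : IsC1 v g) (h0 : v 0 = 0) {L : E →L[ℝ] E}
    {ε δ : ℝ} (hL : ∀ y, ‖y‖ < δ → ‖g y - L y‖ ≤ ε * ‖y‖) {y : E} (hy : ‖y‖ < δ) :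
    |v y| ≤ (‖L‖ + ε) * ‖y‖ ^ 2 ∧ |zf v g y| ≤ 3 * ε * ‖y‖ ^ 2 := by
  have hd : ∀ s : ℝ, HasDerivAt (fun s => v (s • y) - s ^ 2 / 2 * ⟪L y, y⟫)
      (⟪g (s • y) - L (s • y), y⟫) s := fun s => by
    have h1 := hv.hasDerivAt_line 0 y s
    simp only [zero_add] at h1
    refine (h1.sub (((hasDerivAt_pow 2 s).div_const 2).mul_const ⟪L y, y⟫)).congr_deriv ?_
    simp only [inner_sub_left, map_smul, real_inner_smul_left]
    push_cast
    ring
  have hε : 0 ≤ ε * ‖y‖ := (norm_nonneg _).trans (hL y hy)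
  have h1 : |v y - 1 / 2 * ⟪L y, y⟫| ≤ ε * ‖y‖ ^ 2 := by
    have := (convex_Icc (0 : ℝ) 1).norm_image_sub_le_of_norm_hasDerivWithin_le
      (C := ε * ‖y‖ ^ 2) (fun s _ => (hd s).hasDerivWithinAt) (fun s hs => ?_)
      (left_mem_Icc.2 zero_le_one) (right_mem_Icc.2 zero_le_one)
    · simpa [h0] using this
    · have hsy : ‖s • y‖ ≤ ‖y‖ := by
        rw [norm_smul, Real.norm_of_nonneg hs.1]
        exact mul_le_of_le_one_left (norm_nonneg _) hs.2
      refine (abs_real_inner_le_norm _ _).trans ?_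
      have h2 := hL _ (hsy.trans_lt hy)
      rw [norm_smul, Real.norm_of_nonneg hs.1] at h2
      have h3 : ε * (s * ‖y‖) ≤ ε * ‖y‖ := by
        have := mul_le_of_le_one_left hε hs.2
        linarith
      nlinarith [norm_nonneg y]
  have h2 : |⟪g y - L y, y⟫| ≤ ε * ‖y‖ ^ 2 := (abs_real_inner_le_norm _ _).trans (by
    nlinarith [hL y hy, norm_nonneg y])
  have h3 : |⟪L y, y⟫| ≤ ‖L‖ * ‖y‖ ^ 2 := (abs_real_inner_le_norm _ _).trans (by
    nlinarith [L.le_opNorm y, norm_nonneg y])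
  have h4 : 0 ≤ ‖L‖ * ‖y‖ ^ 2 := by positivity
  rw [inner_sub_left] at h2
  rw [abs_le] at h1 h2 h3
  constructor
  · rw [abs_le]; constructor <;> linarith [h1.1, h1.2, h3.1, h3.2]
  · rw [zf, abs_le]; constructor <;> linarith [h1.1, h1.2, h2.1, h2.2]

theorem IsC1.tendsto_weiss_zero {v : E → ℝ} {g : E → E} (hv : IsC1 v g)
    (hw : WeakLap g (fun _ => 0) univ) (h0 : v 0 = 0) (hg0 : g 0 = 0) {L : E →L[ℝ] E}
    (hL : HasFDerivAt g L 0) :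
    Tendsto (fun t => weiss 0 (_root_.sc t v) (scg t g)) (nhdsWithin 0 (Ioi 0)) (nhds 0) := by
  refine Metric.tendsto_nhds.2 fun η hη => ?_
  have hwm := wtMass_pos (E := E)
  set P := 6 * (‖L‖ + 1) * wtMass E with hP
  have hP0 : 0 < P := by positivity
  set ε := min 1 (η / (2 * P)) with hε
  have hε0 : 0 < ε := by positivity
  have hlin : ∀ᶠ y in nhds (0 : E), ‖g y - L y‖ ≤ ε * ‖y‖ := by
    have := hL.isLittleO.def hε0
    simpa [hg0] using this
  obtain ⟨δ, hδ, hball⟩ := Metric.eventually_nhds_iff_ball.1 hlin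
  filter_upwards [Ioo_mem_nhdsGT hδ] with t ht
  have ht0 := ht.1
  rw [weiss_eq (hv.sc t) ((hw.mono (subset_univ _)).sc (R := 2 * t) ht0)
    (closedBall_subset_ball (by rw [mul_div_cancel_right₀ _ ht0.ne']; norm_num)), dist_zero_right]
  have hb : ∀ x : E, ‖(0 - 0) * _root_.sc t v x * zt x + 2 * _root_.sc t v x *
      zf (_root_.sc t v) (scg t g) x * wt x‖ ≤ 6 * (‖L‖ + 1) * ε * wt x := fun x => by
    rcases le_or_gt ‖x‖ 1 with hx | hx
    · have hn : ‖t • x‖ = t * ‖x‖ := by rw [norm_smul, Real.norm_of_nonneg ht0.le]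
      have hty : ‖t • x‖ < δ := by rw [hn]; nlinarith [ht.2, norm_nonneg x]
      obtain ⟨h1, h2⟩ := hv.abs_zf_le h0 (fun y hy => hball y (by simpa using hy)) hty
      rw [hn] at h1 h2
      have hx2 : ‖x‖ ^ 2 ≤ 1 := pow_le_one₀ (norm_nonneg _) hx
      have h1' : |_root_.sc t v x| ≤ ‖L‖ + 1 := by
        rw [_root_.sc, abs_mul, abs_of_pos (by positivity), inv_mul_le_iff₀ (by positivity)]
        refine h1.trans ?_
        have : ε ≤ 1 := min_le_left _ _
        rw [mul_pow, mul_comm]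
        gcongr
        exact mul_le_of_le_one_right (by positivity) hx2
      have h2' : |zf (_root_.sc t v) (scg t g) x| ≤ 3 * ε := by
        rw [zf_sc ht0.ne', abs_mul, abs_of_pos (by positivity), inv_mul_le_iff₀ (by positivity)]
        refine h2.trans ?_
        rw [mul_pow, mul_comm]
        gcongr
        exact mul_le_of_le_one_right (by positivity) hx2
      rw [sub_zero, zero_mul, zero_mul, zero_add, Real.norm_eq_abs, abs_mul, abs_mul, abs_mul,
        abs_of_nonneg (wt_nonneg x), abs_of_pos (by norm_num)]
      refine mul_le_mul_of_nonneg_right ?_ (wt_nonneg x)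
      calc 2 * |_root_.sc t v x| * |zf (_root_.sc t v) (scg t g) x| ≤
          2 * (‖L‖ + 1) * (3 * ε) := by gcongr
        _ = _ := by ring
    · simp [wt_eq_zero hx.le, zt_eq_zero hx.le]
  refine (norm_integral_le_of_norm_le (integrable_wt.const_mul _)
    (Eventually.of_forall hb)).trans_lt ?_
  rw [integral_const_mul]
  change 6 * (‖L‖ + 1) * ε * wtMass E < η
  have : ε ≤ η / (2 * P) := min_le_right _ _
  rw [le_div_iff₀ (by positivity)] at this
  nlinarith

/-- Thick zero sets force quadratic growth along the corresponding scales. -/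
theorem Sol.not_thick_of_tendsto {u : E → ℝ} {g : E → E} {Ω : Set E} (h : Sol u g Ω)
    (h0 : u 0 = 0) (hg0 : g 0 = 0) {r : ℕ → ℝ} (hr : ∀ j, 0 < r j)
    (hr0 : Tendsto r atTop (nhds 0)) (h1 : ∀ j, 1 ≤ hN (sc (r j) u))
    (hN' : Tendsto (fun j => hN (sc (r j) u)) atTop atTop) {c : ℝ} (hc : 0 < c)
    (ht : ∀ j, Thick c (sc (r j) u) (scg (r j) g)) : False := by
  obtain ⟨σ, v₀, g₀, hσ, b⟩ := h.exists_blowUp (M := fun j => √(hN (sc (r j) u))) (C := 1) hr hr0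
    (fun j => Real.one_le_sqrt.2 (h1 j)) fun j => by rw [Real.sq_sqrt (hN_nonneg _), one_mul]
  have hM : Tendsto (fun j => √(hN (sc (r (σ j)) u))) atTop atTop :=
    Real.tendsto_sqrt_atTop.comp (hN'.comp hσ)
  have hC1 : ∀ j, IsC1 _ _ := fun j => (h.isC1.sc (r (σ j))).const_mul (√(hN (sc (r (σ j)) u)))⁻¹
  have hw := b.weakLap_zero h hM
  have hm : Tendsto (fun j => 2 / √(hN (sc (r (σ j)) u))) atTop (nhds 0) :=
    tendsto_const_nhds.div_atTop hM
  have hv0 : v₀ 0 = 0 := by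
    refine tendsto_nhds_unique (b.conv.tendsto 0) (tendsto_const_nhds.congr fun j => ?_)
    simp [sc, h0]
  have hgv0 : g₀ 0 = 0 := by
    refine tendsto_nhds_unique (b.conv.tendsto_grad 0) (tendsto_const_nhds.congr fun j => ?_)
    simp [scg, hg0]
  have hN1 : hN v₀ = 1 := by
    refine tendsto_nhds_unique (b.conv.tendsto_hN b.isC1 hC1) (tendsto_const_nhds.congr fun j => ?_)
    have := h1 (σ j)
    rw [hN_const_mul, inv_pow, Real.sq_sqrt (by linarith), inv_mul_cancel₀ (by linarith)]
  obtain ⟨L, hL⟩ := hw.exists_hasFDerivAt b.isC1 0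
  have hlim : ∀ t : ℝ, 0 < t → Tendsto (fun j => weiss 2 (sc (t * r (σ j)) u)
      (scg (t * r (σ j)) g) / √(hN (sc (r (σ j)) u)) ^ 2) atTop
      (nhds (weiss 0 (sc t v₀) (scg t g₀))) := fun t ht => b.tendsto_weiss h hm ht
  have hmono : ∀ s t, 0 < s → s ≤ t → weiss 0 (sc s v₀) (scg s g₀) ≤
      weiss 0 (sc t v₀) (scg t g₀) := fun s t hs hst => by
    refine le_of_tendsto_of_tendsto (hlim s hs) (hlim t (hs.trans_le hst)) ?_
    filter_upwards [eventually_mul_lt b.r_tendsto t one_pos] with j hj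
    have hrj := b.r_pos j
    have hle : s * r (σ j) ≤ t * r (σ j) := by gcongr
    exact div_le_div_of_nonneg_right (h.weiss_mono ⟨by positivity, hle.trans_lt hj⟩
      ⟨by nlinarith, hj⟩ hle) (by positivity)
  have hnonpos : ∀ t, 0 < t → weiss 0 (sc t v₀) (scg t g₀) ≤ 0 := fun t ht => by
    have hM2 : Tendsto (fun j => √(hN (sc (r (σ j)) u)) ^ 2) atTop atTop :=
      (tendsto_pow_atTop two_ne_zero).comp hM
    refine le_of_tendsto_of_tendsto (hlim t ht)
      (tendsto_const_nhds (x := weiss 2 (sc (1 / 2) u) (scg (1 / 2) g)) |>.div_atTop hM2) ?_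
    filter_upwards [eventually_mul_lt b.r_tendsto t (half_pos one_pos)] with j hj
    have hrj := b.r_pos j
    exact div_le_div_of_nonneg_right (h.weiss_mono ⟨by positivity, by linarith⟩
      ⟨by norm_num, by norm_num⟩ hj.le) (by positivity)
  have hzero : ∀ t, 0 < t → weiss 0 (sc t v₀) (scg t g₀) = 0 := fun t ht => by
    refine le_antisymm (hnonpos t ht) ?_
    refine le_of_tendsto (b.isC1.tendsto_weiss_zero hw hv0 hgv0 hL) ?_
    filter_upwards [Ioo_mem_nhdsGT ht] with s hs
    exact hmono s t hs.1 hs.2.le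
  have hz := b.zf_eq_zero_of_const h hm hzero
  have hlinear : ∀ x, g₀ x = L x := fun x => by
    have hd := hL.comp_hasDerivAt_of_eq (0 : ℝ) ((hasDerivAt_id (0 : ℝ)).smul_const x) (by simp)
    have hsl := (hasDerivAt_iff_tendsto_slope.1 hd).mono_left
      (nhdsWithin_mono 0 fun s (hs : s ∈ Ioi (0 : ℝ)) => (mem_Ioi.1 hs).ne')
    have hc : ∀ᶠ s in nhdsWithin (0 : ℝ) (Ioi 0), g₀ x = slope (g₀ ∘ fun s => id s • x) 0 s := by
      filter_upwards [self_mem_nhdsWithin] with s hs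
      have hs0 : 0 < s := hs
      simp [slope_def_module, hgv0, (b.isC1.homogeneous hz hs0 x).2, smul_smul, hs0.ne']
    have := tendsto_nhds_unique (tendsto_const_nhds.congr' hc) hsl
    simpa using this
  have hthick : Thick c v₀ g₀ := Thick.limit b.conv b.isC1 fun j n hn => by
    obtain ⟨y, h1, h2, h3, h4⟩ := ht (σ j) n hn
    exact ⟨y, h1, h2, by simp [h3], by simp [h4]⟩
  by_cases hker : L.ker = ⊤
  · have hL0 : ∀ x, L x = 0 := fun x => by
      have : x ∈ L.ker := by rw [hker]; trivial
      exact this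
    have : ∀ x, v₀ x = 0 := fun x => by
      have := hz x
      rw [zf, hlinear, hL0, inner_zero_left] at this
      linarith
    simp [hN, this] at hN1
  · have hne : L.kerᗮ ≠ ⊥ := fun hb => hker ((Submodule.orthogonal_eq_bot_iff).1 hb)
    obtain ⟨n, hn, hn0⟩ := Submodule.exists_mem_ne_zero_of_ne_bot hne
    obtain ⟨y, -, h2, -, h4⟩ := hthick (‖n‖⁻¹ • n) (norm_smul_inv_norm (𝕜 := ℝ) hn0)
    have : ⟪y, n⟫ = 0 := hn y (by rw [hlinear] at h4; exact h4)
    rw [real_inner_smul_right, this, mul_zero, abs_zero] at h2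
    linarith

end Homogeneous

section Rotation

variable {E : Type*} [NormedAddCommGroup E] [InnerProductSpace ℝ E] [FiniteDimensional ℝ E]
  [MeasurableSpace E] [BorelSpace E]

/-- A rotation-invariant bump on `E × E`. -/
def kp (p : E × E) : ℝ := max (1 - ‖p.1‖ ^ 2 - ‖p.2‖ ^ 2) 0 ^ 2

@[fun_prop] theorem continuous_kp : Continuous (kp : E × E → ℝ) := by
  unfold kp; fun_prop

theorem kp_nonneg (p : E × E) : 0 ≤ kp p := by unfold kp; positivity

theorem kp_eq_zero {p : E × E} (hp : 1 < ‖p‖) : kp p = 0 := by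
  have : 1 - ‖p.1‖ ^ 2 - ‖p.2‖ ^ 2 ≤ 0 := by
    rw [Prod.norm_def, lt_max_iff] at hp
    rcases hp with h | h <;> nlinarith [sq_nonneg ‖p.1‖, sq_nonneg ‖p.2‖]
  simp [kp, max_eq_right this]

theorem hasCompactSupport_kp : HasCompactSupport (kp : E × E → ℝ) :=
  HasCompactSupport.intro (isCompact_closedBall 0 1) fun p hp => kp_eq_zero (by simpa using hp)

theorem integrable_mul_kp {h : E × E → ℝ} (hh : Continuous h) : Integrable fun p => h p * kp p :=
  Continuous.integrable_of_hasCompactSupport (by fun_prop) hasCompactSupport_kp.mul_left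

/-- Integration against `kp`, as a functional on continuous functions. -/
def kint : C(E × E, ℝ) →ₗ[ℝ] ℝ where
  toFun h := ∫ p, h p * kp p
  map_add' h k := by
    rw [← integral_add (integrable_mul_kp h.continuous) (integrable_mul_kp k.continuous)]
    simp [add_mul]
  map_smul' c h := by
    simp [mul_assoc, integral_const_mul]

theorem kint_apply (h : C(E × E, ℝ)) : kint h = ∫ p, h p * kp p := rfl

theorem kint_mono {h k : C(E × E, ℝ)} (hk : ∀ p, ‖p‖ ≤ 1 → h p ≤ k p) : kint h ≤ kint k := by
  refine integral_mono (integrable_mul_kp h.continuous) (integrable_mul_kp k.continuous)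
    fun p => ?_
  rcases le_or_gt ‖p‖ 1 with hp | hp
  · exact mul_le_mul_of_nonneg_right (hk p hp) (kp_nonneg p)
  · simp [kp_eq_zero hp]

theorem kint_nonneg {h : C(E × E, ℝ)} (hk : ∀ p, ‖p‖ ≤ 1 → 0 ≤ h p) : 0 ≤ kint h := by
  simpa using kint_mono (h := 0) hk

theorem eq_zero_of_kint_nonpos {h : C(E × E, ℝ)} (h0 : ∀ p, 0 ≤ h p) (hk : kint h ≤ 0) {p : E × E}
    (hp : kp p ≠ 0) : h p = 0 := by
  by_contra hne
  exact hk.not_gt (Continuous.integral_pos_of_hasCompactSupport_nonneg_nonzero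
    (f := fun p => h p * kp p) (by fun_prop) hasCompactSupport_kp.mul_left
    (fun p => mul_nonneg (h0 p) (kp_nonneg p)) (mul_ne_zero hne hp))

/-- The rotated coordinate `cos θ • x + sin θ • y`. -/
def rotC (θ : ℝ) : C(E × E, E) := ⟨fun p => Real.cos θ • p.1 + Real.sin θ • p.2, by fun_prop⟩

theorem rotC_apply (θ : ℝ) (p : E × E) : rotC θ p = Real.cos θ • p.1 + Real.sin θ • p.2 := rfl

/-- The rotation of `E × E` by the angle `θ`. -/
def rotL (θ : ℝ) : E × E →ₗ[ℝ] E × E :=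
  (Real.cos θ • LinearMap.fst ℝ E E + Real.sin θ • LinearMap.snd ℝ E E).prod
    (-Real.sin θ • LinearMap.fst ℝ E E + Real.cos θ • LinearMap.snd ℝ E E)

theorem rotL_apply (θ : ℝ) (p : E × E) : rotL θ p =
    (Real.cos θ • p.1 + Real.sin θ • p.2, -Real.sin θ • p.1 + Real.cos θ • p.2) := rfl

theorem rotC_rotL (α θ : ℝ) (p : E × E) : rotC α (rotL θ p) = rotC (α + θ) p := by
  simp only [rotC_apply, rotL_apply, Real.cos_add, Real.sin_add]
  module

theorem rotL_rotL (α θ : ℝ) (p : E × E) : rotL α (rotL θ p) = rotL (α + θ) p := by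
  simp only [rotL_apply, Real.cos_add, Real.sin_add]
  ext <;> simp only <;> module

theorem kp_rotL (θ : ℝ) (p : E × E) : kp (rotL θ p) = kp p := by
  have : ‖(rotL θ p).1‖ ^ 2 + ‖(rotL θ p).2‖ ^ 2 = ‖p.1‖ ^ 2 + ‖p.2‖ ^ 2 := by
    simp only [rotL_apply, ← real_inner_self_eq_norm_sq, inner_add_left, inner_add_right,
      real_inner_smul_left, real_inner_smul_right, real_inner_comm p.1 p.2]
    linear_combination (⟪p.1, p.1⟫ + ⟪p.2, p.2⟫) * Real.sin_sq_add_cos_sq θ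
  rw [kp, kp, sub_sub, sub_sub, this]

theorem integral_comp_rotL (θ : ℝ) {h : E × E → ℝ} (hh : Continuous h) :
    ∫ p, h (rotL θ p) * kp p = ∫ p, h p * kp p := by
  have hc : Continuous (fun p : E × E => rotL θ p) := by
    simp only [rotL_apply]
    fun_prop
  have hdet : LinearMap.det (rotL θ : E × E →ₗ[ℝ] E × E) ≠ 0 := by
    have : rotL (-θ) ∘ₗ rotL θ = (LinearMap.id : E × E →ₗ[ℝ] E × E) := by
      refine LinearMap.ext fun p => ?_
      rw [LinearMap.comp_apply, rotL_rotL, neg_add_cancel, rotL_apply]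
      simp
    have h2 := congrArg LinearMap.det this
    rw [LinearMap.det_comp, LinearMap.det_id] at h2
    exact right_ne_zero_of_mul_eq_one h2
  have : (volume : Measure (E × E)).IsAddHaarMeasure := by
    rw [Measure.volume_eq_prod]
    infer_instance
  have hmap := Measure.map_linearMap_addHaar_eq_smul_addHaar (volume : Measure (E × E)) hdet
  set d := ENNReal.ofReal |(LinearMap.det (rotL θ : E × E →ₗ[ℝ] E × E))⁻¹| with hd
  have key : ∀ k : E × E → ℝ, Continuous k → ∫ p, k (rotL θ p) * kp p =
      d.toReal * ∫ p, k p * kp p := fun k hk => by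
    have : AEStronglyMeasurable (fun p => k p * kp p)
      (Measure.map (rotL θ) (volume : Measure (E × E))) := by
      exact (show Continuous fun p => k p * kp p by fun_prop).aestronglyMeasurable
    have h1 := integral_map hc.measurable.aemeasurable this
    rw [hmap, integral_smul_measure] at h1
    simp only [kp_rotL, smul_eq_mul] at h1
    exact h1.symm
  have hpos : 0 < ∫ p : E × E, 1 * kp p :=
    Continuous.integral_pos_of_hasCompactSupport_nonneg_nonzero
      (f := fun p : E × E => 1 * kp p) (by fun_prop) hasCompactSupport_kp.mul_left
      (fun p => mul_nonneg zero_le_one (kp_nonneg p)) (x := 0) (by simp [kp])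
  have h1 := key (fun _ => 1) continuous_const
  rw [key h hh, (mul_eq_right₀ hpos.ne').1 h1.symm, one_mul]

/-- Pull back of a function along the rotated coordinate. -/
def pull (θ : ℝ) (f : C(E, ℝ)) : C(E × E, ℝ) := f.comp (rotC θ)

theorem pull_apply (θ : ℝ) (f : C(E, ℝ)) (p : E × E) :
    pull θ f p = f (Real.cos θ • p.1 + Real.sin θ • p.2) := rfl

theorem kint_pull (a b : C(E, ℝ)) (α β θ : ℝ) :
    kint (pull (α + θ) a * pull (β + θ) b) = kint (pull α a * pull β b) := by
  rw [kint_apply, kint_apply, ← integral_comp_rotL θ (pull α a * pull β b).continuous]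
  simp only [ContinuousMap.mul_apply, pull, ContinuousMap.comp_apply, rotC_rotL]

theorem integral_mul_kp_slice (x : E) (hx : ‖x‖ < 1) : ∃ c : ℝ, 0 < c ∧
    ∀ h : E → ℝ, ∫ y, h y * kp (x, y) = c * ∫ y, h (√(1 - ‖x‖ ^ 2) • y) * wt y := by
  have ha : 0 < 1 - ‖x‖ ^ 2 := by nlinarith [norm_nonneg x]
  set a := 1 - ‖x‖ ^ 2 with ha'
  have ht : 0 < √a := Real.sqrt_pos.2 ha
  refine ⟨√a ^ Module.finrank ℝ E * a ^ 2, by positivity, fun h => ?_⟩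
  have h1 := integral_affine (0 : E) ht fun y => h y * kp (x, y)
  have h2 : ∀ y : E, kp (x, √a • y) = a ^ 2 * wt y := fun y => by
    rw [kp, wt, norm_smul, Real.norm_of_nonneg ht.le, mul_pow, Real.sq_sqrt ha.le, ← mul_pow]
    congr 1
    rw [mul_max_of_nonneg _ _ ha.le, mul_zero]
    congr 1
    simp only [ha']
    ring
  simp only [zero_add, h2] at h1
  rw [eq_inv_mul_iff_mul_eq₀ (by positivity)] at h1
  rw [← h1, mul_assoc, ← integral_const_mul (a ^ 2)]
  congr 2
  ext y
  ring

theorem kp_slice_eq_zero {x : E} (hx : 1 ≤ ‖x‖) (y : E) : kp (x, y) = 0 := by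
  have : 1 - ‖x‖ ^ 2 - ‖y‖ ^ 2 ≤ 0 := by nlinarith [sq_nonneg ‖y‖]
  simp [kp, max_eq_right this]

theorem kint_mul_eq (a : C(E, ℝ)) (h : C(E × E, ℝ)) :
    kint (pull 0 a * h) = ∫ x, a x * ∫ y, h (x, y) * kp (x, y) := by
  rw [kint_apply, Measure.volume_eq_prod, integral_prod _
    (by exact integrable_mul_kp (pull 0 a * h).continuous)]
  simp [pull_apply, mul_assoc, integral_const_mul]

theorem kint_pull_half_pi {a b : C(E, ℝ)} (hb : ∀ t x, 0 < t → b (t • x) = t * b x)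
    (h0 : ∫ y, b y * wt y = 0) : kint (pull 0 a * pull (Real.pi / 2) b) = 0 := by
  rw [kint_mul_eq]
  refine integral_eq_zero_of_ae (Eventually.of_forall fun x => ?_)
  rcases lt_or_ge ‖x‖ 1 with hx | hx
  · obtain ⟨c, hc, h⟩ := integral_mul_kp_slice x hx
    have ht : 0 < √(1 - ‖x‖ ^ 2) := Real.sqrt_pos.2 (by nlinarith [norm_nonneg x])
    simp only [pull_apply, Real.cos_pi_div_two, zero_smul, Real.sin_pi_div_two, one_smul, zero_add]
    rw [h]
    simp only [hb _ _ ht, mul_assoc, integral_const_mul, h0, mul_zero, Pi.zero_apply]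
  · simp [kp_slice_eq_zero hx]

theorem avg_neg_radius (v : E → ℝ) (t : ℝ) (x : E) : avg v (-t) x = avg v t x := by
  rw [avg, avg, ← integral_neg_eq_self]
  simp [wt_neg]

theorem cos_mul_kint_le {a f : C(E, ℝ)} (ha : ∀ x, 0 ≤ a x)
    (hf : ∀ t x, 0 < t → f (t • x) = t * f x)
    (hs : ∀ x t, 0 ≤ t → wtMass E * f x ≤ avg f t x) {θ : ℝ} (hθ : 0 < Real.cos θ) :
    Real.cos θ * kint (pull 0 a * pull 0 f) ≤ kint (pull 0 a * pull θ f) := by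
  have hs' : ∀ x t, wtMass E * f x ≤ avg f t x := fun x t => by
    rcases le_total 0 t with h | h
    · exact hs x t h
    · rw [← avg_neg_radius]; exact hs x (-t) (by linarith)
  have hi : ∀ h : C(E × E, ℝ), Integrable fun x => a x * ∫ y, h (x, y) * kp (x, y) := fun h => by
    have := (show Integrable (fun p => (pull 0 a * h) p * kp p) (volume.prod volume) from
      integrable_mul_kp (pull 0 a * h).continuous).integral_prod_left
    simpa [pull_apply, mul_assoc, integral_const_mul] using this
  rw [kint_mul_eq, kint_mul_eq, ← integral_const_mul]
  refine integral_mono ((hi _).const_mul _) (hi _) fun x => ?_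
  simp only
  rw [mul_left_comm]
  refine mul_le_mul_of_nonneg_left ?_ (ha x)
  rcases lt_or_ge ‖x‖ 1 with hx | hx
  · obtain ⟨c, hc, h⟩ := integral_mul_kp_slice x hx
    simp only [pull_apply]
    rw [h fun y => f (Real.cos 0 • x + Real.sin 0 • y), h fun y => f (Real.cos θ • x + Real.sin θ • y)]
    simp only [Real.cos_zero, Real.sin_zero, zero_smul, one_smul, add_zero, smul_smul, zero_mul]
    rw [mul_left_comm]
    refine mul_le_mul_of_nonneg_left ?_ hc.le
    have := hs' (Real.cos θ • x) (Real.sin θ * √(1 - ‖x‖ ^ 2))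
    rw [hf _ _ hθ, avg] at this
    rw [integral_const_mul]
    change Real.cos θ * (f x * wtMass E) ≤ _
    linarith
  · simp [kp_slice_eq_zero hx]

end Rotation

section Rigidity

theorem cos_pi_div_four_le {ρ : ℝ → ℝ} (h2 : ∀ h, 2 * ρ h ^ 2 - 1 ≤ ρ (2 * h))
    (h0 : ∀ η > 0, ∃ δ > 0, ∀ h, 0 < h → h < δ → Real.cos h - η * h ^ 2 ≤ ρ h) :
    Real.cos (Real.pi / 4) ≤ ρ (Real.pi / 4) := by
  have key : ∀ ε : ℝ, 0 < ε → ε < 1 → Real.cos ((1 + ε) * (Real.pi / 4)) ≤ ρ (Real.pi / 4) := by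
    intro ε hε hε1
    obtain ⟨δ, hδ, hρ⟩ := h0 (ε / 2) (half_pos hε)
    have hlim : Tendsto (fun k : ℕ => Real.pi / 4 * (1 / 2) ^ k) atTop (nhds 0) := by
      simpa using (tendsto_pow_atTop_nhds_zero_of_lt_one (r := (1 / 2 : ℝ)) (by norm_num)
        (by norm_num)).const_mul (Real.pi / 4)
    have step : ∀ k : ℕ, Real.cos ((1 + ε) * (Real.pi / 4 * (1 / 2) ^ k)) ≤
        ρ (Real.pi / 4 * (1 / 2) ^ k) → Real.cos ((1 + ε) * (Real.pi / 4)) ≤ ρ (Real.pi / 4) := by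
      intro k
      induction k with
      | zero => simp
      | succ k ih =>
        intro hk
        refine ih ?_
        set h := Real.pi / 4 * (1 / 2) ^ (k + 1) with hh
        have e : Real.pi / 4 * (1 / 2) ^ k = 2 * h := by rw [hh, pow_succ]; ring
        have hpos : 0 < h := by positivity
        have hle : h ≤ Real.pi / 8 := by
          have : (1 / 2 : ℝ) ^ k ≤ 1 := pow_le_one₀ (by norm_num) (by norm_num)
          rw [hh, pow_succ]
          nlinarith [Real.pi_pos]
        have hc : 0 ≤ Real.cos ((1 + ε) * h) := Real.cos_nonneg_of_neg_pi_div_two_le_of_le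
          (by nlinarith [Real.pi_pos]) (by nlinarith [Real.pi_pos])
        rw [e, show (1 + ε) * (2 * h) = 2 * ((1 + ε) * h) by ring, Real.cos_two_mul]
        refine le_trans ?_ (h2 h)
        gcongr
    have hs : 0 < min δ (min (ε / 2) (1 / 2)) := by positivity
    obtain ⟨k, hk⟩ := (hlim.eventually (gt_mem_nhds hs)).exists
    refine step k ?_
    set h := Real.pi / 4 * (1 / 2) ^ k
    have hpos : 0 < h := by positivity
    simp only [lt_min_iff] at hk
    obtain ⟨k1, k2, k3⟩ := hk
    refine le_trans ?_ (hρ h hpos k1)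
    have c1 := Real.one_sub_sq_div_two_le_cos (x := h)
    have hy : |(1 + ε) * h| ≤ 1 := by rw [abs_of_pos (by positivity)]; nlinarith
    have c2 := (abs_le.1 (Real.cos_bound hy)).2
    rw [abs_of_pos (by positivity)] at c2
    have h4 : ((1 + ε) * h) ^ 4 ≤ (2 * h) ^ 4 := by gcongr; linarith
    have h5 : h ^ 2 ≤ ε / 2 := by nlinarith
    have h6 : h ^ 4 ≤ ε / 2 * h ^ 2 := by
      rw [show h ^ 4 = h ^ 2 * h ^ 2 by ring]; gcongr
    nlinarith [mul_pos hε (pow_pos hpos 2), mul_pos (pow_pos hε 2) (pow_pos hpos 2)]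
  have hlim : Tendsto (fun ε : ℝ => Real.cos ((1 + ε) * (Real.pi / 4))) (nhdsWithin 0 (Ioi 0))
      (nhds (Real.cos (Real.pi / 4))) := by
    have : Continuous fun ε : ℝ => Real.cos ((1 + ε) * (Real.pi / 4)) := by fun_prop
    simpa using (this.tendsto 0).mono_left nhdsWithin_le_nhds
  refine le_of_tendsto hlim ?_
  filter_upwards [Ioo_mem_nhdsGT (one_pos (α := ℝ))] with ε hε using key ε hε.1 hε.2

variable {E : Type*} [NormedAddCommGroup E] [InnerProductSpace ℝ E] [FiniteDimensional ℝ E]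
  [MeasurableSpace E] [BorelSpace E]

theorem kint_pull_neg (a b : C(E, ℝ)) (θ : ℝ) :
    kint (pull θ a * pull 0 b) = kint (pull 0 a * pull (-θ) b) := by
  rw [← kint_pull a b 0 (-θ) θ]
  simp

theorem kint_pull_self (a b : C(E, ℝ)) (θ : ℝ) :
    kint (pull θ a * pull θ b) = kint (pull 0 a * pull 0 b) := by
  rw [← kint_pull a b 0 0 θ]
  simp

theorem exists_abs_pull_sub_le (f : C(E, ℝ)) {ε : ℝ} (hε : 0 < ε) : ∃ δ > 0, ∀ θ : ℝ, |θ| < δ →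
    ∀ p : E × E, ‖p‖ ≤ 1 → |pull θ f p - pull 0 f p| ≤ ε := by
  have := FiniteDimensional.proper ℝ E
  have hu := (isCompact_closedBall (0 : E) 2).uniformContinuousOn_of_continuous
    f.continuous.continuousOn
  rw [Metric.uniformContinuousOn_iff] at hu
  obtain ⟨δ, hδ, h⟩ := hu ε hε
  refine ⟨min 1 (δ / 2), by positivity, fun θ hθ p hp => ?_⟩
  rw [lt_min_iff] at hθ
  have hp1 : ‖p.1‖ ≤ 1 := (norm_fst_le p).trans hp
  have hp2 : ‖p.2‖ ≤ 1 := (norm_snd_le p).trans hp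
  have hc : |Real.cos θ - 1| ≤ |θ| := by
    have h1 := Real.one_sub_sq_div_two_le_cos (x := θ)
    rw [abs_sub_comm, abs_of_nonneg (by linarith [Real.cos_le_one θ])]
    nlinarith [sq_abs θ, abs_nonneg θ]
  have hs : |Real.sin θ| ≤ |θ| := Real.abs_sin_le_abs
  have hm : ∀ θ : ℝ, ‖Real.cos θ • p.1 + Real.sin θ • p.2‖ ≤ 2 := fun θ => by
    refine (norm_add_le _ _).trans ?_
    rw [norm_smul, norm_smul, Real.norm_eq_abs, Real.norm_eq_abs]
    nlinarith [Real.abs_cos_le_one θ, Real.abs_sin_le_one θ, norm_nonneg p.1, norm_nonneg p.2,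
      abs_nonneg (Real.cos θ), abs_nonneg (Real.sin θ)]
  refine (h _ (mem_closedBall_zero_iff.2 (hm θ)) _ (mem_closedBall_zero_iff.2 (hm 0)) ?_).le
  rw [dist_eq_norm, show Real.cos θ • p.1 + Real.sin θ • p.2 - (Real.cos 0 • p.1 + Real.sin 0 • p.2)
    = (Real.cos θ - 1) • p.1 + Real.sin θ • p.2 by simp [sub_smul]; abel]
  refine (norm_add_le _ _).trans_lt ?_
  rw [norm_smul, norm_smul, Real.norm_eq_abs, Real.norm_eq_abs]
  nlinarith [norm_nonneg p.1, norm_nonneg p.2, abs_nonneg (Real.cos θ - 1),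
    abs_nonneg (Real.sin θ)]

/-- A nonnegative continuous function, positively homogeneous of degree one, below its
averages. -/
structure SubHom (f : C(E, ℝ)) : Prop where
  nonneg : ∀ x, 0 ≤ f x
  hom : ∀ t x, 0 < t → f (t • x) = t * f x
  sub_mean : ∀ x t, 0 ≤ t → wtMass E * f x ≤ avg f t x

theorem SubHom.kint_cross_le {f g : C(E, ℝ)} (hf : SubHom f) (hg : SubHom g)
    (hfg : ∀ x, f x = 0 ∨ g x = 0) {η : ℝ} (hη : 0 < η) : ∃ δ > 0, ∀ θ : ℝ, |θ| < δ →
    kint (pull 0 g * pull θ f) ≤ η * θ ^ 2 := by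
  set G := kint (pull 0 g * pull 0 g) with hG
  set F := kint (pull 0 f) with hF
  have hG0 : 0 ≤ G := kint_nonneg fun p _ => mul_nonneg (hg.nonneg _) (hg.nonneg _)
  have hF0 : 0 ≤ F := kint_nonneg fun p _ => hf.nonneg _
  set d := η / (G + 1) with hd
  have hd0 : 0 < d := by positivity
  set ε := η * d / (F + 1) with hε
  have hε0 : 0 < ε := by positivity
  obtain ⟨δ, hδ, h⟩ := exists_abs_pull_sub_le f hε0
  refine ⟨min δ 1, by positivity, fun θ hθ => ?_⟩
  rw [lt_min_iff] at hθ
  have hcos : ∀ θ : ℝ, |θ| < 1 → 0 < Real.cos θ ∧ 1 - Real.cos θ ≤ θ ^ 2 / 2 := fun θ hθ => by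
    have := Real.one_sub_sq_div_two_le_cos (x := θ)
    have h2 : θ ^ 2 < 1 := by rw [← sq_abs]; nlinarith [abs_nonneg θ]
    constructor <;> linarith
  set k : C(E, ℝ) := f ⊓ ContinuousMap.const E ε with hk
  have hk_apply : ∀ x, k x = min (f x) ε := fun x => rfl
  have hk0 : ∀ x, 0 ≤ k x := fun x => le_min (hf.nonneg x) hε0.le
  have hmono : kint (pull 0 g * pull θ f) ≤ kint ((d / 2) • ((pull 0 g - pull θ g) *
      (pull 0 g - pull θ g)) + (d⁻¹ / 2) • ((pull θ k - pull 0 k) * (pull θ f - pull 0 f))) := by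
    refine kint_mono fun p hp => ?_
    have hb := h θ hθ.1 p hp
    simp only [ContinuousMap.mul_apply, ContinuousMap.add_apply, ContinuousMap.smul_apply,
      ContinuousMap.sub_apply, smul_eq_mul]
    have e : ∀ α, pull α k p = min (pull α f p) ε := fun α => rfl
    rw [e, e]
    have f0 : 0 ≤ pull 0 f p := hf.nonneg _
    have fθ : 0 ≤ pull θ f p := hf.nonneg _
    have g0 : 0 ≤ pull 0 g p := hg.nonneg _
    have gθ : 0 ≤ pull θ g p := hg.nonneg _
    have c0 : pull 0 f p = 0 ∨ pull 0 g p = 0 := hfg _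
    have cθ : pull θ f p = 0 ∨ pull θ g p = 0 := hfg _
    generalize pull 0 f p = a0 at *
    generalize pull θ f p = a1 at *
    generalize pull 0 g p = b0 at *
    generalize pull θ g p = b1 at *
    have hm : 0 ≤ (min a1 ε - min a0 ε) * (a1 - a0) := by
      rcases le_total a0 a1 with h | h
      · exact mul_nonneg (sub_nonneg.2 (min_le_min_right _ h)) (sub_nonneg.2 h)
      · exact mul_nonneg_of_nonpos_of_nonpos (sub_nonpos.2 (min_le_min_right _ h))
          (sub_nonpos.2 h)
    have hr : 0 ≤ d / 2 * ((b0 - b1) * (b0 - b1)) +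
        d⁻¹ / 2 * ((min a1 ε - min a0 ε) * (a1 - a0)) := by
      have := mul_self_nonneg (b0 - b1)
      positivity
    rcases c0 with rfl | rfl
    · rcases cθ with rfl | rfl
      · simpa using hr
      · rw [sub_zero, abs_of_nonneg fθ] at hb
        rw [min_eq_left hb, min_eq_left hε0.le]
        have : d * d⁻¹ = 1 := mul_inv_cancel₀ hd0.ne'
        have h3 : 0 ≤ d⁻¹ * (d * b0 - a1) ^ 2 := by positivity
        have h4 : d⁻¹ * (d * b0 - a1) ^ 2 = d * b0 ^ 2 * (d * d⁻¹) - 2 * (d * d⁻¹) * b0 * a1 +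
          d⁻¹ * a1 ^ 2 := by ring
        rw [h4, this] at h3
        linarith
    · simpa using hr
  refine hmono.trans ?_
  have e1 : (pull 0 g - pull θ g) * (pull 0 g - pull θ g) = pull 0 g * pull 0 g +
      pull θ g * pull θ g - (2 : ℝ) • (pull 0 g * pull θ g) := by
    rw [two_smul]; ring
  have e2 : (pull θ k - pull 0 k) * (pull θ f - pull 0 f) = pull θ k * pull θ f +
      pull 0 k * pull 0 f - pull 0 k * pull θ f - pull θ k * pull 0 f := by ring
  rw [e1, e2]
  simp only [map_add, map_sub, map_smul, smul_eq_mul, kint_pull_self, kint_pull_neg k f θ]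
  obtain ⟨q1, q2⟩ := hcos θ hθ.2
  have q3 := (hcos (-θ) (by simpa using hθ.2)).1
  have r1 := cos_mul_kint_le hg.nonneg hg.hom hg.sub_mean q1
  have r2 := cos_mul_kint_le hk0 hf.hom hf.sub_mean q1
  have r3 := cos_mul_kint_le hk0 hf.hom hf.sub_mean q3
  rw [Real.cos_neg] at r3
  have hH : kint (pull 0 k * pull 0 f) ≤ ε * F := by
    rw [hF, ← smul_eq_mul ε, ← map_smul]
    exact kint_mono fun p _ => mul_le_mul_of_nonneg_right (min_le_right _ _) (hf.nonneg _)
  have hH0 : 0 ≤ kint (pull 0 k * pull 0 f) :=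
    kint_nonneg fun p _ => mul_nonneg (hk0 _) (hf.nonneg _)
  set H := kint (pull 0 k * pull 0 f) with hHdef
  rw [← hG] at r1 ⊢
  have s1 : d * G ≤ η := by
    rw [hd, div_mul_eq_mul_div, div_le_iff₀ (by positivity)]; nlinarith
  have s2 : d⁻¹ * H ≤ η := by
    rw [inv_mul_le_iff₀ hd0]
    refine hH.trans ?_
    rw [hε, div_mul_eq_mul_div, div_le_iff₀ (by positivity)]
    nlinarith [mul_pos hη hd0]
  have t1 : G + G - 2 * kint (pull 0 g * pull θ g) ≤ G * θ ^ 2 := by nlinarith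
  have t2 : H + H - kint (pull 0 k * pull θ f) - kint (pull 0 k * pull (-θ) f) ≤ H * θ ^ 2 := by
    nlinarith
  calc _ ≤ d / 2 * (G * θ ^ 2) + d⁻¹ / 2 * (H * θ ^ 2) := by gcongr
    _ = (d * G / 2 + d⁻¹ * H / 2) * θ ^ 2 := by ring
    _ ≤ η * θ ^ 2 := by gcongr; linarith

/-- Two nonnegative homogeneous sub-mean functions with disjoint supports are the positive and
negative parts of a linear function, up to normalization. -/
theorem SubHom.add_eq {f g : C(E, ℝ)} (hf : SubHom f) (hg : SubHom g)
    (hfg : ∀ x, f x = 0 ∨ g x = 0) (hpos : ∃ x, f x ≠ 0)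
    (heq : ∫ y, f y * wt y = ∫ y, g y * wt y) (x y : E) :
    (f - g) (x + y) = (f - g) x + (f - g) y := by
  set F := f - g with hF
  have hFhom : ∀ t x, 0 < t → F (t • x) = t * F x := fun t x ht => by
    simp only [hF, ContinuousMap.sub_apply, hf.hom t x ht, hg.hom t x ht]; ring
  have hF0 : ∫ y, F y * wt y = 0 := by
    simp only [hF, ContinuousMap.sub_apply, sub_mul]
    rw [integral_sub (integrable_mul_wt f.continuous) (integrable_mul_wt g.continuous), heq,
      sub_self]
  have hscale : ∀ x y : E, ∃ t : ℝ, 0 < t ∧ kp (t • x, t • y) ≠ 0 := fun x y => by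
    have hc : Continuous fun t : ℝ => kp (t • x, t • y) := by fun_prop
    have h0 : kp ((0 : ℝ) • x, (0 : ℝ) • y) ≠ 0 := by simp [kp]
    have := (hc.tendsto 0).mono_left (nhdsWithin_le_nhds (s := Ioi 0)) |>.eventually_ne h0
    exact ((this.and self_mem_nhdsWithin).exists).imp fun t ht => ⟨ht.2, ht.1⟩
  set R : ℝ → ℝ := fun θ => kint (pull 0 F * pull θ F) with hR
  have hRdef : ∀ θ, kint (pull 0 F * pull θ F) = R θ := fun _ => rfl
  have hRneg : ∀ θ, kint (pull θ F * pull 0 F) = R θ := fun θ => by rw [mul_comm]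
  have hR0 : 0 < R 0 := by
    by_contra! hle
    obtain ⟨x, hx⟩ := hpos
    obtain ⟨t, ht, hk⟩ := hscale x 0
    have := eq_zero_of_kint_nonpos (h := pull 0 F * pull 0 F) (fun p => mul_self_nonneg _) hle hk
    have h1 : F (t • x) = 0 := by simpa [pull_apply] using this
    rw [hFhom t x ht, mul_eq_zero] at h1
    have h2 : f x - g x = 0 := h1.resolve_left ht.ne'
    rcases hfg x with h | h
    · exact hx h
    · rw [h, sub_zero] at h2; exact hx h2
  have hpsd : ∀ h, 2 * (R h / R 0) ^ 2 - 1 ≤ R (2 * h) / R 0 := fun h => by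
    set l := 2 * (R h / R 0) with hl
    have h1 : 0 ≤ kint ((pull 0 F + pull (2 * h) F - l • pull h F) *
      (pull 0 F + pull (2 * h) F - l • pull h F)) := kint_nonneg fun p _ => mul_self_nonneg _
    have e : (pull 0 F + pull (2 * h) F - l • pull h F) *
        (pull 0 F + pull (2 * h) F - l • pull h F) = pull 0 F * pull 0 F +
        pull (2 * h) F * pull (2 * h) F + (l * l) • (pull h F * pull h F) +
        (2 : ℝ) • (pull 0 F * pull (2 * h) F) - (2 * l) • (pull 0 F * pull h F) -
        (2 * l) • (pull h F * pull (2 * h) F) := by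
      ext p
      simp only [ContinuousMap.mul_apply, ContinuousMap.add_apply, ContinuousMap.sub_apply,
        ContinuousMap.smul_apply, smul_eq_mul]
      ring
    have e2 : kint (pull h F * pull (2 * h) F) = R h := by
      have := kint_pull F F 0 h h
      rwa [zero_add, ← two_mul] at this
    rw [e] at h1
    simp only [map_add, map_sub, map_smul, smul_eq_mul, kint_pull_self, e2, hRdef] at h1
    rw [le_div_iff₀ hR0]
    have e3 : R h = l / 2 * R 0 := by rw [hl]; field_simp
    rw [e3] at h1
    rw [show R h / R 0 = l / 2 by rw [hl]; ring]
    nlinarith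
  have hsmall : ∀ η > 0, ∃ δ > 0, ∀ h, 0 < h → h < δ →
      Real.cos h - η * h ^ 2 ≤ R h / R 0 := fun η hη => by
    obtain ⟨δ₁, hδ₁, h1⟩ := hf.kint_cross_le hg hfg (η := η * R 0 / 2) (by positivity)
    obtain ⟨δ₂, hδ₂, h2⟩ := hg.kint_cross_le hf (fun x => (hfg x).symm) (η := η * R 0 / 2)
      (by positivity)
    refine ⟨min (min δ₁ δ₂) 1, by positivity, fun h hh hlt => ?_⟩
    simp only [lt_min_iff] at hlt
    have a1 := h1 h (by rw [abs_of_pos hh]; exact hlt.1.1)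
    have a2 := h2 h (by rw [abs_of_pos hh]; exact hlt.1.2)
    have hc : 0 < Real.cos h := by
      have := Real.one_sub_sq_div_two_le_cos (x := h)
      nlinarith [hlt.2]
    have b1 := cos_mul_kint_le hf.nonneg hf.hom hf.sub_mean hc
    have b2 := cos_mul_kint_le hg.nonneg hg.hom hg.sub_mean hc
    have e : ∀ θ, R θ = kint (pull 0 f * pull θ f) + kint (pull 0 g * pull θ g) -
        kint (pull 0 g * pull θ f) - kint (pull 0 f * pull θ g) := fun θ => by
      rw [← map_add, ← map_sub, ← map_sub, ← hRdef]
      refine congrArg kint ?_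
      ext p
      simp only [ContinuousMap.mul_apply, ContinuousMap.add_apply, ContinuousMap.sub_apply,
        pull_apply, hF]
      ring
    have e0 : R 0 = kint (pull 0 f * pull 0 f) + kint (pull 0 g * pull 0 g) := by
      have z1 : pull 0 g * pull 0 f = 0 := by
        ext p; rcases hfg p.1 with h | h <;> simp [pull_apply, h]
      have z2 : pull 0 f * pull 0 g = 0 := by rw [mul_comm, z1]
      rw [e, z1, z2]; simp
    rw [le_div_iff₀ hR0, e h]
    have : Real.cos h * R 0 = Real.cos h * kint (pull 0 f * pull 0 f) +
      Real.cos h * kint (pull 0 g * pull 0 g) := by rw [e0]; ring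
    linarith
  have hquarter := cos_pi_div_four_le (ρ := fun h => R h / R 0) hpsd hsmall
  rw [le_div_iff₀ hR0] at hquarter
  set s := Real.cos (Real.pi / 4) with hs
  have hs0 : 0 < s := by rw [hs, Real.cos_pi_div_four]; positivity
  have hs2 : s * s = 1 / 2 := by
    rw [hs, Real.cos_pi_div_four, div_mul_div_comm, Real.mul_self_sqrt zero_le_two]; norm_num
  have hhalf : R (Real.pi / 2) = 0 := kint_pull_half_pi hFhom hF0
  have hfin : kint ((pull (Real.pi / 4) F - s • (pull 0 F + pull (Real.pi / 2) F)) *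
      (pull (Real.pi / 4) F - s • (pull 0 F + pull (Real.pi / 2) F))) ≤ 0 := by
    have e : (pull (Real.pi / 4) F - s • (pull 0 F + pull (Real.pi / 2) F)) *
        (pull (Real.pi / 4) F - s • (pull 0 F + pull (Real.pi / 2) F)) =
        pull (Real.pi / 4) F * pull (Real.pi / 4) F + (s * s) • (pull 0 F * pull 0 F) +
        (s * s) • (pull (Real.pi / 2) F * pull (Real.pi / 2) F) +
        (2 * (s * s)) • (pull 0 F * pull (Real.pi / 2) F) -
        (2 * s) • (pull 0 F * pull (Real.pi / 4) F) -
        (2 * s) • (pull (Real.pi / 4) F * pull (Real.pi / 2) F) := by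
      ext p
      simp only [ContinuousMap.mul_apply, ContinuousMap.add_apply, ContinuousMap.sub_apply,
        ContinuousMap.smul_apply, smul_eq_mul]
      ring
    have e2 : kint (pull (Real.pi / 4) F * pull (Real.pi / 2) F) = R (Real.pi / 4) := by
      have := kint_pull F F 0 (Real.pi / 4) (Real.pi / 4)
      rwa [zero_add, show Real.pi / 4 + Real.pi / 4 = Real.pi / 2 by ring] at this
    rw [e]
    simp only [map_add, map_sub, map_smul, smul_eq_mul, kint_pull_self, e2, hRdef, hhalf, hs2]
    nlinarith
  obtain ⟨t, ht, hk⟩ := hscale x y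
  have := eq_zero_of_kint_nonpos (fun p => mul_self_nonneg _) hfin hk
  have h1 := mul_self_eq_zero.1 this
  have hsin : Real.sin (Real.pi / 4) = s := by rw [hs, Real.sin_pi_div_four, Real.cos_pi_div_four]
  simp only [ContinuousMap.add_apply, ContinuousMap.sub_apply, ContinuousMap.smul_apply,
    smul_eq_mul, pull_apply, hsin, ← hs, Real.cos_zero, Real.sin_zero, Real.cos_pi_div_two,
    Real.sin_pi_div_two, zero_smul, one_smul, zero_add, add_zero, ← smul_add,
    hFhom _ _ hs0, hFhom _ _ ht] at h1
  have h2 : (s * t) * (F (x + y) - (F x + F y)) = 0 := by linear_combination h1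
  exact sub_eq_zero.1 ((mul_eq_zero.1 h2).resolve_left (by positivity))

theorem SubHom.const_smul {f : C(E, ℝ)} (hf : SubHom f) {c : ℝ} (hc : 0 ≤ c) : SubHom (c • f) where
  nonneg x := mul_nonneg hc (hf.nonneg x)
  hom t x ht := by simp only [ContinuousMap.smul_apply, hf.hom t x ht, smul_eq_mul]; ring
  sub_mean x t ht := by
    have := mul_le_mul_of_nonneg_left (hf.sub_mean x t ht) hc
    rw [avg] at this ⊢
    simp only [ContinuousMap.smul_apply, smul_eq_mul, mul_assoc, integral_const_mul]
    linarith

theorem SubHom.exists_inner_eq_zero {f g : C(E, ℝ)} (hf : SubHom f) (hg : SubHom g)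
    (hfg : ∀ x, f x = 0 ∨ g x = 0) (hf0 : ∃ x, f x ≠ 0) (hg0 : ∃ x, g x ≠ 0) :
    ∃ a : E, ‖a‖ = 1 ∧ ∀ x, f x = 0 → g x = 0 → ⟪x, a⟫ = 0 := by
  have hpos : ∀ {f : C(E, ℝ)}, SubHom f → (∃ x, f x ≠ 0) → 0 < ∫ y, f y * wt y := by
    rintro f hf ⟨x, hx⟩
    have hx0 : x ≠ 0 := by
      rintro rfl
      have := hf.hom 2 0 two_pos
      rw [smul_zero] at this
      exact hx (by linarith)
    have ht : 0 < (2 * ‖x‖)⁻¹ := by positivity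
    refine Continuous.integral_pos_of_hasCompactSupport_nonneg_nonzero
      (f := fun y => f y * wt y) (by fun_prop) hasCompactSupport_wt.mul_left
      (fun p => mul_nonneg (hf.nonneg _) (wt_nonneg p)) (x := (2 * ‖x‖)⁻¹ • x) ?_
    refine mul_ne_zero ?_ (wt_pos ?_).ne'
    · rw [hf.hom _ _ ht]; positivity
    · rw [norm_smul, Real.norm_of_nonneg ht.le, mul_inv, mul_assoc,
        inv_mul_cancel₀ (norm_ne_zero_iff.2 hx0)]
      norm_num
  set p := ∫ y, f y * wt y with hp
  set q := ∫ y, g y * wt y with hq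
  have hp0 : 0 < p := hpos hf hf0
  have hq0 : 0 < q := hpos hg hg0
  have hf' := hf.const_smul (inv_nonneg.2 hp0.le)
  have hg' := hg.const_smul (inv_nonneg.2 hq0.le)
  obtain ⟨x₀, hx₀⟩ := hf0
  have hadd := hf'.add_eq hg' (fun x => (hfg x).imp (fun h => by simp [h]) fun h => by simp [h])
    ⟨x₀, mul_ne_zero (inv_ne_zero hp0.ne') hx₀⟩ (by
      simp only [ContinuousMap.smul_apply, smul_eq_mul, mul_assoc, integral_const_mul]
      rw [← hp, ← hq, inv_mul_cancel₀ hp0.ne', inv_mul_cancel₀ hq0.ne'])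
  set F := p⁻¹ • f - q⁻¹ • g with hF
  set L : E →+ ℝ := AddMonoidHom.mk' F hadd with hL
  have hLc : Continuous L := F.continuous
  set T : E →L[ℝ] ℝ := L.toRealLinearMap hLc with hT
  have hTF : ∀ x, T x = p⁻¹ * f x - q⁻¹ * g x := fun x => rfl
  set a := (InnerProductSpace.toDual ℝ E).symm T with ha
  have haT : ∀ x, ⟪a, x⟫ = T x := fun x => InnerProductSpace.toDual_symm_apply
  have ha0 : a ≠ 0 := by
    intro h
    have := haT x₀
    rw [h, inner_zero_left, hTF, (hfg x₀).resolve_left hx₀, mul_zero, sub_zero] at this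
    exact mul_ne_zero (inv_ne_zero hp0.ne') hx₀ this.symm
  refine ⟨‖a‖⁻¹ • a, norm_smul_inv_norm (𝕜 := ℝ) ha0, fun x h1 h2 => ?_⟩
  rw [real_inner_smul_right, real_inner_comm, haT, hTF, h1, h2]
  simp

end Rigidity

section Derivative

variable {E : Type*} [NormedAddCommGroup E] [InnerProductSpace ℝ E] [FiniteDimensional ℝ E]
  [MeasurableSpace E] [BorelSpace E]

theorem WeakLap.translate {g : E → E} {f : E → ℝ} {D : Set E} (h : WeakLap g f D) (a : E) :
    WeakLap (fun x => g (x + a)) (fun x => f (x + a)) {x | x + a ∈ D} where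
  meas := h.meas.comp (measurable_add_const a)
  bdd := let ⟨B, hB⟩ := h.bdd; ⟨B, fun x => hB _⟩
  weak φ ψ hφ hc hs := by
    have e1 := h.weak (fun x => φ (-a + (1 : ℝ) • x)) (fun x => (1 : ℝ) • ψ (-a + (1 : ℝ) • x))
      (hφ.comp_affine (-a) 1) ?_ ?_
    · rw [← integral_add_right_eq_self _ a, ← integral_add_right_eq_self (fun x => f x * _) a] at e1
      simpa using e1
    · have := hc.comp_homeomorph (Homeomorph.addLeft (-a))
      simpa [Function.comp_def] using this
    · have := tsupport_comp_eq_preimage φ (Homeomorph.addLeft (-a))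
      simp only [one_smul]
      intro x hx
      have hx' : x ∈ tsupport (φ ∘ Homeomorph.addLeft (-a)) := hx
      rw [this] at hx'
      have := hs hx'
      simpa [add_comm] using this

theorem hasDerivAt_comp_max {q : ℝ → ℝ} {q' : ℝ → ℝ} (h : ∀ m, 0 ≤ m → HasDerivAt q (q' m) m)
    (h0 : q' 0 = 0) (s : ℝ) : HasDerivAt (fun s => q (max s 0)) (q' (max s 0)) s := by
  rcases lt_trichotomy s 0 with hs | rfl | hs
  · rw [max_eq_right hs.le, h0]
    refine (hasDerivAt_const s (q 0)).congr_of_eventuallyEq ?_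
    filter_upwards [gt_mem_nhds hs] with t ht
    rw [max_eq_right ht.le]
  · rw [max_self, ← hasDerivWithinAt_univ, ← Iic_union_Ici (a := (0 : ℝ))]
    refine HasDerivWithinAt.union ?_ ?_
    · rw [h0]
      refine (hasDerivWithinAt_const 0 _ (q 0)).congr (fun t ht => ?_) (by simp)
      rw [max_eq_right ht]
    · refine (h 0 le_rfl).hasDerivWithinAt.congr (fun t ht => ?_) (by simp)
      rw [max_eq_left ht]
  · rw [max_eq_left hs.le]
    refine (h s hs.le).congr_of_eventuallyEq ?_
    filter_upwards [lt_mem_nhds hs] with t ht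
    rw [max_eq_left ht.le]

theorem exists_convex_approx {ε : ℝ} (hε : 0 < ε) : ∃ β β' β'' : ℝ → ℝ, Continuous β' ∧
    Continuous β'' ∧ (∀ s, HasDerivAt β (β' s) s) ∧ (∀ s, HasDerivAt β' (β'' s) s) ∧
    (∀ s, 0 ≤ β'' s) ∧ (∀ s, s ≤ ε → β' s = 0) ∧ ∀ s, |β s - max s 0| ≤ 3 * ε := by
  have hp : ∀ m : ℝ, 0 ≤ m → m + ε ≠ 0 := fun m hm => by positivity
  have d1 : ∀ m : ℝ, 0 ≤ m → HasDerivAt (fun m => m ^ 3 / (m + ε) ^ 2)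
      (m ^ 2 * (m + 3 * ε) / (m + ε) ^ 3) m := fun m hm => by
    have := (hasDerivAt_pow 3 m).div (((hasDerivAt_id m).add_const ε).pow 2)
      (pow_ne_zero 2 (hp m hm))
    refine this.congr_deriv ?_
    have := hp m hm
    simp
    field_simp
    ring
  have d2 : ∀ m : ℝ, 0 ≤ m → HasDerivAt (fun m => m ^ 2 * (m + 3 * ε) / (m + ε) ^ 3)
      (6 * ε ^ 2 * m / (m + ε) ^ 4) m := fun m hm => by
    have := ((hasDerivAt_pow 2 m).mul ((hasDerivAt_id m).add_const (3 * ε))).div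
      (((hasDerivAt_id m).add_const ε).pow 3) (pow_ne_zero 3 (hp m hm))
    refine this.congr_deriv ?_
    have := hp m hm
    simp
    field_simp
    ring
  have h1 := fun s => (hasDerivAt_comp_max d1 (by simp) (s - ε)).comp s
    ((hasDerivAt_id s).sub_const ε)
  have h2 := fun s => (hasDerivAt_comp_max d2 (by simp) (s - ε)).comp s
    ((hasDerivAt_id s).sub_const ε)
  have hne : ∀ s : ℝ, max (s - ε) 0 + ε ≠ 0 := fun s => by positivity
  refine ⟨fun s => max (s - ε) 0 ^ 3 / (max (s - ε) 0 + ε) ^ 2,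
    fun s => max (s - ε) 0 ^ 2 * (max (s - ε) 0 + 3 * ε) / (max (s - ε) 0 + ε) ^ 3,
    fun s => 6 * ε ^ 2 * max (s - ε) 0 / (max (s - ε) 0 + ε) ^ 4, ?_, ?_, fun s => ?_, fun s => ?_,
    fun s => by positivity, fun s hs => ?_, fun s => ?_⟩
  · exact Continuous.div (by fun_prop) (by fun_prop) fun s => pow_ne_zero _ (hne s)
  · exact Continuous.div (by fun_prop) (by fun_prop) fun s => pow_ne_zero _ (hne s)
  · simpa [Function.comp_def] using h1 s
  · simpa [Function.comp_def] using h2 s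
  · simp [max_eq_right (sub_nonpos.2 hs)]
  · dsimp only
    have a1 : |max (s - ε) 0 - max s 0| ≤ ε := by
      refine (abs_max_sub_max_le_abs _ _ _).trans ?_
      rw [sub_sub_cancel_left, abs_neg, abs_of_pos hε]
    generalize max (s - ε) 0 = m, le_max_right (s - ε) 0 = hm at a1 ⊢
    have a2 : |m ^ 3 / (m + ε) ^ 2 - m| ≤ 2 * ε := by
      have e : m ^ 3 / (m + ε) ^ 2 - m = -(m * (2 * m * ε + ε ^ 2) / (m + ε) ^ 2) := by
        field_simp; ring
      rw [e, abs_neg, abs_of_nonneg (by positivity), div_le_iff₀ (by positivity)]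
      nlinarith [mul_nonneg hm hε.le, mul_nonneg hm (sq_nonneg ε), pow_pos hε 3]
    have := abs_sub_le (m ^ 3 / (m + ε) ^ 2) m (max s 0)
    linarith

theorem WeakLap.subLap_comp {w : E → ℝ} {G : E → E} (hw : IsC1 w G) {D D' : Set E} {ε : ℝ}
    (h : WeakLap G (fun _ => 0) D) (hD : ∀ x ∈ D', ε ≤ w x → x ∈ D) {β' β'' : ℝ → ℝ}
    (hc' : Continuous β') (hc'' : Continuous β'') (hd : ∀ s, HasDerivAt β' (β'' s) s)
    (h0 : ∀ s, 0 ≤ β'' s) (hε : ∀ s, s ≤ ε → β' s = 0) :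
    SubLap (fun x => β' (w x) • G x) D' := fun φ ψ hφ hc hs hn => by
  have t1 : IsC1 (fun x => β' (w x)) (fun x => β'' (w x) • G x) := hw.comp hc'' hd
  have t2 := t1.mul hφ
  have hcs : HasCompactSupport fun x => β' (w x) * φ x := hc.mul_left
  have hsub : tsupport (fun x => β' (w x) * φ x) ⊆ D := by
    intro x hx
    refine hD x (hs (tsupport_mul_subset_right hx)) ?_
    have hcl : IsClosed {x | ε ≤ w x} := isClosed_le continuous_const hw.continuous
    refine closure_minimal ?_ hcl hx
    intro y hy
    by_contra hlt
    rw [mem_ofPred_eq, not_le] at hlt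
    exact hy (by simp [hε _ hlt.le])
  have key := h.weak _ _ t2 hcs hsub
  have i1 : Integrable fun x => ⟪β' (w x) • G x, ψ x⟫ :=
    hφ.integrable_inner hc ((hc'.comp hw.continuous).smul hw.cont_grad)
  have i2 : Integrable fun x => (β'' (w x) * ‖G x‖ ^ 2) * φ x :=
    ((((hc''.comp hw.continuous).mul (hw.cont_grad.norm.pow 2))).mul
      hφ.continuous).integrable_of_hasCompactSupport hc.mul_left
  have e : ∀ x, ⟪G x, φ x • β'' (w x) • G x + β' (w x) • ψ x⟫ =
      ⟪β' (w x) • G x, ψ x⟫ + (β'' (w x) * ‖G x‖ ^ 2) * φ x := fun x => by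
    rw [inner_add_right, inner_smul_right, inner_smul_right, inner_smul_right,
      real_inner_self_eq_norm_sq, real_inner_smul_left]
    ring
  simp_rw [e] at key
  rw [integral_add i1 i2] at key
  have : 0 ≤ ∫ x, (β'' (w x) * ‖G x‖ ^ 2) * φ x :=
    MeasureTheory.integral_nonneg fun x => mul_nonneg (mul_nonneg (h0 _) (sq_nonneg _)) (hn x)
  simp only [zero_mul, integral_zero, neg_zero] at key
  linarith

theorem exists_slope_near {v : E → ℝ} {g : E → E} (hv : IsC1 v g) (ν : E) (R : ℝ) {ε : ℝ}
    (hε : 0 < ε) : ∃ h > 0, ∀ x, ‖x‖ ≤ R → |h⁻¹ * (v (x + h • ν) - v x) - ⟪g x, ν⟫| < ε ∧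
      |h⁻¹ * (v (x + h • ν) - v x) - ⟪g (x + h • ν), ν⟫| < ε := by
  have hcw : Continuous fun x => ⟪g x, ν⟫ := hv.cont_grad.inner continuous_const
  have huc := (isCompact_closedBall (0 : E) (R + ‖ν‖)).uniformContinuousOn_of_continuous
    hcw.continuousOn
  rw [Metric.uniformContinuousOn_iff] at huc
  obtain ⟨δ, hδ, H⟩ := huc ε hε
  have hν := norm_nonneg ν
  obtain ⟨h, hh, hh1, hhδ⟩ : ∃ h : ℝ, 0 < h ∧ h ≤ 1 ∧ h * ‖ν‖ < δ := by
    refine ⟨min 1 (δ / (‖ν‖ + 1)), by positivity, min_le_left _ _, ?_⟩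
    calc min 1 (δ / (‖ν‖ + 1)) * ‖ν‖ ≤ δ / (‖ν‖ + 1) * ‖ν‖ := by gcongr; exact min_le_right _ _
      _ < δ := by rw [div_mul_eq_mul_div, div_lt_iff₀ (by positivity)]; nlinarith
  refine ⟨h, hh, fun x hx => ?_⟩
  obtain ⟨s, ⟨hs0, hs1⟩, hs⟩ := exists_hasDerivAt_eq_slope (fun s : ℝ => v (x + s • ν))
    (fun s => ⟪g (x + s • ν), ν⟫) hh
    (hv.continuous.comp (by fun_prop : Continuous fun s : ℝ => x + s • ν)).continuousOn
    fun s _ => hv.hasDerivAt_line x ν s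
  have e : h⁻¹ * (v (x + h • ν) - v x) = ⟪g (x + s • ν), ν⟫ := by
    rw [hs]; simp [div_eq_inv_mul]
  have hmem : ∀ s : ℝ, 0 ≤ s → s ≤ h → x + s • ν ∈ closedBall (0 : E) (R + ‖ν‖) := by
    intro s h0 h1
    rw [mem_closedBall_zero_iff]
    refine (norm_add_le _ _).trans (add_le_add hx ?_)
    rw [norm_smul, Real.norm_of_nonneg h0]
    exact mul_le_of_le_one_left hν (h1.trans hh1)
  rw [e]
  have h0 := hmem 0 le_rfl hh.le
  rw [zero_smul, add_zero] at h0
  constructor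
  · refine H _ (hmem s hs0.le hs1.le) _ h0 ?_
    rw [dist_eq_norm, add_sub_cancel_left, norm_smul, Real.norm_of_nonneg hs0.le]
    exact lt_of_le_of_lt (by gcongr) hhδ
  · refine H _ (hmem s hs0.le hs1.le) _ (hmem h hh.le le_rfl) ?_
    rw [dist_eq_norm, add_sub_add_left_eq_sub, ← sub_smul, norm_smul, Real.norm_eq_abs,
      abs_of_nonpos (by linarith)]
    refine lt_of_le_of_lt ?_ hhδ
    gcongr
    linarith

theorem WeakLap.pos_part_le_avg {v : E → ℝ} {g : E → E} (hv : IsC1 v g)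
    (h : WeakLap g (fun _ => 1) {x | v x ≠ 0 ∨ g x ≠ 0}) (ν x : E) {t : ℝ} (ht : 0 ≤ t) :
    wtMass E * max ⟪g x, ν⟫ 0 ≤ avg (fun x => max ⟪g x, ν⟫ 0) t x := by
  have hcw : Continuous fun x => ⟪g x, ν⟫ := hv.cont_grad.inner continuous_const
  suffices H : ∀ ε : ℝ, 0 < ε → wtMass E * max ⟪g x, ν⟫ 0 ≤
      avg (fun x => max ⟪g x, ν⟫ 0) t x + 8 * wtMass E * ε by
    refine le_of_forall_pos_le_add fun η hη => ?_
    have hm := wtMass_pos (E := E)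
    have := H (η / (8 * wtMass E)) (by positivity)
    rwa [mul_div_cancel₀ _ (by positivity)] at this
  intro ε hε
  obtain ⟨β, β', β'', hc', hc'', hβ, hβ', hβ'', hz, hap⟩ := exists_convex_approx hε
  obtain ⟨h', hh, hsl⟩ := exists_slope_near hv ν (‖x‖ + t) hε
  set w : E → ℝ := fun x => h'⁻¹ * (v (x + h' • ν) - v x) with hwdef
  set G : E → E := fun x => h'⁻¹ • (g (x + h' • ν) - g x) with hGdef
  have htr : IsC1 (fun x => v (x + h' • ν)) (fun x => g (x + h' • ν)) := by
    simpa [add_comm] using hv.comp_affine (h' • ν) 1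
  have hw : IsC1 w G := (htr.sub hv).const_mul _
  set U := {x | v x ≠ 0 ∨ g x ≠ 0}
  have hL : WeakLap G (fun _ => 0) ({x | x + h' • ν ∈ U} ∩ U) := by
    have := (((h.translate (h' • ν)).mono inter_subset_left).sub (h.mono inter_subset_right)
      htr.cont_grad hv.cont_grad).const_mul h'⁻¹
    simpa using this
  have hU : ∀ y, y ∉ U → ⟪g y, ν⟫ = 0 := fun y hy => by
    simp only [U, mem_ofPred_eq, not_or, not_not] at hy
    simp [hy.2]
  have hball : ∀ y ∈ ball x t, ‖y‖ ≤ ‖x‖ + t := fun y hy => by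
    rw [mem_ball, dist_eq_norm] at hy
    have := norm_add_le x (y - x)
    rw [add_sub_cancel] at this
    linarith
  have hsub := hL.subLap_comp hw (D' := ball x t) (ε := ε) ?_ hc' hc'' hβ' hβ'' hz
  · have hβw := hw.comp hc' hβ
    have key := hsub.le_avg hβw ht subset_rfl
    have est : ∀ y, ‖y‖ ≤ ‖x‖ + t → |β (w y) - max ⟪g y, ν⟫ 0| ≤ 4 * ε := fun y hy => by
      have a1 := hap (w y)
      have a2 := (abs_max_sub_max_le_abs (w y) ⟪g y, ν⟫ 0).trans (hsl y hy).1.le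
      have := abs_sub_le (β (w y)) (max (w y) 0) (max ⟪g y, ν⟫ 0)
      linarith
    have e1 := abs_le.1 (est x (by linarith))
    have hcm : Continuous fun x => max ⟪g x, ν⟫ 0 := hcw.max continuous_const
    have e2 : avg (fun x => β (w x)) t x ≤ avg (fun x => max ⟪g x, ν⟫ 0) t x + 4 * wtMass E * ε := by
      have i1 : Integrable fun y => max ⟪g (x + t • y), ν⟫ 0 * wt y :=
        integrable_mul_wt (hcm.comp (by fun_prop))
      have i2 : Integrable fun y : E => (4 * ε) * wt y := integrable_wt.const_mul _
      have : avg (fun x => max ⟪g x, ν⟫ 0) t x + 4 * wtMass E * ε =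
          ∫ y, (max ⟪g (x + t • y), ν⟫ 0 * wt y + (4 * ε) * wt y) := by
        rw [integral_add i1 i2, integral_const_mul]
        unfold avg wtMass
        ring
      rw [this]
      refine integral_mono (integrable_mul_wt (hβw.continuous.comp (by fun_prop))) (i1.add i2)
        fun y => ?_
      dsimp only
      rcases lt_or_ge ‖y‖ 1 with hy | hy
      · rw [← add_mul]
        refine mul_le_mul_of_nonneg_right ?_ (wt_nonneg y)
        have := abs_le.1 (est (x + t • y) ?_)
        · linarith
        · refine (norm_add_le _ _).trans (add_le_add le_rfl ?_)
          rw [norm_smul, Real.norm_of_nonneg ht]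
          exact mul_le_of_le_one_right ht hy.le
      · simp [wt_eq_zero hy]
    have hm := wtMass_pos (E := E)
    nlinarith
  · intro y hy hyw
    have := hsl y (hball y hy)
    refine ⟨?_, ?_⟩
    · by_contra hn
      have h2 := this.2
      rw [hU _ hn, sub_zero] at h2
      exact absurd hyw (not_le.2 ((le_abs_self _).trans_lt h2))
    · by_contra hn
      have h2 := this.1
      rw [hU _ hn, sub_zero] at h2
      exact absurd hyw (not_le.2 ((le_abs_self _).trans_lt h2))

theorem WeakLap.subHom {v : E → ℝ} {g : E → E} (hv : IsC1 v g)
    (h : WeakLap g (fun _ => 1) {x | v x ≠ 0 ∨ g x ≠ 0})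
    (hg : ∀ (t : ℝ) x, 0 < t → g (t • x) = t • g x) (ν : E) :
    SubHom (⟨fun x => max ⟪g x, ν⟫ 0,
      (hv.cont_grad.inner continuous_const).max continuous_const⟩ : C(E, ℝ)) where
  nonneg x := le_max_right _ _
  hom t x ht := by
    simp [hg t x ht, real_inner_smul_left, mul_max_of_nonneg _ _ ht.le]
  sub_mean x t ht := h.pos_part_le_avg hv ν x ht

/-- The gradient of a homogeneous limit with thick zero set has one sign in each direction. -/
theorem WeakLap.inner_nonneg_or {v : E → ℝ} {g : E → E} (hv : IsC1 v g)
    (h : WeakLap g (fun _ => 1) {x | v x ≠ 0 ∨ g x ≠ 0})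
    (hg : ∀ (t : ℝ) x, 0 < t → g (t • x) = t • g x) {c : ℝ} (hc : 0 < c) (ht : Thick c v g) (ν : E) :
    (∀ x, 0 ≤ ⟪g x, ν⟫) ∨ ∀ x, ⟪g x, ν⟫ ≤ 0 := by
  by_contra hcon
  push Not at hcon
  obtain ⟨⟨x, hx⟩, y, hy⟩ := hcon
  have hex := (h.subHom hv hg ν).exists_inner_eq_zero (h.subHom hv hg (-ν))
  simp only [ContinuousMap.coe_mk, inner_neg_right] at hex
  obtain ⟨a, ha, H⟩ := hex (fun z => (le_total ⟪g z, ν⟫ 0).imp max_eq_right fun h =>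
    max_eq_right (by linarith)) ⟨y, by rw [max_eq_left hy.le]; exact hy.ne'⟩
    ⟨x, by rw [max_eq_left (by linarith)]; linarith⟩
  obtain ⟨z, -, hz, -, hz0⟩ := ht a ha
  have := H z (by simp [hz0]) (by simp [hz0])
  rw [this, abs_zero] at hz
  linarith

end Derivative

section Direction

variable {E : Type*} [NormedAddCommGroup E] [InnerProductSpace ℝ E] [FiniteDimensional ℝ E]
  [MeasurableSpace E] [BorelSpace E]

theorem norm_smul_eq_norm_smul_of_sign {a b : E}
    (h : 0 ≤ ⟪b, ‖b‖ • a - ‖a‖ • b⟫ ∨ ⟪a, ‖b‖ • a - ‖a‖ • b⟫ ≤ 0) : ‖b‖ • a = ‖a‖ • b := by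
  rcases eq_or_ne a 0 with rfl | ha
  · simp
  rcases eq_or_ne b 0 with rfl | hb
  · simp
  rw [← inner_eq_norm_mul_iff_real]
  refine le_antisymm (real_inner_le_norm a b) ?_
  have ha' := norm_pos_iff.2 ha
  have hb' := norm_pos_iff.2 hb
  simp only [inner_sub_right, inner_smul_right, real_inner_self_eq_norm_sq] at h
  rw [real_inner_comm] at h
  rcases h with h | h
  · refine le_of_mul_le_mul_left ?_ hb'
    nlinarith
  · refine le_of_mul_le_mul_left ?_ ha'
    nlinarith

theorem integral_inner_mul_wt (e : E) : ∫ y, ⟪y, e⟫ * wt y = 0 := by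
  have := integral_neg_eq_self (fun y : E => ⟪y, e⟫ * wt y) volume
  simp only [inner_neg_left, wt_neg, neg_mul, integral_neg] at this
  linarith

theorem IsC1.eq_add_of_orthogonal {v : E → ℝ} {g : E → E} (hv : IsC1 v g) {y : E}
    (hy : ∀ x, ⟪g x, y⟫ = 0) (x : E) : v (x + y) = v x := by
  have h : ∀ t : ℝ, HasDerivAt (fun t : ℝ => v (x + t • y)) 0 t := fun t => by
    simpa [hy] using hv.hasDerivAt_line x y t
  have := is_const_of_deriv_eq_zero (fun t => (h t).differentiableAt) (fun t => (h t).deriv) 1 0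
  simpa using this

theorem WeakLap.exists_direction [Nontrivial E] {v : E → ℝ} {g : E → E} (hv : IsC1 v g)
    (h : WeakLap g (fun _ => 1) {x | v x ≠ 0 ∨ g x ≠ 0}) (hz : ∀ x, zf v g x = 0) {c : ℝ}
    (hc : 0 < c) (ht : Thick c v g) :
    ∃ e : E, ‖e‖ = 1 ∧ (∀ x, ‖x‖ ≤ 2 → v x ≤ ⟪g x, e⟫) ∧ ∀ x, ⟪x, e⟫ ≤ 0 → v x = 0 := by
  have hh := fun (t : ℝ) (x : E) (ht : 0 < t) => hv.homogeneous hz ht x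
  have hsign := h.inner_nonneg_or hv (fun t x ht => (hh t x ht).2) hc ht
  have hv2 : ∀ x, v x = ⟪g x, x⟫ / 2 := fun x => by
    have := hz x
    unfold zf at this
    linarith
  by_cases hg : ∀ x, g x = 0
  · obtain ⟨e, he⟩ := exists_norm_eq E zero_le_one
    exact ⟨e, he, fun x _ => by simp [hv2, hg], fun x _ => by simp [hv2, hg]⟩
  push Not at hg
  obtain ⟨p, hp⟩ := hg
  have hp' := norm_pos_iff.2 hp
  set e : E := ‖g p‖⁻¹ • g p with he
  have he1 : ‖e‖ = 1 := norm_smul_inv_norm hp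
  have hge : ∀ x, g x = ‖g x‖ • e := fun x => by
    have : ‖g x‖ • g p = ‖g p‖ • g x := norm_smul_eq_norm_smul_of_sign
      ((hsign (‖g x‖ • g p - ‖g p‖ • g x)).imp (fun H => H x) fun H => H p)
    rw [he, smul_comm, this, smul_smul, inv_mul_cancel₀ hp'.ne', one_smul]
  have hlam : ∀ x, ⟪g x, e⟫ = ‖g x‖ := fun x => by
    rw [hge x, real_inner_smul_left, real_inner_self_eq_norm_sq, he1, norm_smul, norm_norm, he1]
    ring
  have hv3 : ∀ x, v x = ‖g x‖ * ⟪x, e⟫ / 2 := fun x => by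
    rw [hv2, hge x, real_inner_smul_left, real_inner_comm, norm_smul, norm_norm, he1, mul_one]
  have hee : ⟪e, e⟫ = (1 : ℝ) := by rw [real_inner_self_eq_norm_sq, he1]; norm_num
  have hproj : ∀ x, v x = v (⟪x, e⟫ • e) := fun x => by
    have := hv.eq_add_of_orthogonal (y := x - ⟪x, e⟫ • e) (fun z => ?_) (⟪x, e⟫ • e)
    · rwa [add_sub_cancel] at this
    · rw [hge z, real_inner_smul_left, inner_sub_right, inner_smul_right, hee, real_inner_comm]
      ring
  have hpos : ∀ x, 0 ≤ ⟪x, e⟫ → v x = ⟪x, e⟫ ^ 2 * v e := fun x hx => by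
    rw [hproj]
    rcases hx.eq_or_lt with hx | hx
    · rw [← hx, zero_smul, hv2]; simp
    · exact (hh _ e hx).1
  have hneg : ∀ x, ⟪x, e⟫ ≤ 0 → v x = ⟪x, e⟫ ^ 2 * v (-e) := fun x hx => by
    rw [hproj]
    rcases hx.eq_or_lt with hx | hx
    · rw [hx, zero_smul, hv2]; simp
    · have := (hh _ (-e) (neg_pos.2 hx)).1
      rwa [smul_neg, neg_smul, neg_neg, neg_sq] at this
  have hm : v (-e) = 0 := by
    have hle : v (-e) ≤ 0 := by
      rw [hv3, inner_neg_left, hee]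
      have := norm_nonneg (g (-e))
      linarith
    by_contra hne
    have hlt : v (-e) < 0 := lt_of_le_of_ne hle hne
    have hin : ∀ y : E, ‖y‖ < 1 → ⟪-e + y, e⟫ < 0 := fun y hy => by
      rw [inner_add_left, inner_neg_left, hee]
      have := real_inner_le_norm y e
      rw [he1] at this
      linarith
    have key := h.le_avg hv (x := -e) (t := 1) (K := 1) zero_le_one (fun z hz => ?_)
      fun _ _ => le_rfl
    · have i1 : Integrable fun y : E => v (-e) * wt y := integrable_wt.const_mul _
      have i2 : Integrable fun y : E => (2 * v (-e)) * (⟪y, e⟫ * wt y) :=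
        (integrable_mul_wt (by fun_prop)).const_mul _
      have : avg v 1 (-e) ≤ ∫ y, (v (-e) * wt y - (2 * v (-e)) * (⟪y, e⟫ * wt y)) := by
        refine integral_mono (integrable_mul_wt (hv.continuous.comp (by fun_prop))) (i1.sub' i2)
          fun y => ?_
        dsimp only
        rcases lt_or_ge ‖y‖ 1 with hy | hy
        · rw [one_smul, hneg _ (hin y hy).le, inner_add_left, inner_neg_left, hee]
          have := wt_nonneg y
          have : v (-e) * (⟪y, e⟫ ^ 2 * wt y) ≤ 0 :=
            mul_nonpos_of_nonpos_of_nonneg hle (by positivity)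
          nlinarith
        · simp [wt_eq_zero hy]
      rw [integral_sub i1 i2, integral_const_mul, integral_const_mul, integral_inner_mul_wt] at this
      have hzt := ztMass_pos (E := E)
      change _ ≤ v (-e) * wtMass E - _ at this
      linarith
    · left
      have hz' := hin (z + e) (by simpa [mem_ball, dist_eq_norm] using hz)
      rw [neg_add_cancel_comm_assoc] at hz'
      rw [hneg z hz'.le]
      exact mul_ne_zero (pow_ne_zero 2 hz'.ne) hne
  refine ⟨e, he1, fun x hx => ?_, fun x hx => by rw [hneg x hx, hm, mul_zero]⟩
  rw [hlam, hv3]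
  have := real_inner_le_norm x e
  rw [he1] at this
  nlinarith [norm_nonneg (g x)]

end Direction

section Conclusion

variable {E : Type*} [NormedAddCommGroup E] [InnerProductSpace ℝ E] [FiniteDimensional ℝ E]
  [MeasurableSpace E] [BorelSpace E]

/-- Solutions of the no-sign obstacle problem in a general set. -/
structure SolOn (v : E → ℝ) (g : E → E) (Ω D : Set E) : Prop where
  isOpen : IsOpen Ω
  isC1 : IsC1 v g
  weak : WeakLap g (Ω.indicator (1 : E → ℝ)) D
  zero : ∀ x ∈ D, x ∉ Ω → v x = 0 ∧ g x = 0

/-- The growth rate of the quadratic barrier. -/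
def barrier (E : Type*) [NormedAddCommGroup E] [InnerProductSpace ℝ E] [FiniteDimensional ℝ E]
    [MeasurableSpace E] [BorelSpace E] : ℝ := ztMass E / (8 * wtMass E)

theorem barrier_pos : 0 < barrier E :=
  div_pos ztMass_pos (mul_pos (by norm_num) wtMass_pos)

theorem avg_normSq_le (y q : E) (t : ℝ) : avg (fun x => ‖x - y‖ ^ 2) t q ≤
    wtMass E * ‖q - y‖ ^ 2 + wtMass E * t ^ 2 := by
  have i1 : Integrable fun z : E => (‖q - y‖ ^ 2 + t ^ 2) * wt z := integrable_wt.const_mul _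
  have i2 : Integrable fun z : E => (2 * t) * (⟪z, q - y⟫ * wt z) :=
    (integrable_mul_wt (by fun_prop)).const_mul _
  have : avg (fun x => ‖x - y‖ ^ 2) t q ≤
      ∫ z, ((‖q - y‖ ^ 2 + t ^ 2) * wt z + (2 * t) * (⟪z, q - y⟫ * wt z)) := by
    refine integral_mono (integrable_mul_wt (by fun_prop)) (i1.fun_add i2) fun z => ?_
    dsimp only
    rcases lt_or_ge ‖z‖ 1 with hz | hz
    · have e : q + t • z - y = (q - y) + t • z := by abel
      rw [e, norm_add_sq_real, inner_smul_right, real_inner_comm, norm_smul, mul_pow,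
        Real.norm_eq_abs, sq_abs]
      have h1 : t ^ 2 * ‖z‖ ^ 2 ≤ t ^ 2 :=
        mul_le_of_le_one_right (sq_nonneg t) (pow_le_one₀ (norm_nonneg z) hz.le)
      have := mul_le_mul_of_nonneg_right h1 (wt_nonneg z)
      nlinarith
    · simp [wt_eq_zero hz]
  rw [integral_add i1 i2, integral_const_mul, integral_const_mul, integral_inner_mul_wt] at this
  change _ ≤ _ * wtMass E + _ at this
  linarith

theorem avg_le_of_le {h : E → ℝ} (hh : Continuous h) {q : E} {t : ℝ} (ht : 0 < t)
    (hq : ∀ x ∈ ball q t, h x ≤ h q) : avg h t q ≤ wtMass E * h q := by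
  have : avg h t q ≤ ∫ z : E, h q * wt z := by
    refine integral_mono (integrable_mul_wt (hh.comp (by fun_prop))) (integrable_wt.const_mul _)
      fun z => ?_
    dsimp only
    rcases lt_or_ge ‖z‖ 1 with hz | hz
    · refine mul_le_mul_of_nonneg_right (hq _ ?_) (wt_nonneg z)
      rw [mem_ball, dist_eq_norm, add_sub_cancel_left, norm_smul, Real.norm_of_nonneg ht.le]
      nlinarith
    · simp [wt_eq_zero hz]
  rwa [integral_const_mul, mul_comm] at this

theorem SolOn.le_inner {v : E → ℝ} {g : E → E} {Ω D : Set E} (h : SolOn v g Ω D) {y e : E} {ρ : ℝ}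
    (hρ : 0 < ρ) (hD : closedBall y ρ ⊆ D)
    (hb : ∀ x, ‖x - y‖ = ρ → v x - ⟪g x, e⟫ ≤ barrier E * ρ ^ 2) : v y ≤ ⟪g y, e⟫ := by
  by_contra hlt
  rw [not_le] at hlt
  set H : E → ℝ := fun x => v x - ⟪g x, e⟫ - barrier E * ‖x - y‖ ^ 2 with hH
  have hvc := h.isC1.continuous
  have hgc : Continuous fun x => ⟪g x, e⟫ := h.isC1.cont_grad.inner continuous_const
  have hHc : Continuous H := (hvc.sub hgc).sub (by fun_prop)
  obtain ⟨q, hq, hmax⟩ := (isCompact_closedBall y ρ).exists_isMaxOn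
    ⟨y, mem_closedBall_self hρ.le⟩ hHc.continuousOn
  have hHq : 0 < H q := by
    refine lt_of_lt_of_le ?_ (hmax (mem_closedBall_self hρ.le))
    simp only [hH, sub_self, norm_zero]
    linarith
  have hκ := barrier_pos (E := E)
  have hqΩ : q ∈ Ω := by
    by_contra hn
    obtain ⟨h1, h2⟩ := h.zero q (hD hq) hn
    simp only [hH, h1, h2, inner_zero_left] at hHq
    nlinarith [sq_nonneg ‖q - y‖]
  have hqb : q ∈ ball y ρ := by
    rw [mem_closedBall, dist_eq_norm] at hq
    rw [mem_ball, dist_eq_norm]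
    refine lt_of_le_of_ne hq fun heq => ?_
    have := hb q heq
    simp only [hH, heq] at hHq
    linarith
  obtain ⟨R, hR, hsub⟩ := Metric.isOpen_iff.1 (h.isOpen.inter isOpen_ball) q ⟨hqΩ, hqb⟩
  have hf : ∀ z ∈ ball q R, Ω.indicator (1 : E → ℝ) z = 1 := fun z hz => by
    rw [indicator_of_mem (hsub hz).1]; rfl
  have hRD : ball q R ⊆ D := fun z hz => hD (ball_subset_closedBall (hsub hz).2)
  have ht : 0 < R / 2 := by positivity
  have hbb : ball q (R / 2) ⊆ ball q R := ball_subset_ball (by linarith)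
  have a1 := h.weak.avg_eq h.isC1 ht.le (hbb.trans hRD) fun z hz => hf z (hbb hz)
  have a2 := h.weak.grad_avg h.isC1 ht.le (by linarith) hRD hf e
  have a3 := avg_normSq_le y q (R / 2)
  have a4 := avg_le_of_le hHc ht fun x hx => hmax (ball_subset_closedBall (hsub (hbb hx)).2)
  have i1 : Integrable fun z => v (q + (R / 2) • z) * wt z :=
    integrable_mul_wt (hvc.comp (by fun_prop))
  have i2 : Integrable fun z => ⟪g (q + (R / 2) • z), e⟫ * wt z :=
    integrable_mul_wt (hgc.comp (by fun_prop : Continuous fun z : E => q + (R / 2) • z))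
  have i3 : Integrable fun z => barrier E * (‖q + (R / 2) • z - y‖ ^ 2 * wt z) :=
    (integrable_mul_wt (by fun_prop)).const_mul _
  have a5 : avg H (R / 2) q = avg v (R / 2) q - (∫ z, ⟪g (q + (R / 2) • z), e⟫ * wt z) -
      barrier E * avg (fun x => ‖x - y‖ ^ 2) (R / 2) q := by
    unfold avg
    rw [← integral_const_mul (barrier E), ← integral_sub i1 i2, ← integral_sub (i1.sub' i2) i3]
    congr 1
    ext z
    simp only [hH]
    ring
  have a6 : barrier E * wtMass E = ztMass E / 8 := by
    unfold barrier
    have := (wtMass_pos (E := E)).ne'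
    field_simp
  have hz := ztMass_pos (E := E)
  have a7 := mul_le_mul_of_nonneg_left a3 hκ.le
  rw [a5, a1, a2] at a4
  simp only [hH] at a4
  have a8 : barrier E * (wtMass E * ‖q - y‖ ^ 2 + wtMass E * (R / 2) ^ 2) =
    wtMass E * (barrier E * ‖q - y‖ ^ 2) + ztMass E / 8 * (R / 2) ^ 2 := by rw [← a6]; ring
  rw [a8] at a7
  have : 0 < ztMass E * (R / 2) ^ 2 := by positivity
  nlinarith

theorem eq_zero_of_avg {v : E → ℝ} (hv : Continuous v) {p : E} {t : ℝ} (ht : 0 < t)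
    (hle : ∀ x ∈ ball p t, v x ≤ 0) (h : 0 ≤ avg v t p) {x : E} (hx : x ∈ ball p t) : v x = 0 := by
  by_contra hne
  have hc : Continuous fun y => -(v (p + t • y) * wt y) :=
    ((hv.comp (by fun_prop)).mul isC1_wt.continuous).neg
  have hmem : ∀ y : E, ‖y‖ < 1 → p + t • y ∈ ball p t := fun y hy => by
    rw [mem_ball, dist_eq_norm, add_sub_cancel_left, norm_smul, Real.norm_of_nonneg ht.le]
    nlinarith
  have := hc.integral_pos_of_hasCompactSupport_nonneg_nonzero (μ := volume)
    (HasCompactSupport.neg (hasCompactSupport_wt.mul_left)) (fun y => ?_) (x := t⁻¹ • (x - p)) ?_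
  · rw [integral_neg] at this
    change 0 < -avg v t p at this
    linarith
  · rcases lt_or_ge ‖y‖ 1 with hy | hy
    · have := mul_nonneg (neg_nonneg.2 (hle _ (hmem y hy))) (wt_nonneg y)
      simpa using this
    · simp [wt_eq_zero hy]
  · rw [smul_inv_smul₀ ht.ne', add_sub_cancel]
    refine neg_ne_zero.2 (mul_ne_zero hne (wt_pos ?_).ne')
    rw [norm_smul, Real.norm_of_nonneg (inv_nonneg.2 ht.le), inv_mul_lt_iff₀ ht, mul_one]
    simpa [dist_eq_norm] using hx

theorem SolOn.notMem_of_small {v : E → ℝ} {g : E → E} {Ω D : Set E} (h : SolOn v g Ω D) {y : E}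
    {s : ℝ} (hs : 0 < s) (hD : ball y s ⊆ D)
    (hb : ∀ x ∈ ball y s, |v x| ≤ barrier E * (s / 4) ^ 2) : y ∉ Ω := fun hy => by
  have hvc := h.isC1.continuous
  have hzt := ztMass_pos (E := E)
  have hwt := wtMass_pos (E := E)
  have hle : ∀ z ∈ ball y (s / 2), v z ≤ 0 := fun z hz => by
    rw [mem_ball] at hz
    have hsub : closedBall z (s / 4) ⊆ ball y s := fun x hx => by
      rw [mem_closedBall] at hx
      rw [mem_ball]
      linarith [dist_triangle x z y]
    have := h.le_inner (y := z) (e := 0) (ρ := s / 4) (by linarith) (hsub.trans hD) fun x hx => ?_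
    · simpa using this
    · rw [inner_zero_right, sub_zero]
      exact (le_abs_self _).trans (hb x (hsub (by rw [mem_closedBall, dist_eq_norm]; exact hx.le)))
  have hs4 : 0 < s / 4 := by linarith
  have strict : ∀ t > 0, ball y t ⊆ Ω → ball y t ⊆ ball y (s / 2) → 
      ztMass E * t ^ 2 / 4 ≤ - (wtMass E * v y) := fun t ht htΩ hts => by
    have a1 := h.weak.avg_eq h.isC1 (x := y) (m := 1) ht.le
      (hts.trans ((ball_subset_ball (by linarith)).trans hD)) fun z hz => by
        rw [indicator_of_mem (htΩ hz)]; rfl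
    have a2 : avg v t y ≤ 0 := by
      refine integral_nonpos fun z => ?_
      dsimp only
      rcases lt_or_ge ‖z‖ 1 with hz | hz
      · refine mul_nonpos_of_nonpos_of_nonneg (hle _ (hts ?_)) (wt_nonneg z)
        rw [mem_ball, dist_eq_norm, add_sub_cancel_left, norm_smul, Real.norm_of_nonneg ht.le]
        nlinarith
      · simp [wt_eq_zero hz]
    linarith
  by_cases hsubΩ : ball y (s / 4) ⊆ Ω
  · have a1 := strict (s / 4) hs4 hsubΩ (ball_subset_ball (by linarith))
    have a2 := (abs_le.1 (hb y (mem_ball_self hs))).1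
    have a6 : wtMass E * (barrier E * (s / 4) ^ 2) = ztMass E / 8 * (s / 4) ^ 2 := by
      unfold barrier
      field_simp
    have := mul_le_mul_of_nonneg_left a2 hwt.le
    rw [mul_neg, a6] at this
    have : 0 < ztMass E * (s / 4) ^ 2 := by positivity
    linarith
  · obtain ⟨p, hp, hpΩ⟩ := not_subset.1 hsubΩ
    rw [mem_ball] at hp
    have hpD : ball p (s / 4) ⊆ ball y (s / 2) := fun x hx => by
      rw [mem_ball] at hx ⊢
      linarith [dist_triangle x p y]
    have hpD' : ball p (s / 4) ⊆ D := hpD.trans ((ball_subset_ball (by linarith)).trans hD)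
    have a1 := ((h.weak.mono hpD').subLap fun x =>
      indicator_nonneg (fun _ _ => zero_le_one) x).le_avg h.isC1 hs4.le subset_rfl
    rw [(h.zero p (hpD' (mem_ball_self hs4)) hpΩ).1, mul_zero] at a1
    obtain ⟨R, hR, hsub⟩ := Metric.isOpen_iff.1 (h.isOpen.inter (isOpen_ball (x := y) (ε := s / 2)))
      y ⟨hy, mem_ball_self (by linarith)⟩
    have a2 := strict R hR (hsub.trans inter_subset_left) (hsub.trans inter_subset_right)
    have a3 := eq_zero_of_avg hvc hs4 (fun x hx => hle x (hpD hx)) a1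
      (x := y) (by rwa [mem_ball, dist_comm])
    rw [a3] at a2
    have : 0 < ztMass E * R ^ 2 := by positivity
    linarith

theorem SolOn.nonneg_of_close {v : E → ℝ} {g : E → E} {Ω : Set E} (h : SolOn v g Ω (ball 0 3))
    {v₀ : E → ℝ} {g₀ : E → E} {e : E} (he : ‖e‖ = 1) (h₀ : ∀ x, ‖x‖ ≤ 2 → v₀ x ≤ ⟪g₀ x, e⟫)
    (h₁ : ∀ x, ⟪x, e⟫ ≤ 0 → v₀ x = 0)
    (hc : ∀ x, ‖x‖ ≤ 2 → |v x - v₀ x| < barrier E / 256 ∧ ‖g x - g₀ x‖ < barrier E / 256)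
    {x : E} (hx : ‖x‖ ≤ 1 / 4) : 0 ≤ v x := by
  have hκ := barrier_pos (E := E)
  have hee : ⟪e, e⟫ = (1 : ℝ) := by rw [real_inner_self_eq_norm_sq, he]; norm_num
  have hmono : ∀ y : E, ‖y‖ ≤ 1 → v y ≤ ⟪g y, e⟫ := fun y hy => by
    have hn : ∀ z : E, ‖z - y‖ ≤ 1 → ‖z‖ ≤ 2 := fun z hz => by
      have := norm_add_le y (z - y)
      rw [add_sub_cancel] at this
      linarith
    refine h.le_inner one_pos (fun z hz => ?_) fun z hz => ?_
    · rw [mem_closedBall, dist_eq_norm] at hz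
      rw [mem_ball_zero_iff]
      linarith [hn z hz]
    · have hz2 := hn z hz.le
      have a1 := (abs_lt.1 (hc z hz2).1).2
      have a2 := abs_real_inner_le_norm (g z - g₀ z) e
      rw [he, mul_one, inner_sub_left] at a2
      have a3 := (abs_le.1 (a2.trans (hc z hz2).2.le)).1
      have := h₀ z hz2
      linarith
  have hzero : ∀ y : E, ‖y‖ ≤ 1 → ⟪y, e⟫ ≤ -(1 / 4) → v y = 0 := fun y hy hye => by
    have hsub : ∀ z ∈ ball y (1 / 4), ‖z‖ ≤ 2 ∧ ⟪z, e⟫ ≤ 0 := fun z hz => by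
      rw [mem_ball, dist_eq_norm] at hz
      have a1 := norm_add_le y (z - y)
      have a2 := real_inner_le_norm (z - y) e
      rw [add_sub_cancel] at a1
      rw [inner_sub_left, he, mul_one] at a2
      constructor <;> linarith
    refine (h.zero y (by rw [mem_ball_zero_iff]; linarith) ?_).1
    refine h.notMem_of_small (s := 1 / 4) (by norm_num) (fun z hz => ?_) fun z hz => ?_
    · rw [mem_ball_zero_iff]
      linarith [(hsub z hz).1]
    · have := (hc z (hsub z hz).1).1
      rw [h₁ z (hsub z hz).2, sub_zero] at this
      norm_num
      linarith
  set a : E := x - (1 / 2 : ℝ) • e with ha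
  have hd : ∀ s : ℝ, HasDerivAt (fun s : ℝ => Real.exp (-s) * v (a + s • e))
      (Real.exp (-s) * (⟪g (a + s • e), e⟫ - v (a + s • e))) s := fun s => by
    have := ((hasDerivAt_neg s).exp).mul (h.isC1.hasDerivAt_line a e s)
    refine this.congr_deriv ?_
    ring
  have hm : MonotoneOn (fun s : ℝ => Real.exp (-s) * v (a + s • e)) (Icc 0 (1 / 2)) := by
    refine monotoneOn_of_deriv_nonneg (convex_Icc _ _)
      (fun s _ => (hd s).continuousAt.continuousWithinAt)
      (fun s _ => (hd s).differentiableAt.differentiableWithinAt) fun s hs => ?_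
    rw [interior_Icc] at hs
    rw [(hd s).deriv]
    refine mul_nonneg (Real.exp_pos _).le (sub_nonneg.2 (hmono _ ?_))
    have e1 : a + s • e = x + (s - 1 / 2) • e := by rw [ha, sub_smul]; abel
    have := norm_add_le x ((s - 1 / 2) • e)
    rw [norm_smul, he, mul_one, Real.norm_eq_abs, abs_of_neg (by linarith [hs.2])] at this
    rw [e1]
    linarith [hs.1]
  have key := hm (left_mem_Icc.2 (by norm_num)) (right_mem_Icc.2 (by norm_num)) (by norm_num)
  have ha0 : v a = 0 := by
    have a2 := real_inner_le_norm x e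
    rw [he, mul_one] at a2
    refine hzero a ?_ ?_
    · have := norm_sub_le x ((1 / 2 : ℝ) • e)
      rw [norm_smul, he] at this
      norm_num at this
      linarith
    · rw [ha, inner_sub_left, real_inner_smul_left, hee]
      linarith
  simp only [zero_smul, add_zero, ha0, mul_zero] at key
  rw [ha, sub_add_cancel] at key
  exact nonneg_of_mul_nonneg_right key (Real.exp_pos _)

end Conclusion

section LocalSign

variable {E : Type*} [NormedAddCommGroup E] [InnerProductSpace ℝ E] [FiniteDimensional ℝ E]
  [MeasurableSpace E] [BorelSpace E]

theorem Sol.solOn_sc {u : E → ℝ} {g : E → E} {Ω : Set E} (h : Sol u g Ω) {r : ℝ} (hr : 0 < r)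
    (hr1 : 3 * r < 1) : SolOn (sc r u) (scg r g) {x | r • x ∈ Ω} (ball 0 3) where
  isOpen := h.isOpen.preimage (continuous_const_smul r)
  isC1 := h.isC1.sc r
  weak := by
    refine WeakLap.mono (D := ball 0 (1 / r)) ?_ (ball_subset_ball ?_)
    · have e : {x | r • x ∈ Ω}.indicator (1 : E → ℝ) = fun x => Ω.indicator (1 : E → ℝ) (r • x) := by
        ext x
        by_cases hx : r • x ∈ Ω <;> simp [hx]
      rw [e]
      exact h.weak_sc hr
    · rw [le_div_iff₀ hr]
      exact hr1.le
  zero x hx hΩ := by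
    have := h.zero (r • x) ?_ hΩ
    · simp [sc, scg, this.1, this.2]
    · rw [mem_ball_zero_iff] at hx ⊢
      rw [norm_smul, Real.norm_of_nonneg hr.le]
      nlinarith

/-- If the zero set is thick at arbitrarily small scales, the solution is nonnegative nearby. -/
theorem Sol.exists_nonneg_ball [Nontrivial E] {u : E → ℝ} {g : E → E} {Ω : Set E} (h : Sol u g Ω)
    (h0 : u 0 = 0) (hg0 : g 0 = 0) {r : ℕ → ℝ} (hr : ∀ j, 0 < r j)
    (hr0 : Tendsto r atTop (nhds 0)) {c : ℝ} (hc : 0 < c)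
    (ht : ∀ j, Thick c (sc (r j) u) (scg (r j) g)) : ∃ ρ > 0, ∀ x ∈ ball (0 : E) ρ, 0 ≤ u x := by
  have hnt : ¬ Tendsto (fun j => hN (sc (r j) u)) atTop atTop := fun hT => by
    obtain ⟨n, hn⟩ := eventually_atTop.1 (hT.eventually_ge_atTop 1)
    exact h.not_thick_of_tendsto h0 hg0 (r := fun j => r (j + n)) (fun j => hr _)
      (hr0.comp (tendsto_add_atTop_nat n)) (fun j => hn _ (by omega))
      (hT.comp (tendsto_add_atTop_nat n)) hc fun j => ht _
  rw [Filter.tendsto_atTop] at hnt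
  push Not at hnt
  obtain ⟨B, hB⟩ := hnt
  obtain ⟨τ, hτ, hτB⟩ := extraction_of_frequently_atTop hB
  obtain ⟨σ, v₀, g₀, -, b⟩ := h.exists_blowUp (r := fun j => r (τ j)) (M := fun _ => 1)
    (fun j => hr _) (hr0.comp hτ.tendsto_atTop) (fun _ => le_rfl) (C := B) fun j => by
      have := hτB j
      rw [one_pow, mul_one]
      exact this.le
  have hconv := b.conv
  simp only [inv_one, one_mul, one_smul] at hconv
  obtain ⟨e, he, h1, h2⟩ := (b.weakLap_one h).exists_direction b.isC1 (b.zf_eq_zero_of_one h) hc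
    (Thick.limit hconv b.isC1 fun j => ht _)
  obtain ⟨j, hj1, hj2⟩ := ((hconv 2 (barrier E / 256) (div_pos barrier_pos (by norm_num))).and
    (eventually_mul_lt b.r_tendsto 3 one_pos)).exists
  have hrj := b.r_pos j
  refine ⟨r (τ (σ j)) / 4, by positivity, fun x hx => ?_⟩
  rw [mem_ball_zero_iff] at hx
  have := (h.solOn_sc hrj hj2).nonneg_of_close he h1 h2 hj1 (x := (r (τ (σ j)))⁻¹ • x) ?_
  · rw [sc, smul_inv_smul₀ hrj.ne'] at this
    exact nonneg_of_mul_nonneg_right this (by positivity)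
  · rw [norm_smul, norm_inv, Real.norm_of_nonneg hrj.le, inv_mul_le_iff₀ hrj]
    linarith

end LocalSign

section Mollification

variable {E : Type*} [NormedAddCommGroup E] [InnerProductSpace ℝ E] [FiniteDimensional ℝ E]
  [MeasurableSpace E] [BorelSpace E]

theorem IsC1.fderiv_eq {φ : E → ℝ} {ψ : E → E} (hφ : IsC1 φ ψ) :
    fderiv ℝ φ = fun x => innerSL ℝ (ψ x) := funext fun x => (hφ.hasFDerivAt x).fderiv

theorem IsC1.contDiff {φ : E → ℝ} {ψ : E → E} (hφ : IsC1 φ ψ) : ContDiff ℝ 1 φ := by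
  rw [contDiff_one_iff_fderiv, hφ.fderiv_eq]
  exact ⟨fun x => (hφ.hasFDerivAt x).differentiableAt, (innerSL ℝ).continuous.comp hφ.cont_grad⟩

theorem IsC1.exists_mollify {φ : E → ℝ} {ψ : E → E} (hφ : IsC1 φ ψ) (hc : HasCompactSupport φ)
    {D : Set E} (hD : IsOpen D) (hs : tsupport φ ⊆ D) {η : ℝ} (hη : 0 < η) :
    ∃ Φ : E → ℝ, ContDiff ℝ (⊤ : ℕ∞) Φ ∧ HasCompactSupport Φ ∧ tsupport Φ ⊆ D ∧
      (∀ x, |Φ x - φ x| ≤ η) ∧ ∀ x e, |fderiv ℝ Φ x e - ⟪ψ x, e⟫| ≤ η * ‖e‖ := by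
  obtain ⟨δ₁, hδ₁, hsub⟩ := IsCompact.exists_cthickening_subset_open hc hD hs
  have hψc : HasCompactSupport ψ := hc.of_isClosed_subset (isClosed_tsupport _)
    hφ.hasCompactSupport_grad
  obtain ⟨δ₂, hδ₂, u₂⟩ := Metric.uniformContinuous_iff.1
    (hc.uniformContinuous_of_continuous hφ.continuous) η hη
  obtain ⟨δ₃, hδ₃, u₃⟩ := Metric.uniformContinuous_iff.1
    (hψc.uniformContinuous_of_continuous hφ.cont_grad) η hη
  obtain ⟨δ, hδ, h1, h2, h3⟩ : ∃ δ > 0, δ ≤ δ₁ ∧ δ ≤ δ₂ ∧ δ ≤ δ₃ :=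
    ⟨min δ₁ (min δ₂ δ₃), by positivity, min_le_left _ _, (min_le_right _ _).trans (min_le_left _ _),
      (min_le_right _ _).trans (min_le_right _ _)⟩
  let ρ : ContDiffBump (0 : E) := ⟨δ / 2, δ, by positivity, by linarith⟩
  have hρc : Continuous (ρ.normed volume) := ρ.continuous_normed
  set Φ : E → ℝ := convolution (ρ.normed volume) φ (ContinuousLinearMap.lsmul ℝ ℝ) volume with hΦ
  have hclose : ∀ f : E → ℝ, Continuous f → ∀ x κ, (∀ y ∈ ball x δ, dist (f y) (f x) ≤ κ) →
      dist (convolution (ρ.normed volume) f (ContinuousLinearMap.lsmul ℝ ℝ) volume x) (f x) ≤ κ :=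
    fun f hf x κ h => ContDiffBump.dist_normed_convolution_le hf.aestronglyMeasurable h
  have hcs : tsupport Φ ⊆ cthickening δ (tsupport φ) := by
    refine closure_minimal (fun x hx => ?_) isClosed_cthickening
    by_contra hn
    have hz : ∀ y ∈ closedBall x δ, φ y = 0 := fun y hy => by
      by_contra hne
      exact hn (mem_cthickening_of_dist_le x y δ _ (subset_tsupport _ hne) (by
        rw [dist_comm]; exact hy))
    have := hclose φ hφ.continuous x 0 fun y hy => by
      rw [hz y (ball_subset_closedBall hy), hz x (mem_closedBall_self hδ.le), dist_self]
    rw [hz x (mem_closedBall_self hδ.le), dist_le_zero] at this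
    exact hx this
  refine ⟨Φ, ?_, ?_, ?_, fun x => ?_, fun x e => ?_⟩
  · exact ρ.hasCompactSupport_normed.contDiff_convolution_left _ ρ.contDiff_normed
      hφ.continuous.locallyIntegrable
  · exact (hc.isCompact.cthickening (r := δ)).of_isClosed_subset (isClosed_tsupport _) hcs
  · exact hcs.trans ((cthickening_mono h1 _).trans hsub)
  · exact hclose φ hφ.continuous x η fun y hy => (u₂ (lt_of_lt_of_le hy h2)).le
  · have hd := (hc.hasFDerivAt_convolution_right (ContinuousLinearMap.lsmul ℝ ℝ)
      (hρc.locallyIntegrable (μ := volume)) hφ.contDiff x).fderiv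
    rw [hΦ, hd, convolution_precompR_apply _ hρc.locallyIntegrable (hc.fderiv ℝ)
      (hφ.contDiff.continuous_fderiv one_ne_zero), hφ.fderiv_eq]
    simp only [innerSL_apply_apply]
    refine hclose (fun x => ⟪ψ x, e⟫) (hφ.cont_grad.inner continuous_const) x _ fun y hy => ?_
    rw [Real.dist_eq, ← inner_sub_left]
    refine (abs_real_inner_le_norm _ _).trans ?_
    gcongr
    rw [← dist_eq_norm]
    exact (u₃ (lt_of_lt_of_le hy h3)).le

theorem tendsto_integral_mul_of_uniform {a : E → ℝ} (ha : Measurable a) {R B K : ℝ}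
    (hB : ∀ x ∈ ball 0 R, |a x| ≤ B) {F : ℕ → E → ℝ} {f : E → ℝ} (hF : ∀ n, Continuous (F n))
    (hf : Continuous f) (h0 : ∀ n, ∀ x ∉ ball 0 R, F n x = 0)
    (hl : ∀ n x, |F n x - f x| ≤ 1 / ((n : ℝ) + 1) * K) :
    Tendsto (fun n => ∫ x, a x * F n x) atTop (nhds (∫ x, a x * f x)) := by
  obtain ⟨C, hC⟩ := (isCompact_closedBall (0 : E) R).exists_bound_of_continuousOn hf.continuousOn
  have hK : 0 ≤ K := by simpa using (abs_nonneg _).trans (hl 0 0)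
  refine tendsto_integral_of_dominated_convergence ((ball (0 : E) R).indicator
    fun _ => B * (C + K)) (fun n => (ha.mul (hF n).measurable).aestronglyMeasurable) ?_
    (fun n => Eventually.of_forall fun x => ?_) (Eventually.of_forall fun x => ?_)
  · exact (integrable_indicator_iff measurableSet_ball).2
      (integrableOn_const (by exact measure_ball_lt_top.ne) (by exact enorm_ne_top))
  · by_cases hx : x ∈ ball 0 R
    · rw [indicator_of_mem hx, norm_mul, Real.norm_eq_abs]
      have h1 : 1 / ((n : ℝ) + 1) * K ≤ K := by
        refine mul_le_of_le_one_left hK ?_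
        rw [div_le_one (by positivity)]
        linarith [n.cast_nonneg (α := ℝ)]
      have h2 := hl n x
      have h3 := hC x (ball_subset_closedBall hx)
      rw [Real.norm_eq_abs] at h3
      have h4 := abs_add_le (F n x - f x) (f x)
      rw [sub_add_cancel] at h4
      exact mul_le_mul (hB x hx) (by rw [Real.norm_eq_abs]; linarith) (norm_nonneg _)
        ((abs_nonneg _).trans (hB x hx))
    · rw [h0 n x hx, mul_zero, norm_zero, indicator_of_notMem hx]
  · refine Tendsto.const_mul _ ?_
    rw [tendsto_iff_norm_sub_tendsto_zero]
    refine squeeze_zero (fun _ => norm_nonneg _) (fun n => hl n x) ?_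
    simpa using tendsto_one_div_add_atTop_nhds_zero_nat.mul_const K

theorem integral_mul_fderiv_fderiv {u : E → ℝ} (hu : ContDiff ℝ 1 u) {Φ : E → ℝ}
    (hΦ : ContDiff ℝ (⊤ : ℕ∞) Φ) (hc : HasCompactSupport Φ) {ι : Type*} [Fintype ι] (b : ι → E) :
    ∫ x, u x * ∑ i, fderiv ℝ (fun y => fderiv ℝ Φ y (b i)) x (b i) =
      -∑ i, ∫ x, fderiv ℝ u x (b i) * fderiv ℝ Φ x (b i) := by
  have h1 : ∀ i, ContDiff ℝ 1 fun y => fderiv ℝ Φ y (b i) := fun i =>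
    (hΦ.fderiv_right (m := 1) (WithTop.coe_le_coe.2 le_top)).clm_apply contDiff_const
  have hc1 : ∀ i, HasCompactSupport fun y => fderiv ℝ Φ y (b i) := fun i => hc.fderiv_apply ℝ (b i)
  have hc2 : ∀ i, Continuous fun x => fderiv ℝ (fun y => fderiv ℝ Φ y (b i)) x (b i) := fun i =>
    ((h1 i).continuous_fderiv one_ne_zero).clm_apply continuous_const
  have hc3 : ∀ i, HasCompactSupport fun x => fderiv ℝ (fun y => fderiv ℝ Φ y (b i)) x (b i) :=
    fun i => (hc1 i).fderiv_apply ℝ (b i)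
  have hc4 : ∀ i, Continuous fun x => fderiv ℝ u x (b i) := fun i =>
    (hu.continuous_fderiv one_ne_zero).clm_apply continuous_const
  have i1 : ∀ i, Integrable fun x => u x * fderiv ℝ (fun y => fderiv ℝ Φ y (b i)) x (b i) :=
    fun i => (hu.continuous.mul (hc2 i)).integrable_of_hasCompactSupport (hc3 i).mul_left
  simp_rw [Finset.mul_sum]
  rw [integral_finsetSum _ fun i _ => i1 i, ← Finset.sum_neg_distrib]
  refine Finset.sum_congr rfl fun i _ => ?_
  exact integral_mul_fderiv_eq_neg_fderiv_mul_of_integrable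
    (((hc4 i).mul (h1 i).continuous).integrable_of_hasCompactSupport (hc1 i).mul_left) (i1 i)
    ((hu.continuous.mul (h1 i).continuous).integrable_of_hasCompactSupport (hc1 i).mul_left)
    (fun x _ => hu.differentiable one_ne_zero x) fun x _ => (h1 i).differentiable one_ne_zero x

theorem isC1_gradient {u : E → ℝ} (hu : ContDiff ℝ 1 u) : IsC1 u (gradient u) where
  cont_grad := (InnerProductSpace.toDual ℝ E).symm.continuous.comp
    (hu.continuous_fderiv one_ne_zero)
  hasFDerivAt x := by
    refine ((hu.differentiable one_ne_zero x).hasFDerivAt).congr_fderiv ?_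
    ext y
    rw [innerSL_apply_apply, inner_gradient_left]

theorem WeakLap.of_smooth {u : E → ℝ} (hu : ContDiff ℝ 1 u) {Ω D : Set E} (hΩ : IsOpen Ω)
    (hD : IsOpen D) {ι : Type*} [Fintype ι] (b : OrthonormalBasis ι ℝ E)
    (h : ∀ φ : E → ℝ, ContDiff ℝ (⊤ : ℕ∞) φ → tsupport φ ⊆ D →
      ∫ x, u x * ∑ i, fderiv ℝ (fun y => fderiv ℝ φ y (b i)) x (b i) = ∫ x in Ω, φ x) :
    WeakLap (gradient u) (Ω.indicator (1 : E → ℝ)) D where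
  meas := measurable_one.indicator hΩ.measurableSet
  bdd := ⟨1, indicator_one_abs_le Ω⟩
  weak φ ψ hφ hc hs := by
    have hu1 := isC1_gradient hu
    obtain ⟨R, -, hR⟩ := hc.isCompact.isBounded.subset_ball_lt 0 (0 : E)
    choose Φ s1 s2 s3 s4 s5 using fun n : ℕ => hφ.exists_mollify hc (hD.inter isOpen_ball)
      (subset_inter hs hR) (η := 1 / ((n : ℝ) + 1)) (by positivity)
    have hdc : ∀ n i, Continuous fun x => fderiv ℝ (Φ n) x (b i) := fun n i =>
      ((s1 n).continuous_fderiv (by simp)).clm_apply continuous_const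
    have hgc : ∀ i, Continuous fun x => ⟪gradient u x, b i⟫ := fun i =>
      hu1.cont_grad.inner continuous_const
    have l1 : Tendsto (fun n => ∫ x, Ω.indicator (1 : E → ℝ) x * Φ n x) atTop
        (nhds (∫ x, Ω.indicator (1 : E → ℝ) x * φ x)) :=
      tendsto_integral_mul_of_uniform (measurable_one.indicator hΩ.measurableSet)
        (fun x _ => indicator_one_abs_le Ω x) (R := R) (K := 1) (fun n => (s1 n).continuous)
        hφ.continuous (fun n x hx => image_eq_zero_of_notMem_tsupport fun hx' => hx (s3 n hx').2)
        fun n x => by rw [mul_one]; exact s4 n x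
    have l2 : ∀ i, Tendsto (fun n => ∫ x, ⟪gradient u x, b i⟫ * fderiv ℝ (Φ n) x (b i)) atTop
        (nhds (∫ x, ⟪gradient u x, b i⟫ * ⟪ψ x, b i⟫)) := fun i => by
      obtain ⟨B, hB⟩ := (isCompact_closedBall (0 : E) R).exists_bound_of_continuousOn
        (hgc i).continuousOn
      refine tendsto_integral_mul_of_uniform (hgc i).measurable (R := R) (B := B) (K := ‖b i‖)
        (fun x hx => hB x (ball_subset_closedBall hx)) (fun n => hdc n i)
        (hφ.cont_grad.inner continuous_const) (fun n x hx => ?_) fun n x => s5 n x (b i)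
      rw [image_eq_zero_of_notMem_tsupport fun hx' => hx (s3 n (tsupport_fderiv_subset ℝ hx')).2]
      rfl
    have e1 : ∀ n, ∫ x, Ω.indicator (1 : E → ℝ) x * Φ n x =
        -∑ i, ∫ x, ⟪gradient u x, b i⟫ * fderiv ℝ (Φ n) x (b i) := fun n => by
      have := h (Φ n) (s1 n) ((s3 n).trans inter_subset_left)
      rw [integral_mul_fderiv_fderiv hu (s1 n) (s2 n) b, ← integral_indicator hΩ.measurableSet]
        at this
      simp_rw [inner_gradient_left]
      rw [this]
      congr 1
      ext x
      by_cases hx : x ∈ Ω <;> simp [hx]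
    have l3 := (tendsto_finsetSum Finset.univ fun i _ => l2 i).neg
    simp_rw [← e1] at l3
    have e2 : ∫ x, ⟪gradient u x, ψ x⟫ = ∑ i, ∫ x, ⟪gradient u x, b i⟫ * ⟪ψ x, b i⟫ := by
      rw [← integral_finsetSum]
      · congr 1
        ext x
        rw [← b.sum_inner_mul_inner]
        simp_rw [real_inner_comm (ψ x)]
      · intro i _
        have hψc : HasCompactSupport ψ := hc.of_isClosed_subset (isClosed_tsupport _)
          hφ.hasCompactSupport_grad
        refine ((hgc i).mul (hφ.cont_grad.inner
          continuous_const)).integrable_of_hasCompactSupport (hψc.mono fun x hx hx0 => hx ?_)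
        simp [hx0]
    rw [e2, tendsto_nhds_unique l1 l3, neg_neg]

end Mollification

section

theorem zero_le_width {N : ℕ} {D : Set (EuclideanSpace ℝ (Fin N))} {r : ℝ} (hD : D ⊆ ball 0 r)
    (n : EuclideanSpace ℝ (Fin N)) :
    0 ≤ (⨆ x : D, ⟪(x : EuclideanSpace ℝ (Fin N)), n⟫) -
      ⨅ x : D, ⟪(x : EuclideanSpace ℝ (Fin N)), n⟫ := by
  rcases isEmpty_or_nonempty D with h | ⟨⟨x⟩⟩
  · simp [Real.iSup_of_isEmpty, Real.iInf_of_isEmpty]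
  have hb : ∀ y : D, |⟪(y : EuclideanSpace ℝ (Fin N)), n⟫| ≤ r * ‖n‖ := fun y =>
    (abs_real_inner_le_norm _ _).trans (by
      gcongr
      exact (mem_ball_zero_iff.1 (hD y.2)).le)
  exact sub_nonneg.2 ((ciInf_le ⟨-(r * ‖n‖), by rintro _ ⟨y, rfl⟩; exact (abs_le.1 (hb y)).1⟩ x).trans
    (le_ciSup ⟨r * ‖n‖, by rintro _ ⟨y, rfl⟩; exact (abs_le.1 (hb y)).2⟩ x))

theorem MD_nonneg {N : ℕ} {D : Set (EuclideanSpace ℝ (Fin N))} {r : ℝ} (hD : D ⊆ ball 0 r) :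
    0 ≤ MD N D :=
  Real.iInf_nonneg fun e => zero_le_width hD e

theorem exists_abs_inner_of_lt_MD {N : ℕ} {D : Set (EuclideanSpace ℝ (Fin N))} {r c : ℝ}
    (hD : D ⊆ ball 0 r) (hne : D.Nonempty) (hc : 2 * c < MD N D) {n : EuclideanSpace ℝ (Fin N)}
    (hn : ‖n‖ = 1) : ∃ x ∈ D, c ≤ |⟪x, n⟫| := by
  by_contra! h
  have := hne.to_subtype
  have h1 : MD N D ≤ _ := ciInf_le (f := fun e : {e : EuclideanSpace ℝ (Fin N) // ‖e‖ = 1} =>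
    (⨆ x : D, ⟪(x : EuclideanSpace ℝ (Fin N)), (e : EuclideanSpace ℝ (Fin N))⟫) -
      ⨅ x : D, ⟪(x : EuclideanSpace ℝ (Fin N)), (e : EuclideanSpace ℝ (Fin N))⟫)
    ⟨0, by rintro _ ⟨e, rfl⟩; exact zero_le_width hD e⟩ ⟨n, hn⟩
  have h2 : ⨆ x : D, ⟪(x : EuclideanSpace ℝ (Fin N)), n⟫ ≤ c :=
    ciSup_le fun x => (abs_lt.1 (h x x.2)).2.le
  have h3 : -c ≤ ⨅ x : D, ⟪(x : EuclideanSpace ℝ (Fin N)), n⟫ :=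
    le_ciInf fun x => (abs_lt.1 (h x x.2)).1.le
  simp only at h1
  linarith

theorem Thick.of_lt_deltaFn {N : ℕ} {u : EuclideanSpace ℝ (Fin N) → ℝ} (h0 : u 0 = 0)
    (hg0 : gradient u 0 = 0) {r c : ℝ} (hr : 0 < r) (h : 2 * c < deltaFn N u r) :
    Thick c (sc r u) (scg r (gradient u)) := by
  intro n hn
  rw [deltaFn, lt_div_iff₀ hr, mul_assoc] at h
  obtain ⟨x, ⟨⟨hx, hgx⟩, hxr⟩, hxn⟩ := exists_abs_inner_of_lt_MD inter_subset_right
    (show ({x | u x = 0 ∧ gradient u x = 0} ∩ ball 0 r).Nonempty from ⟨0, ⟨h0, hg0⟩, mem_ball_self hr⟩) h hn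
  refine ⟨r⁻¹ • x, ?_, ?_, ?_, ?_⟩
  · rw [norm_smul, norm_inv, Real.norm_of_nonneg hr.le, inv_mul_le_one₀ hr]
    exact (mem_ball_zero_iff.1 hxr).le
  · rw [real_inner_smul_left, abs_mul, abs_inv, abs_of_pos hr, ← div_eq_inv_mul, le_div_iff₀ hr]
    exact hxn
  · rw [sc, smul_inv_smul₀ hr.ne', hx, mul_zero]
  · rw [scg, smul_inv_smul₀ hr.ne', hgx, smul_zero]

theorem exists_seq_lt_of_pos_limsup {f : ℝ → ℝ} (hf : ∀ r > 0, 0 ≤ f r)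
    (h : 0 < limsup f (nhdsWithin 0 (Ioi 0))) :
    ∃ c > 0, ∃ r : ℕ → ℝ, (∀ j, 0 < r j) ∧ Tendsto r atTop (nhds 0) ∧ ∀ j, c < f (r j) := by
  obtain ⟨c, hc, hcl⟩ := exists_between h
  have hpos : ∀ᶠ r : ℝ in nhdsWithin 0 (Ioi 0), 0 < r := self_mem_nhdsWithin
  have hb : IsCoboundedUnder (· ≤ ·) (nhdsWithin (0 : ℝ) (Ioi 0)) f :=
    IsBoundedUnder.isCoboundedUnder_le ⟨0, eventually_map.2 (hpos.mono hf)⟩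
  obtain ⟨r, hr, h2⟩ := exists_seq_forall_of_frequently
    ((frequently_lt_of_lt_limsup hb hcl).and_eventually hpos)
  exact ⟨c, hc, r, fun j => (h2 j).2, hr.mono_right nhdsWithin_le_nhds, fun j => (h2 j).1⟩

theorem MemP.sol {N : ℕ} {M : ℝ} {Ω : Set (EuclideanSpace ℝ (Fin N))}
    {u : EuclideanSpace ℝ (Fin N) → ℝ} (h : MemP N 1 0 M Ω u) : Sol u (gradient u) Ω where
  isOpen := h.1
  isC1 := isC1_gradient h.2.1
  weak := WeakLap.of_smooth h.2.1 h.1 isOpen_ball (EuclideanSpace.basisFun (Fin N) ℝ)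
    fun φ hφ hs => by simpa [lap] using h.2.2.1 φ hφ hs
  zero x hx hxΩ := h.2.2.2.1 x ⟨hx, hxΩ⟩

end

/-- positive upper density of the zero set forces local nonnegativity. -/
theorem nonneg_near_origin (N : ℕ) (hN : 2 ≤ N) (M : ℝ) (hM : 0 < M)
    (Ω : Set (EuclideanSpace ℝ (Fin N))) (u : EuclideanSpace ℝ (Fin N) → ℝ)
    (hu : MemP N 1 0 M Ω u)
    (hδ : 0 < Filter.limsup (fun r => deltaFn N u r) (nhdsWithin 0 (Set.Ioi 0))) :
    ∃ ρ : ℝ, 0 < ρ ∧ ∀ x ∈ ball (0 : EuclideanSpace ℝ (Fin N)) ρ, 0 ≤ u x := by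
  have : Nonempty (Fin N) := ⟨⟨0, by lia⟩⟩
  have h0 : (0 : EuclideanSpace ℝ (Fin N)) ∉ Ω := by
    simpa [hu.1.interior_eq] using hu.2.2.2.2.2.2
  obtain ⟨hu0, hg0⟩ := hu.sol.zero 0 (mem_ball_self one_pos) h0
  obtain ⟨c, hc, r, hr, hr0, hcr⟩ := exists_seq_lt_of_pos_limsup
    (fun r hr => div_nonneg (MD_nonneg inter_subset_right) hr.le) hδ
  exact hu.sol.exists_nonneg_ball hu0 hg0 hr hr0 (half_pos hc) fun j =>
    Thick.of_lt_deltaFn hu0 hg0 (hr j) ((mul_div_cancel₀ c two_ne_zero).trans_lt (hcr j))
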